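/- arXiv:1903.03870 — 3 statements merged into one kernel-verified Lean document; each statement's English description precedes it below -/
import Mathlib

section
/- There exists a Dedekind domain D whose ideal class group ClassGroup D is isomorphic to ℤ/6ℤ and such that D is an HFD but not an IDPD. -/
/-- An integral domain (here: commutative ring) is *atomic* if every nonzero nonunit
is a finite product of irreducible elements. -/
def IsAtomicDomain (D : Type*) [CommRing D] : Prop :=
  ∀ z : D, z ≠ 0 → ¬IsUnit z →
    ∃ l : Multiset D, (∀ p ∈ l, Irreducible p) ∧ l.prod = z

/-- An *irreducible divisor pair domain (IDPD)* is an atomic integral domain such that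
for every nonzero nonunit `z` and every pair of non-associate irreducible divisors
`p, q` of `z`, there are irreducibles `p', q'` with `p*p' ~ q*q' ∣ z`. -/
def IsIDPD (D : Type*) [CommRing D] : Prop :=
  IsDomain D ∧ IsAtomicDomain D ∧
    ∀ z p q : D, z ≠ 0 → ¬IsUnit z → Irreducible p → Irreducible q →
      p ∣ z → q ∣ z → ¬Associated p q →
      ∃ p' q' : D, Irreducible p' ∧ Irreducible q' ∧
        Associated (p * p') (q * q') ∧ q * q' ∣ z

/-- A *half-factorial domain (HFD)* is an atomic integral domain in which any two
irreducible factorizations of the same element have the same length. -/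
def IsHFD (D : Type*) [CommRing D] : Prop :=
  IsDomain D ∧ IsAtomicDomain D ∧
    ∀ s t : Multiset D, (∀ p ∈ s, Irreducible p) → (∀ q ∈ t, Irreducible q) →
      s.prod = t.prod → Multiset.card s = Multiset.card t


open Polynomial in
/-- Hensel's lemma for simple roots of not necessarily monic polynomials over power series. -/
theorem hensel_adic {R : Type*} [CommRing R] (I : Ideal R) [IsAdicComplete I R]
    (f : R[X]) (a₀ : R) (h₁ : f.eval a₀ ∈ I)
    (h₂ : IsUnit (Ideal.Quotient.mk I (f.derivative.eval a₀))) :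
    ∃ a : R, f.IsRoot a ∧ a - a₀ ∈ I := by
  classical
  let f' := derivative f
  let c : ℕ → R := fun n => Nat.recOn n a₀ fun _ b => b - f.eval b * Ring.inverse (f'.eval b)
  have hc : ∀ n, c (n + 1) = c n - f.eval (c n) * Ring.inverse (f'.eval (c n)) := by
    intro n
    simp only [c]
  have hc_mod : ∀ n, c n ≡ a₀ [SMOD I] := by
    intro n
    induction n with
    | zero => rfl
    | succ n ih => ?_
    rw [hc, sub_eq_add_neg, ← add_zero a₀]
    refine ih.add ?_
    rw [SModEq.zero, Ideal.neg_mem_iff]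
    refine I.mul_mem_right _ ?_
    rw [← SModEq.zero] at h₁ ⊢
    exact (ih.eval f).trans h₁
  have hf'c : ∀ n, IsUnit (f'.eval (c n)) := by
    intro n
    have := isLocalHom_of_le_jacobson_bot I (IsAdicComplete.le_jacobson_bot I)
    apply IsUnit.of_map (Ideal.Quotient.mk I)
    convert! h₂ using 1
    exact SModEq.def.mp ((hc_mod n).eval _)
  have hfcI : ∀ n, f.eval (c n) ∈ I ^ (n + 1) := by
    intro n
    induction n with
    | zero => simpa only [Nat.rec_zero, zero_add, pow_one] using! h₁
    | succ n ih => ?_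
    rw [← taylor_eval_sub (c n), hc, sub_eq_add_neg, sub_eq_add_neg,
      add_neg_cancel_comm]
    rw [eval_eq_sum, sum_over_range' _ _ _ (lt_add_of_pos_right _ zero_lt_two), ←
      Finset.sum_range_add_sum_Ico _ (Nat.le_add_left _ _)]
    swap
    · intro i
      rw [zero_mul]
    refine Ideal.add_mem _ ?_ ?_
    · rw [← one_add_one_eq_two, Finset.sum_range_succ, Finset.range_one, Finset.sum_singleton,
        taylor_coeff_zero, taylor_coeff_one, pow_zero, pow_one, mul_one, mul_neg,
        mul_left_comm, Ring.mul_inverse_cancel _ (hf'c n), mul_one, add_neg_cancel]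
      exact Ideal.zero_mem _
    · refine Submodule.sum_mem _ ?_
      simp only [Finset.mem_Ico]
      rintro i ⟨h2i, _⟩
      have aux : n + 2 ≤ i * (n + 1) := by trans 2 * (n + 1) <;> nlinarith only [h2i]
      refine Ideal.mul_mem_left _ _ (Ideal.pow_le_pow_right aux ?_)
      rw [pow_mul']
      exact Ideal.pow_mem_pow ((Ideal.neg_mem_iff _).2 <| Ideal.mul_mem_right _ _ ih) _
  have aux : ∀ m n, m ≤ n → c m ≡ c n [SMOD (I ^ m • ⊤ : Ideal R)] := by
    intro m n hmn
    rw [← Ideal.one_eq_top, Ideal.smul_eq_mul, mul_one]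
    obtain ⟨k, rfl⟩ := Nat.exists_eq_add_of_le hmn
    clear hmn
    induction k with
    | zero => rw [add_zero]
    | succ k ih => ?_
    rw [← add_assoc, hc, ← add_zero (c m), sub_eq_add_neg]
    refine ih.add ?_
    symm
    rw [SModEq.zero, Ideal.neg_mem_iff]
    refine Ideal.mul_mem_right _ _ (Ideal.pow_le_pow_right ?_ (hfcI _))
    rw [add_assoc]
    exact le_self_add
  obtain ⟨a, ha⟩ := IsPrecomplete.prec' c (aux _ _)
  refine ⟨a, ?_, ?_⟩
  · show f.IsRoot a
    suffices ∀ n, f.eval a ≡ 0 [SMOD (I ^ n • ⊤ : Ideal R)] by exact IsHausdorff.haus' _ this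
    intro n
    specialize ha n
    rw [← Ideal.one_eq_top, Ideal.smul_eq_mul, mul_one] at ha ⊢
    refine (ha.symm.eval f).trans ?_
    rw [SModEq.zero]
    exact Ideal.pow_le_pow_right le_self_add (hfcI _)
  · show a - a₀ ∈ I
    specialize ha (0 + 1)
    rw [hc, pow_one, ← Ideal.one_eq_top, Ideal.smul_eq_mul, mul_one, sub_eq_add_neg] at ha
    rw [← SModEq.sub_mem, ← add_zero a₀]
    refine ha.symm.trans (SModEq.rfl.add ?_)
    rw [SModEq.zero, Ideal.neg_mem_iff]
    exact Ideal.mul_mem_right _ _ h₁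

theorem hensel_ps (f : Polynomial (PowerSeries ℂ)) (a₀ : ℂ)
    (h₁ : (f.map (PowerSeries.constantCoeff (R := ℂ))).eval a₀ = 0)
    (h₂ : (f.derivative.map (PowerSeries.constantCoeff (R := ℂ))).eval a₀ ≠ 0) :
    ∃ a : PowerSeries ℂ, f.eval a = 0 ∧ PowerSeries.constantCoeff a = a₀ := by
  have key : ∀ g : Polynomial (PowerSeries ℂ),
      PowerSeries.constantCoeff (g.eval (PowerSeries.C a₀)) =
      (g.map (PowerSeries.constantCoeff (R := ℂ))).eval a₀ := by
    intro g
    rw [Polynomial.eval_map, ← Polynomial.eval₂_at_apply]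
    simp
  obtain ⟨a, ha, ha'⟩ := hensel_adic (Ideal.span {(PowerSeries.X : PowerSeries ℂ)}) f
    (PowerSeries.C a₀) (by
      rw [Ideal.mem_span_singleton, PowerSeries.X_dvd_iff, key, h₁]) (by
      apply IsUnit.map
      rw [PowerSeries.isUnit_iff_constantCoeff, key]
      exact isUnit_iff_ne_zero.2 h₂)
  refine ⟨a, ha, ?_⟩
  rw [Ideal.mem_span_singleton, PowerSeries.X_dvd_iff, map_sub, sub_eq_zero] at ha'
  simpa using ha'

theorem newton_puiseux (k : ℕ) : ∀ (f : Polynomial (PowerSeries ℂ)) (a : ℂ),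
    f.map (PowerSeries.constantCoeff (R := ℂ)) ≠ 0 →
    (f.map (PowerSeries.constantCoeff (R := ℂ))).rootMultiplicity a = k → 0 < k →
    ∃ (N : ℕ) (hN : N ≠ 0) (r : PowerSeries ℂ),
      (f.map (PowerSeries.expand (R := ℂ) N hN : PowerSeries ℂ →+* PowerSeries ℂ)).eval r = 0 := by
  induction k using Nat.strong_induction_on with
  | _ k ih =>
  intro f a hf hk hk0
  classical
  set cc := (PowerSeries.constantCoeff (R := ℂ)) with hcc
  -- a root of the (k-1)-st derivative
  obtain ⟨α, hα, hαa⟩ : ∃ α : PowerSeries ℂ,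
      (Polynomial.derivative^[k-1] f).eval α = 0 ∧ cc α = a := by
    apply hensel_ps
    · rw [← Polynomial.iterate_derivative_map]
      exact Polynomial.isRoot_iterate_derivative_of_lt_rootMultiplicity (by rw [← hcc, hk]; omega)
    · rw [← Function.iterate_succ_apply' (f := Polynomial.derivative), Nat.succ_eq_add_one,
        Nat.sub_add_cancel hk0, ← Polynomial.iterate_derivative_map, ← hcc]
      have := Polynomial.eval_iterate_derivative_rootMultiplicity (p := f.map cc) (t := a)
      rw [hk] at this
      rw [this]
      have h2 := Polynomial.eval_divByMonic_pow_rootMultiplicity_ne_zero a hf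
      rw [hk] at h2
      simp only [nsmul_eq_mul]
      exact mul_ne_zero (by exact_mod_cast Nat.factorial_ne_zero k) h2
  set F := Polynomial.taylor α f with hF
  have hFmap : F.map cc = (f.map cc).comp (Polynomial.X + Polynomial.C a) := by
    rw [hF, Polynomial.taylor_apply, Polynomial.map_comp]
    simp [hαa]
  have htr : (F.map cc).natTrailingDegree = k := by
    rw [hFmap, ← Polynomial.rootMultiplicity_eq_natTrailingDegree, hk]
  have hF0 : F.map cc ≠ 0 := by
    rw [hFmap, ← Polynomial.taylor_apply]
    intro h
    exact hf (by simpa using h)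
  have hlow : ∀ j < k, cc (F.coeff j) = 0 := by
    intro j hj
    rw [← Polynomial.coeff_map]
    exact Polynomial.coeff_eq_zero_of_lt_natTrailingDegree (by omega)
  have hFk : cc (F.coeff k) ≠ 0 := by
    rw [← Polynomial.coeff_map, ← htr]
    exact Polynomial.trailingCoeff_nonzero_iff_nonzero.2 hF0
  have hFk1 : F.coeff (k-1) = 0 := by
    rw [hF, Polynomial.taylor_coeff]
    rw [← Polynomial.factorial_smul_hasseDeriv] at hα
    have h3 : (((k-1).factorial : ℕ) : PowerSeries ℂ) * (Polynomial.hasseDeriv (k-1) f).eval α = 0 := by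
      rw [← hα, LinearMap.smul_apply, nsmul_eq_mul, Polynomial.eval_mul, Polynomial.eval_natCast]
    refine (mul_eq_zero.1 h3).resolve_left ?_
    intro h
    have h4 := congrArg cc h
    rw [map_natCast, map_zero] at h4
    exact Nat.factorial_ne_zero _ (by exact_mod_cast h4)
  by_cases hall : ∀ j < k, F.coeff j = 0
  · refine ⟨1, one_ne_zero, α, ?_⟩
    have := hall 0 hk0
    rw [hF, Polynomial.taylor_coeff_zero] at this
    rw [PowerSeries.expand_one]
    convert this
    exact Polynomial.map_id
  push Not at hall
  -- choose the Newton slope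
  set e : ℕ → ℕ := fun j => (F.coeff j).order.toNat with he
  set S := (Finset.range k).filter (fun j => F.coeff j ≠ 0) with hS
  have hSne : S.Nonempty := by
    obtain ⟨j, hj, hj'⟩ := hall
    exact ⟨j, by simp [hS, hj, hj']⟩
  obtain ⟨j0, hj0S, hmin⟩ := Finset.exists_min_image S
    (fun j => e j * (k.factorial / (k - j))) hSne
  set M := e j0 * (k.factorial / (k - j0)) with hM
  simp only [hS, Finset.mem_filter, Finset.mem_range] at hj0S hmin
  obtain ⟨hj0, hj0'⟩ := hj0S
  have hdiv : ∀ j < k, (k.factorial / (k - j)) * (k - j) = k.factorial := by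
    intro j hj
    exact Nat.div_mul_cancel (Nat.dvd_factorial (by omega) (by omega))
  have hdec : ∀ j, F.coeff j ≠ 0 → ∃ u : PowerSeries ℂ, F.coeff j = PowerSeries.X ^ (e j) * u ∧
      cc u ≠ 0 := by
    intro j hj
    obtain ⟨u, hu⟩ := PowerSeries.X_pow_order_dvd (φ := F.coeff j)
    refine ⟨u, hu, ?_⟩
    have := PowerSeries.coeff_order hj
    rw [hu, PowerSeries.coeff_X_pow_mul'] at this
    rw [← hu] at this
    simpa using this
  have he0 : 0 < e j0 := by
    obtain ⟨u, hu, hu'⟩ := hdec j0 hj0'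
    have := hlow j0 hj0
    by_contra h
    rw [hu, show e j0 = 0 by omega] at this
    simp at this
    exact hu' this
  have hkf : k.factorial ≠ 0 := Nat.factorial_ne_zero k
  have hM0 : 0 < M := by
    apply Nat.mul_pos he0
    rw [Nat.pos_iff_ne_zero]
    intro h
    have := hdiv j0 hj0
    rw [h] at this
    omega
  set ex : PowerSeries ℂ →+* PowerSeries ℂ :=
    ((PowerSeries.expand (R := ℂ) k.factorial hkf : PowerSeries ℂ →ₐ[ℂ] PowerSeries ℂ) :
      PowerSeries ℂ →+* PowerSeries ℂ) with hex
  have hexX : ex PowerSeries.X = PowerSeries.X ^ k.factorial := PowerSeries.expand_X _ hkf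
  have hexcc : ∀ x, cc (ex x) = cc x := fun x => PowerSeries.constantCoeff_expand _ hkf x
  have hMk : ∀ j < k, F.coeff j ≠ 0 → M * k ≤ k.factorial * e j + M * j := by
    intro j hj hj'
    have h1 : M * (k - j) ≤ e j * (k.factorial / (k - j)) * (k - j) :=
      Nat.mul_le_mul_right _ (hmin j ⟨hj, hj'⟩)
    rw [mul_assoc (e j), hdiv j hj] at h1
    clear_value M
    obtain ⟨d, rfl⟩ : ∃ d, k = j + d := ⟨k - j, by omega⟩
    simp only [Nat.add_sub_cancel_left] at h1
    nlinarith
  have hMj0 : M * k = k.factorial * e j0 + M * j0 := by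
    have h1 : M * (k - j0) = e j0 * k.factorial := by
      rw [hM, mul_assoc, hdiv j0 hj0]
    have h2 : M * k = M * (k - j0) + M * j0 := by
      rw [← mul_add]; congr 1; omega
    rw [h2, h1, mul_comm (e j0)]
  clear_value M
  obtain ⟨G, hG⟩ : Polynomial.C ((PowerSeries.X : PowerSeries ℂ) ^ (M * k)) ∣
      (F.map ex).comp (Polynomial.C (PowerSeries.X ^ M) * Polynomial.X) := by
    rw [Polynomial.C_dvd_iff_dvd_coeff]
    intro j
    rw [Polynomial.comp_C_mul_X_coeff, Polynomial.coeff_map, ← pow_mul]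
    by_cases hj : F.coeff j = 0
    · simp [hj]
    by_cases hjk : j < k
    · obtain ⟨u, hu, -⟩ := hdec j hj
      rw [hu, map_mul, map_pow, hexX, ← pow_mul, mul_right_comm (PowerSeries.X ^ _), ← pow_add]
      exact Dvd.dvd.mul_right (pow_dvd_pow _ (hMk j hjk hj)) _
    · exact Dvd.dvd.mul_left (pow_dvd_pow _ (Nat.mul_le_mul_left _ (by omega))) _
  have hGc : ∀ j, ex (F.coeff j) * PowerSeries.X ^ (M * j) =
      PowerSeries.X ^ (M * k) * G.coeff j := by
    intro j
    have := congrArg (fun p => Polynomial.coeff p j) hG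
    simpa only [Polynomial.comp_C_mul_X_coeff, Polynomial.coeff_map, ← pow_mul,
      Polynomial.coeff_C_mul] using this
  have hXne : ∀ n, (PowerSeries.X : PowerSeries ℂ) ^ n ≠ 0 := fun n => pow_ne_zero _ PowerSeries.X_ne_zero
  have hGk : cc (G.coeff k) ≠ 0 := by
    have := hGc k
    rw [mul_comm] at this
    rw [← mul_left_cancel₀ (hXne _) this, hexcc]
    exact hFk
  have hGhi : ∀ j, k < j → cc (G.coeff j) = 0 := by
    intro j hj
    have := hGc j
    obtain ⟨d, rfl⟩ : ∃ d, j = k + (d + 1) := ⟨j - k - 1, by omega⟩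
    rw [mul_add, pow_add, mul_left_comm] at this
    rw [← mul_left_cancel₀ (hXne _) this, map_mul, map_pow, hcc, PowerSeries.constantCoeff_X,
      zero_pow, mul_zero]
    positivity
  have hGk1 : G.coeff (k-1) = 0 := by
    have := hGc (k-1)
    rw [hFk1] at this
    simpa [hXne, PowerSeries.X_ne_zero] using this
  have hGj0 : cc (G.coeff j0) ≠ 0 := by
    obtain ⟨u, hu, hu'⟩ := hdec j0 hj0'
    have := hGc j0
    rw [hMj0, hu, map_mul, map_pow, hexX, ← pow_mul, mul_right_comm (PowerSeries.X ^ _), ← pow_add] at this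
    rw [← mul_left_cancel₀ (hXne _) this, hexcc]
    exact hu'
  have hGdeg : (G.map cc).natDegree = k := by
    apply le_antisymm
    · rw [Polynomial.natDegree_le_iff_coeff_eq_zero]
      intro j hj
      rw [Polynomial.coeff_map, hGhi j hj]
    · apply Polynomial.le_natDegree_of_ne_zero
      rwa [Polynomial.coeff_map]
  have hG0 : G.map cc ≠ 0 := by
    intro h
    rw [h] at hGdeg
    simp at hGdeg
    omega
  obtain ⟨b, hb⟩ := IsAlgClosed.exists_root (G.map cc) (by
    rw [Polynomial.degree_eq_natDegree hG0, hGdeg]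
    exact_mod_cast hk0.ne')
  have hbpos : 0 < (G.map cc).rootMultiplicity b := (Polynomial.rootMultiplicity_pos hG0).2 hb
  have hble : (G.map cc).rootMultiplicity b < k := by
    have hdvd := Polynomial.pow_rootMultiplicity_dvd (G.map cc) b
    have hle : (G.map cc).rootMultiplicity b ≤ k := by
      have := Polynomial.natDegree_le_of_dvd hdvd hG0
      rwa [Polynomial.natDegree_pow, Polynomial.natDegree_X_sub_C, mul_one, hGdeg] at this
    rcases hle.lt_or_eq with h | h
    · exact h
    exfalso
    rw [h] at hdvd
    obtain ⟨q, hq⟩ := hdvd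
    have hq0 : q ≠ 0 := by rintro rfl; simp at hq; exact hG0 hq
    have hqd : q.natDegree = 0 := by
      have := congrArg Polynomial.natDegree hq
      rw [Polynomial.natDegree_mul (pow_ne_zero _ (Polynomial.X_sub_C_ne_zero b)) hq0,
        Polynomial.natDegree_pow, Polynomial.natDegree_X_sub_C, hGdeg] at this
      omega
    obtain ⟨c, rfl⟩ : ∃ c, q = Polynomial.C c := ⟨_, Polynomial.eq_C_of_natDegree_eq_zero hqd⟩
    have hc0 : c ≠ 0 := by rintro rfl; simp at hq0
    have h1 : (G.map cc).coeff (k-1) = 0 := by rw [Polynomial.coeff_map, hGk1, map_zero]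
    have h2 : (G.map cc).coeff j0 ≠ 0 := by rwa [Polynomial.coeff_map]
    rw [hq, Polynomial.coeff_mul_C, sub_eq_add_neg, ← Polynomial.C_neg,
      Polynomial.coeff_X_add_C_pow] at h1 h2
    rw [show k - (k - 1) = 1 by omega] at h1
    have hkc : ((k.choose (k-1) : ℕ) : ℂ) ≠ 0 := by
      exact_mod_cast (Nat.choose_pos (by omega)).ne'
    have hb0 : b = 0 := by simpa [hc0, hkc] using h1
    rw [hb0, neg_zero, zero_pow (by omega)] at h2
    simp at h2
  obtain ⟨N', hN', r', hr'⟩ := ih _ hble G b hG0 rfl hbpos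
  set ex' : PowerSeries ℂ →+* PowerSeries ℂ :=
    ((PowerSeries.expand (R := ℂ) N' hN' : PowerSeries ℂ →ₐ[ℂ] PowerSeries ℂ) :
      PowerSeries ℂ →+* PowerSeries ℂ) with hex'
  refine ⟨N' * k.factorial, Nat.mul_ne_zero hN' hkf,
    ex' (PowerSeries.X ^ M) * r' + ex' (ex α), ?_⟩
  have hcomp : ((PowerSeries.expand (R := ℂ) (N' * k.factorial) (Nat.mul_ne_zero hN' hkf) :
      PowerSeries ℂ →ₐ[ℂ] PowerSeries ℂ) : PowerSeries ℂ →+* PowerSeries ℂ) = ex'.comp ex := by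
    ext1 x
    exact PowerSeries.expand_mul _ hN' _ hkf x
  rw [hcomp, ← Polynomial.map_map]
  have hfF : f = F.comp (Polynomial.X - Polynomial.C α) := by
    rw [hF, Polynomial.taylor_apply, Polynomial.comp_assoc]
    simp
  have hG2 := congrArg (fun p => (p.map ex').eval r') hG
  simp only [Polynomial.map_mul, Polynomial.eval_mul, hr', mul_zero] at hG2
  rw [hfF]
  simp only [Polynomial.map_comp, Polynomial.map_mul, Polynomial.map_C, Polynomial.map_X,
    Polynomial.eval_comp, Polynomial.eval_mul, Polynomial.eval_C, Polynomial.eval_X,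
    Polynomial.map_sub, Polynomial.eval_sub, add_sub_cancel_right] at hG2 ⊢
  exact hG2

abbrev HH := HahnSeries ℚ ℂ

/-- the map `j ↦ j / b` -/
noncomputable def divHom (b : ℕ) : ℤ →+ ℚ where
  toFun j := (j : ℚ) / b
  map_zero' := by simp
  map_add' x y := by push_cast; ring

theorem divHom_le (b : ℕ) (hb : b ≠ 0) (g g' : ℤ) : divHom b g ≤ divHom b g' ↔ g ≤ g' := by
  have : (0 : ℚ) < b := by exact_mod_cast Nat.pos_of_ne_zero hb
  simp only [divHom, AddMonoidHom.coe_mk, ZeroHom.coe_mk]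
  rw [div_le_div_iff_of_pos_right this]
  exact Int.cast_le

theorem divHom_inj (b : ℕ) (hb : b ≠ 0) : Function.Injective (divHom b) := by
  intro x y h
  exact le_antisymm ((divHom_le b hb _ _).1 h.le) ((divHom_le b hb _ _).1 h.ge)

/-- Laurent series in `t^(1/b)` -/
noncomputable def EE (b : ℕ) (hb : b ≠ 0) : HahnSeries ℤ ℂ →+* HH :=
  HahnSeries.embDomainRingHom (divHom b) (divHom_inj b hb) (divHom_le b hb)

theorem EE_coeff (b : ℕ) (hb : b ≠ 0) (x : HahnSeries ℤ ℂ) (j : ℤ) :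
    (EE b hb x).coeff ((j : ℚ) / b) = x.coeff j :=
  HahnSeries.embDomain_coeff (f := ⟨⟨divHom b, divHom_inj b hb⟩, divHom_le b hb _ _⟩)

theorem EE_coeff_ne (b : ℕ) (hb : b ≠ 0) (x : HahnSeries ℤ ℂ) (q : ℚ)
    (h : (EE b hb x).coeff q ≠ 0) : ∃ j : ℤ, q = (j : ℚ) / b := by
  by_contra hq
  apply h
  apply HahnSeries.embDomain_of_notMem_range
  rintro ⟨j, hj⟩
  exact hq ⟨j, hj.symm⟩

theorem mem_range_EE (b : ℕ) (hb : b ≠ 0) (x : HH) :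
    (∃ y, EE b hb y = x) ↔ ∀ q, x.coeff q ≠ 0 → ∃ j : ℤ, q = (j : ℚ) / b := by
  constructor
  · rintro ⟨y, rfl⟩ q
    exact EE_coeff_ne b hb y q
  · intro h
    have hb' : (0 : ℚ) < b := by exact_mod_cast Nat.pos_of_ne_zero hb
    have hp : (Function.support (fun j : ℤ => x.coeff ((j : ℚ) / b))).IsPWO := by
      rw [Set.isPWO_iff_isWF]
      have h1 : (x.support).IsWF := x.isWF_support
      rw [Set.isWF_iff_no_descending_seq] at h1 ⊢
      intro f hf hr
      refine h1 (fun n => ((f n : ℤ) : ℚ) / b) ?_ ?_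
      · intro m n hmn
        have := hf hmn
        show ((f n : ℤ) : ℚ) / b < ((f m : ℤ) : ℚ) / b
        gcongr
      · intro n
        exact hr n
    refine ⟨⟨_, hp⟩, ?_⟩
    ext q
    by_cases hq : ∃ j : ℤ, q = (j : ℚ) / b
    · obtain ⟨j, rfl⟩ := hq
      rw [EE_coeff]
    · rw [not_imp_comm.1 (h q) hq]
      by_contra h2
      exact hq (EE_coeff_ne b hb _ q h2)

/-- power series in `t^(1/b)` -/
noncomputable def PP (b : ℕ) (hb : b ≠ 0) : PowerSeries ℂ →+* HH :=
  (EE b hb).comp (HahnSeries.ofPowerSeries ℤ ℂ)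

theorem PP_expand (b N : ℕ) (hb : b ≠ 0) (hN : N ≠ 0) (x : PowerSeries ℂ) :
    PP (b * N) (mul_ne_zero hb hN) (PowerSeries.expand N hN x) = PP b hb x := by
  have hbq : (b : ℚ) ≠ 0 := by exact_mod_cast hb
  have hNq : (N : ℚ) ≠ 0 := by exact_mod_cast hN
  have hz : ∀ (y : PowerSeries ℂ) (j : ℤ), ¬ 0 ≤ j →
      (HahnSeries.ofPowerSeries ℤ ℂ y).coeff j = 0 := by
    intro y j hj
    rw [HahnSeries.ofPowerSeries_apply]
    apply HahnSeries.embDomain_of_notMem_range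
    rintro ⟨n, hn⟩
    apply hj
    rw [← hn]
    exact Int.natCast_nonneg n
  have main : ∀ j : ℤ, (HahnSeries.ofPowerSeries ℤ ℂ (PowerSeries.expand N hN x)).coeff (j * N) =
      (HahnSeries.ofPowerSeries ℤ ℂ x).coeff j := by
    intro j
    by_cases hj : 0 ≤ j
    · obtain ⟨n, rfl⟩ := Int.eq_ofNat_of_zero_le hj
      rw [HahnSeries.ofPowerSeries_apply_coeff]
      rw [show ((n : ℤ) * (N : ℤ)) = (((N * n : ℕ) : ℕ) : ℤ) by push_cast; ring]
      rw [HahnSeries.ofPowerSeries_apply_coeff, PowerSeries.coeff_expand_mul]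
    · rw [hz _ _ hj, hz]
      intro h
      apply hj
      have : (0 : ℤ) < N := by exact_mod_cast Nat.pos_of_ne_zero hN
      exact nonneg_of_mul_nonneg_left h this
  ext q
  simp only [PP, RingHom.comp_apply]
  by_cases hq : ∃ j : ℤ, q = (j : ℚ) / ((b * N : ℕ) : ℚ)
  · obtain ⟨j, rfl⟩ := hq
    rw [EE_coeff]
    by_cases hd : (N : ℤ) ∣ j
    · obtain ⟨i, rfl⟩ := hd
      rw [mul_comm, main, ← EE_coeff b hb]
      congr 1
      push_cast
      field_simp
    · have h1 : (HahnSeries.ofPowerSeries ℤ ℂ (PowerSeries.expand N hN x)).coeff j = 0 := by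
        by_cases hj : 0 ≤ j
        · obtain ⟨n, rfl⟩ := Int.eq_ofNat_of_zero_le hj
          rw [HahnSeries.ofPowerSeries_apply_coeff, PowerSeries.coeff_expand_of_not_dvd]
          intro h
          exact hd (by exact_mod_cast h)
        · exact hz _ _ hj
      rw [h1]
      by_contra h2
      obtain ⟨i, hi⟩ := EE_coeff_ne b hb _ _ (Ne.symm h2)
      apply hd
      refine ⟨i, ?_⟩
      push_cast at hi
      field_simp at hi
      exact_mod_cast hi
  · trans 0
    · by_contra h2
      exact hq (EE_coeff_ne _ _ _ q h2)
    · by_contra h2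
      obtain ⟨j, hj⟩ := EE_coeff_ne _ _ _ q (Ne.symm h2)
      apply hq
      refine ⟨j * N, ?_⟩
      rw [hj]
      push_cast
      field_simp

theorem exists_root_EE (b : ℕ) (hb : b ≠ 0) (f : Polynomial (LaurentSeries ℂ))
    (hf : f.natDegree ≠ 0) : ∃ (N : ℕ) (hN : N ≠ 0) (y : HahnSeries ℤ ℂ),
    f.eval₂ (EE b hb) (EE (b * N) (mul_ne_zero hb hN) y) = 0 := by
  obtain ⟨c, hcm, hc⟩ := IsLocalization.integerNormalization_spec (nonZeroDivisors (PowerSeries ℂ)) f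
  set p := IsLocalization.integerNormalization (nonZeroDivisors (PowerSeries ℂ)) f with hp
  have hinj : Function.Injective (algebraMap (PowerSeries ℂ) (LaurentSeries ℂ)) :=
    IsFractionRing.injective _ _
  have hc0 : algebraMap (PowerSeries ℂ) (LaurentSeries ℂ) c ≠ 0 := by
    intro h
    exact nonZeroDivisors.ne_zero hcm (hinj (by rw [h, map_zero]))
  have hc' : p.map (algebraMap (PowerSeries ℂ) (LaurentSeries ℂ)) =
      Polynomial.C (algebraMap (PowerSeries ℂ) (LaurentSeries ℂ) c) * f := by
    rw [hc, ← Polynomial.smul_eq_C_mul]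
    exact (algebraMap_smul (LaurentSeries ℂ) c f).symm
  have hdeg : p.natDegree = f.natDegree := by
    rw [← Polynomial.natDegree_map_eq_of_injective hinj p, hc', Polynomial.natDegree_C_mul hc0]
  have hp0 : p ≠ 0 := by
    rintro h
    rw [h] at hdeg
    simp at hdeg
    exact hf hdeg.symm
  set g := p.integralNormalization with hg
  have hgm : g.Monic := Polynomial.monic_integralNormalization hp0
  have hgd : g.natDegree = f.natDegree := by
    rw [hg, ← hdeg]
    exact Polynomial.natDegree_eq_of_degree_eq Polynomial.degree_integralNormalization
  have hgc : (g.map (PowerSeries.constantCoeff (R := ℂ))).Monic := hgm.map _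
  obtain ⟨a, ha⟩ := IsAlgClosed.exists_root (g.map (PowerSeries.constantCoeff (R := ℂ))) (by
    rw [Polynomial.degree_eq_natDegree hgc.ne_zero, hgm.natDegree_map, hgd]
    exact_mod_cast hf)
  obtain ⟨N, hN, r, hr⟩ := newton_puiseux _ g a hgc.ne_zero rfl
    ((Polynomial.rootMultiplicity_pos hgc.ne_zero).2 ha)
  set φ := PP (b * N) (mul_ne_zero hb hN) with hφ
  have h1 : g.eval₂ (PP b hb) (φ r) = 0 := by
    have := congrArg φ hr
    rw [map_zero, ← Polynomial.eval₂_at_apply, Polynomial.eval₂_map] at this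
    rw [← this]
    congr 1
    ext1 x
    exact (PP_expand b N hb hN x).symm
  have hPinj : Function.Injective (PP b hb) := by
    apply (EE b hb).injective.comp
    exact HahnSeries.ofPowerSeries_injective
  set l := p.leadingCoeff with hl
  have hl0 : PP b hb l ≠ 0 := by
    intro h
    exact hp0 (Polynomial.leadingCoeff_eq_zero.1 (hPinj (by rw [← hl, h, map_zero])))
  obtain ⟨y, hy⟩ : ∃ y, EE (b * N) (mul_ne_zero hb hN) y = (PP b hb l)⁻¹ * φ r := by
    refine ⟨(HahnSeries.ofPowerSeries ℤ ℂ (PowerSeries.expand N hN l))⁻¹ *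
      HahnSeries.ofPowerSeries ℤ ℂ r, ?_⟩
    rw [map_mul, map_inv₀]
    congr 1
    exact congrArg _ (PP_expand b N hb hN l)
  refine ⟨N, hN, y, ?_⟩
  rw [hy]
  have h2 : p.eval₂ (PP b hb) ((PP b hb l)⁻¹ * φ r) = 0 := by
    have h3 := Polynomial.integralNormalization_eval₂_leadingCoeff_mul (p := p) (by omega) (PP b hb)
      ((PP b hb l)⁻¹ * φ r)
    rw [← hl, mul_inv_cancel_left₀ hl0, ← hg, h1] at h3
    have h4 := (mul_eq_zero.1 h3.symm).resolve_left (pow_ne_zero _ hl0)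
    exact h4
  have h5 := congrArg (Polynomial.eval₂ (EE b hb) ((PP b hb l)⁻¹ * φ r)) hc'
  rw [Polynomial.eval₂_map, Polynomial.eval₂_mul, Polynomial.eval₂_C] at h5
  have h6 : (EE b hb).comp (algebraMap (PowerSeries ℂ) (LaurentSeries ℂ)) = PP b hb := rfl
  rw [h6, h2] at h5
  exact (mul_eq_zero.1 h5.symm).resolve_left (by
    exact (map_ne_zero_iff _ (EE b hb).injective).2 hc0)

instance instCharZeroHH : CharZero HH :=
  charZero_of_injective_ringHom (f := (HahnSeries.C : ℂ →+* HH)) HahnSeries.C_injective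

theorem EE_mono (b c : ℕ) (hb : b ≠ 0) (hc : c ≠ 0) (x : HH) (h : ∃ y, EE b hb y = x) :
    ∃ y, EE (b * c) (mul_ne_zero hb hc) y = x := by
  rw [mem_range_EE] at h ⊢
  intro q hq
  obtain ⟨j, rfl⟩ := h q hq
  refine ⟨j * c, ?_⟩
  have hbq : (b : ℚ) ≠ 0 := by exact_mod_cast hb
  have hNq : (c : ℚ) ≠ 0 := by exact_mod_cast hc
  push_cast
  field_simp

/-- coefficientwise complex conjugation -/
noncomputable def conjH : HH →+* HH where
  toFun x := x.map (starRingEnd ℂ)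
  map_one' := by
    ext q
    rw [HahnSeries.map_coeff, HahnSeries.coeff_one]
    split_ifs <;> simp
  map_zero' := by ext q; simp
  map_add' x y := by ext q; simp
  map_mul' x y := by
    ext q
    rw [HahnSeries.map_coeff, HahnSeries.coeff_mul, HahnSeries.coeff_mul, map_sum]
    apply Finset.sum_congr
    · ext ij
      simp
    · intro ij _
      simp

theorem conjH_coeff (x : HH) (q : ℚ) : (conjH x).coeff q = (starRingEnd ℂ) (x.coeff q) := rfl

/-- Puiseux series with denominators prime to 3, complex coefficients -/
noncomputable def KC : Subfield HH where
  carrier := {x | ∃ (b : ℕ) (hb : b ≠ 0), ¬ 3 ∣ b ∧ ∃ y, EE b hb y = x}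
  mul_mem' := by
    rintro x y ⟨b, hb, hb3, hx⟩ ⟨c, hc, hc3, hy⟩
    obtain ⟨x', hx'⟩ := EE_mono b c hb hc x hx
    obtain ⟨y', hy'⟩ := EE_mono c b hc hb y hy
    simp only [mul_comm c b] at hy'
    refine ⟨b * c, mul_ne_zero hb hc, ?_, x' * y', by rw [map_mul, hx', hy']⟩
    rw [Nat.Prime.dvd_mul Nat.prime_three]
    tauto
  add_mem' := by
    rintro x y ⟨b, hb, hb3, hx⟩ ⟨c, hc, hc3, hy⟩
    obtain ⟨x', hx'⟩ := EE_mono b c hb hc x hx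
    obtain ⟨y', hy'⟩ := EE_mono c b hc hb y hy
    simp only [mul_comm c b] at hy'
    refine ⟨b * c, mul_ne_zero hb hc, ?_, x' + y', by rw [map_add, hx', hy']⟩
    rw [Nat.Prime.dvd_mul Nat.prime_three]
    tauto
  one_mem' := ⟨1, one_ne_zero, by decide, 1, map_one _⟩
  zero_mem' := ⟨1, one_ne_zero, by decide, 0, map_zero _⟩
  neg_mem' := by
    rintro x ⟨b, hb, hb3, y, rfl⟩
    exact ⟨b, hb, hb3, -y, map_neg _ _⟩
  inv_mem' := by
    rintro x ⟨b, hb, hb3, y, rfl⟩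
    exact ⟨b, hb, hb3, y⁻¹, map_inv₀ _ _⟩

theorem mem_KC (x : HH) : x ∈ KC ↔ ∃ (b : ℕ) (hb : b ≠ 0), ¬ 3 ∣ b ∧ ∃ y, EE b hb y = x := Iff.rfl

/-- the real version -/
noncomputable def KK : Subfield HH := KC ⊓ RingHom.eqLocusField conjH (RingHom.id HH)

theorem mem_KK (x : HH) : x ∈ KK ↔ x ∈ KC ∧ conjH x = x := Iff.rfl

theorem common_denom (s : Finset ℕ) (f : ℕ → HH) (hf : ∀ i, f i ∈ KC) :
    ∃ (b : ℕ) (hb : b ≠ 0), ¬ 3 ∣ b ∧ ∀ i ∈ s, ∃ y, EE b hb y = f i := by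
  classical
  induction s using Finset.induction_on with
  | empty => exact ⟨1, one_ne_zero, by decide, by simp⟩
  | insert a s ha ih =>
    obtain ⟨b, hb, hb3, h⟩ := ih
    obtain ⟨c, hc, hc3, h'⟩ := hf a
    refine ⟨b * c, mul_ne_zero hb hc, ?_, ?_⟩
    · rw [Nat.Prime.dvd_mul Nat.prime_three]
      tauto
    intro i hi
    rcases Finset.mem_insert.1 hi with rfl | hi
    · have := EE_mono c b hc hb _ h'
      simpa only [mul_comm c b] using this
    · exact EE_mono b c hb hc _ (h i hi)

noncomputable def iH : HH := HahnSeries.C Complex.I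

noncomputable def sH (a : ℕ) : HH := HahnSeries.single (1 / 3 ^ a : ℚ) 1

theorem iH_sq : iH ^ 2 = -1 := by
  rw [iH, ← map_pow, Complex.I_sq, map_neg, map_one]

theorem sH_pow (a : ℕ) : sH a ^ (3 ^ a) = sH 0 := by
  rw [sH, HahnSeries.single_pow, sH]
  simp

theorem conj_iH : conjH iH = - iH := by
  ext q
  rw [conjH_coeff, iH, HahnSeries.coeff_neg, HahnSeries.C_apply, HahnSeries.coeff_single]
  split_ifs <;> simp

theorem iH_mem : iH ∈ KC := by
  refine ⟨1, one_ne_zero, by decide, HahnSeries.C Complex.I, ?_⟩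
  exact HahnSeries.embDomainRingHom_C

theorem tH_mem : sH 0 ∈ KK := by
  refine ⟨⟨1, one_ne_zero, by decide, ?_⟩, ?_⟩
  · rw [mem_range_EE]
    intro q hq
    refine ⟨1, ?_⟩
    rw [sH, HahnSeries.coeff_single] at hq
    by_contra h
    rw [if_neg] at hq
    · exact hq rfl
    · simpa using h
  · show conjH _ = _
    ext q
    rw [conjH_coeff]
    simp only [sH, HahnSeries.coeff_single, RingHom.id_apply]
    split_ifs <;> simp

theorem t_not_cube (x : HH) (hx : x ∈ KC) : x ^ 3 ≠ sH 0 := by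
  intro h
  have hx0 : x ≠ 0 := by
    rintro rfl
    have : (sH 0).order = 1 := by
      rw [sH, HahnSeries.order_single one_ne_zero]; simp
    rw [← h] at this
    simp at this
  have h1 : (x ^ 3).order = 3 • x.order := HahnSeries.order_pow x 3
  rw [h, sH, HahnSeries.order_single one_ne_zero] at h1
  obtain ⟨b, hb, hb3, hx⟩ := hx
  rw [mem_range_EE] at hx
  obtain ⟨j, hj⟩ := hx x.order (HahnSeries.coeff_order_eq_zero.not.2 hx0)
  rw [hj] at h1
  have hbq : (b : ℚ) ≠ 0 := by exact_mod_cast hb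
  have h2 : (b : ℚ) = 3 * j := by
    simp at h1
    field_simp at h1
    exact h1
  have h3 : (b : ℤ) = 3 * j := by exact_mod_cast h2
  apply hb3
  have : (3 : ℤ) ∣ b := ⟨j, h3⟩
  exact_mod_cast this

theorem KC_le (x : HH) (hx : x ∈ KC) : ∃ u v : KK, x = u + iH * v := by
  obtain ⟨b, hb, hb3, y, hy⟩ := hx
  have hconj : conjH x ∈ KC := by
    refine ⟨b, hb, hb3, ?_⟩
    have h := (mem_range_EE b hb x).1 ⟨y, hy⟩
    rw [mem_range_EE]
    intro q hq
    apply h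
    intro h0
    rw [conjH_coeff, h0, map_zero] at hq
    exact hq rfl
  have hx : x ∈ KC := ⟨b, hb, hb3, y, hy⟩
  have hcc : conjH (conjH x) = x := by
    ext q
    rw [conjH_coeff, conjH_coeff, Complex.conj_conj]
  have hi : iH ≠ 0 := by
    intro h
    have := iH_sq
    rw [h] at this
    norm_num at this
  have h2 : (2 : HH) ≠ 0 := two_ne_zero
  have hre : (x + conjH x) / 2 ∈ KK := by
    rw [mem_KK]
    refine ⟨KC.div_mem (KC.add_mem hx hconj) (ofNat_mem KC 2), ?_⟩
    rw [map_div₀, map_add, hcc, add_comm, map_ofNat]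
  have him : (x - conjH x) / (2 * iH) ∈ KK := by
    rw [mem_KK]
    refine ⟨KC.div_mem (KC.sub_mem hx hconj) (KC.mul_mem (ofNat_mem KC 2) iH_mem), ?_⟩
    rw [map_div₀, map_sub, hcc, map_mul, conj_iH, map_ofNat]
    field_simp
    ring
  have : x = (x + conjH x) / 2 + iH * ((x - conjH x) / (2 * iH)) := by
    field_simp
    ring
  exact ⟨⟨_, hre⟩, ⟨_, him⟩, this⟩

theorem KK_no_sqrt (x : KK) : x ^ 2 ≠ -1 := by
  intro h0
  have h1 : (x : HH) ^ 2 = -1 := congrArg (fun z : KK => (z : HH)) h0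
  have h3 : ((x : HH) - iH) * (x + iH) = 0 := by
    have := iH_sq
    linear_combination h1 - this
  have h4 : conjH (x : HH) = x := ((mem_KK _).1 x.2).2
  have hi : iH = 0 := by
    have h2 : (2 : HH) ≠ 0 := two_ne_zero
    rcases mul_eq_zero.1 h3 with h | h
    · have h5 : (x : HH) = iH := by linear_combination h
      rw [h5, conj_iH] at h4
      have : 2 * iH = 0 := by linear_combination - h4
      exact (mul_eq_zero.1 this).resolve_left h2
    · have h5 : (x : HH) = -iH := by linear_combination h
      rw [h5, map_neg, conj_iH] at h4
      have : 2 * iH = 0 := by linear_combination h4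
      exact (mul_eq_zero.1 this).resolve_left h2
  have := iH_sq
  rw [hi] at this
  norm_num at this

/-- restriction of the support -/
noncomputable def filt (S : Set ℚ) (x : HH) : HH where
  coeff := S.indicator x.coeff
  isPWO_support' := x.isPWO_support.mono (by
    intro q hq
    simp only [Function.mem_support, ne_eq, Set.indicator_apply_eq_zero, not_forall] at hq
    obtain ⟨_, h⟩ := hq
    exact h)

theorem filt_coeff (S : Set ℚ) (x : HH) (q : ℚ) : (filt S x).coeff q = S.indicator x.coeff q := rfl

theorem decomp (a c : ℕ) (hc : c ≠ 0) (hc3 : ¬ 3 ∣ c) (x : HH)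
    (hx : ∀ q, x.coeff q ≠ 0 → ∃ j : ℤ, q = (j : ℚ) / ((3 ^ a * c : ℕ) : ℚ)) :
    ∃ y : ℕ → HH, (∀ j, y j ∈ KC) ∧ x = ∑ j ∈ Finset.range (3 ^ a), sH a ^ j * y j := by
  classical
  have hcq : (c : ℚ) ≠ 0 := by exact_mod_cast hc
  set S : ℕ → Set ℚ := fun j => {q | ∃ l : ℤ, q = (j : ℚ) / 3 ^ a + (l : ℚ) / c} with hS
  refine ⟨fun j => HahnSeries.single (-(j : ℚ) / 3 ^ a) 1 * filt (S j) x, ?_, ?_⟩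
  · intro j
    refine ⟨c, hc, hc3, ?_⟩
    rw [mem_range_EE]
    intro q hq
    rw [HahnSeries.coeff_single_mul, one_mul, filt_coeff] at hq
    have hq' : q - -(j : ℚ) / 3 ^ a ∈ S j := by
      by_contra h
      exact hq (Set.indicator_of_notMem h _)
    obtain ⟨l, hl⟩ := hq'
    refine ⟨l, ?_⟩
    linear_combination hl
  · have h1 : ∀ j : ℕ, sH a ^ j * (HahnSeries.single (-(j : ℚ) / 3 ^ a) 1 * filt (S j) x) =
        filt (S j) x := by
      intro j
      rw [← mul_assoc, sH, HahnSeries.single_pow, HahnSeries.single_mul_single]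
      have : j • (1 / 3 ^ a : ℚ) + -(j : ℚ) / 3 ^ a = 0 := by
        rw [nsmul_eq_mul]; ring
      rw [this]
      simp
    simp only [h1]
    ext q
    rw [HahnSeries.coeff_sum]
    simp only [filt_coeff]
    by_cases hq : x.coeff q = 0
    · rw [hq]
      symm
      apply Finset.sum_eq_zero
      intro j _
      rw [Set.indicator_apply]
      split_ifs <;> simp [hq]
    obtain ⟨k, hk⟩ := hx q hq
    have hcop : IsCoprime (c : ℤ) ((3 ^ a : ℕ) : ℤ) := by
      rw [Nat.isCoprime_iff_coprime]
      apply Nat.Coprime.pow_right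
      exact ((Nat.Prime.coprime_iff_not_dvd Nat.prime_three).2 hc3).symm
    have hmem : ∀ j : ℕ, q ∈ S j ↔ ((3 ^ a : ℕ) : ℤ) ∣ k - j * c := by
      intro j
      simp only [hS, Set.mem_ofPred_eq]
      constructor
      · rintro ⟨l, hl⟩
        refine ⟨l, ?_⟩
        rw [hk] at hl
        push_cast at hl
        field_simp at hl
        have : k = j * c + 3 ^ a * l := by exact_mod_cast (by linear_combination hl : (k : ℚ) = j * c + 3 ^ a * l)
        rw [this]
        push_cast
        ring
      · rintro ⟨l, hl⟩
        refine ⟨l, ?_⟩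
        have : (k : ℚ) = j * c + 3 ^ a * l := by
          have : k = j * c + 3 ^ a * l := by push_cast at hl; linear_combination hl
          exact_mod_cast this
        rw [hk, this]
        push_cast
        field_simp
    obtain ⟨u, v, huv⟩ := hcop
    have h3 : (0 : ℤ) < ((3 ^ a : ℕ) : ℤ) := by positivity
    set j0 := ((k * u) % ((3 ^ a : ℕ) : ℤ)).toNat with hj0
    have hj0' : (j0 : ℤ) = (k * u) % ((3 ^ a : ℕ) : ℤ) :=
      Int.toNat_of_nonneg (Int.emod_nonneg _ h3.ne')
    have hj0lt : j0 < 3 ^ a := by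
      have := Int.emod_lt_of_pos (k * u) h3
      rw [← hj0'] at this
      exact_mod_cast this
    have hj0mem : q ∈ S j0 := by
      rw [hmem, hj0', Int.emod_def]
      refine ⟨k * v + (k * u / ((3 ^ a : ℕ) : ℤ)) * c, ?_⟩
      linear_combination (-k) * huv
    rw [Finset.sum_eq_single_of_mem j0 (Finset.mem_range.2 hj0lt)]
    · rw [Set.indicator_of_mem hj0mem]
    · intro j hj hne
      apply Set.indicator_of_notMem
      intro hm
      apply hne
      rw [hmem] at hm hj0mem
      have h5 : ((3 ^ a : ℕ) : ℤ) ∣ ((j : ℤ) - j0) * c := by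
        have := dvd_sub hj0mem hm
        rwa [show k - (j0 : ℤ) * c - (k - j * c) = ((j : ℤ) - j0) * c by ring] at this
      have h6 : ((3 ^ a : ℕ) : ℤ) ∣ ((j : ℤ) - j0) := by
        have h7 : IsCoprime ((3 ^ a : ℕ) : ℤ) (c : ℤ) := ⟨v, u, by linear_combination huv⟩
        exact h7.dvd_of_dvd_mul_right h5
      have hjlt := Finset.mem_range.1 hj
      have h8 : (j : ℤ) ≡ j0 [ZMOD ((3 ^ a : ℕ) : ℤ)] := (Int.modEq_iff_dvd.2 (by
        have := (dvd_neg).2 h6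
        simpa using this))
      have h9 : j ≡ j0 [MOD 3 ^ a] := (Int.natCast_modEq_iff).1 h8
      exact Nat.ModEq.eq_of_lt_of_lt h9 hjlt hj0lt

section Abstract
open Polynomial IntermediateField

variable {K H : Type} [Field K] [Field H] [CharZero K] [Algebra K H] (KC : Subfield H) (i : H)
  (s : ℕ → H) (t : K)

theorem abs_irr_two (hno : ∀ x : K, x ^ 2 ≠ -1) : Irreducible (X ^ 2 + C 1 : Polynomial K) := by
  have hd : (X ^ 2 + C 1 : Polynomial K).natDegree = 2 := natDegree_X_pow_add_C
  apply irreducible_of_degree_le_three_of_not_isRoot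
  · rw [hd]; decide
  · intro x hx
    have : x ^ 2 + 1 = 0 := by simpa using hx
    exact hno x (eq_neg_of_add_eq_zero_left this)

theorem abs_finrank_F (hno : ∀ x : K, x ^ 2 ≠ -1) (hi : i ^ 2 = -1) :
    Module.finrank K K⟮i⟯ = 2 := by
  have hm : (X ^ 2 + C 1 : Polynomial K).Monic := monic_X_pow_add_C _ two_ne_zero
  have h0 : aeval i (X ^ 2 + C 1 : Polynomial K) = 0 := by
    simp [hi]
  rw [IntermediateField.adjoin.finrank ⟨_, hm, h0⟩,
    ← minpoly.eq_of_irreducible_of_monic (abs_irr_two hno) h0 hm]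
  exact natDegree_X_pow_add_C

theorem abs_le_KC (hK : ∀ x : K, algebraMap K H x ∈ KC) (hiK : i ∈ KC) (x : H) (hx : x ∈ K⟮i⟯) :
    x ∈ KC := by
  let KC' : IntermediateField K H :=
    { KC with algebraMap_mem' := hK }
  have h : K⟮i⟯ ≤ KC' := by
    rw [adjoin_simple_le_iff]
    exact hiK
  exact h hx

theorem abs_finrank_E (hK : ∀ x : K, algebraMap K H x ∈ KC) (hiK : i ∈ KC)
    (hs : ∀ a, s a ^ (3 ^ a) = algebraMap K H t) (ht : ∀ x ∈ KC, x ^ 3 ≠ algebraMap K H t) (a : ℕ) :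
    Module.finrank K⟮i⟯ K⟮i⟯⟮s a⟯ = 3 ^ a := by
  set t' : K⟮i⟯ := algebraMap K _ t with ht'
  have hm : (X ^ (3 ^ a) - C t').Monic := monic_X_pow_sub_C _ (by positivity)
  have h0 : aeval (s a) (X ^ (3 ^ a) - C t') = 0 := by
    simp only [map_sub, map_pow, aeval_X, aeval_C, hs]
    exact sub_self _
  have hirr : Irreducible (X ^ (3 ^ a) - C t') := by
    apply X_pow_sub_C_irreducible_of_prime_pow Nat.prime_three (by decide)
    intro b hb
    apply ht b (abs_le_KC KC i hK hiK _ b.2)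
    exact congrArg (fun z : K⟮i⟯ => (z : H)) hb
  rw [IntermediateField.adjoin.finrank ⟨_, hm, h0⟩,
    ← minpoly.eq_of_irreducible_of_monic hirr h0 hm]
  exact natDegree_X_pow_sub_C

theorem mod_six_of_dvd (n a : ℕ) (h : n ∣ 2 * 3 ^ a) : n % 6 ≤ 3 := by
  obtain ⟨x, y, hx, hy, hxy⟩ := exists_dvd_and_dvd_of_dvd_mul h
  obtain ⟨m, -, rfl⟩ := (Nat.dvd_prime_pow Nat.prime_three).1 hy
  have hm : 3 ^ m % 6 = 1 ∨ 3 ^ m % 6 = 3 := by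
    clear hy hxy
    induction m with
    | zero => left; rfl
    | succ m ih => rw [pow_succ]; omega
  have hx2 : x = 1 ∨ x = 2 := by
    have := Nat.le_of_dvd (by decide) hx
    interval_cases x
    · simp at hx
    · left; rfl
    · right; rfl
  rw [hxy]
  rcases hx2 with rfl | rfl <;> omega

theorem abs_field (hno : ∀ x : K, x ^ 2 ≠ -1) (hi : i ^ 2 = -1)
    (hK : ∀ x : K, algebraMap K H x ∈ KC) (hiK : i ∈ KC)
    (hs : ∀ a, s a ^ (3 ^ a) = algebraMap K H t) (ht : ∀ x ∈ KC, x ^ 3 ≠ algebraMap K H t)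
    (hKC : ∀ x ∈ KC, ∃ u v : K, x = algebraMap K H u + i * algebraMap K H v)
    (hroot : ∀ f : Polynomial K, Irreducible f → ∃ (α : H) (a : ℕ) (y : ℕ → H), (∀ j, y j ∈ KC) ∧
      aeval α f = 0 ∧ α = ∑ j ∈ Finset.range (3 ^ a), s a ^ j * y j) :
    (∃ p : Polynomial K, Irreducible p ∧ p.natDegree = 2) ∧
    (∃ p : Polynomial K, Irreducible p ∧ p.natDegree = 3) ∧
    (∃ p : Polynomial K, Irreducible p ∧ p.natDegree = 6) ∧
    (∀ p : Polynomial K, Irreducible p → p.natDegree % 6 ≤ 3) := by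
  have htot : ∀ a, Module.finrank K K⟮i⟯⟮s a⟯ = 2 * 3 ^ a := by
    intro a
    rw [← Module.finrank_mul_finrank K K⟮i⟯ K⟮i⟯⟮s a⟯, abs_finrank_F i hno hi,
      abs_finrank_E KC i s t hK hiK hs ht]
  refine ⟨⟨_, abs_irr_two hno, natDegree_X_pow_add_C⟩, ?_, ?_, ?_⟩
  · refine ⟨X ^ 3 - C t, ?_, natDegree_X_pow_sub_C⟩
    apply X_pow_sub_C_irreducible_of_prime Nat.prime_three
    intro b hb
    apply ht _ (hK b)
    rw [← map_pow, hb]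
  · have hfin : Module.finrank K K⟮i⟯⟮s 1⟯ = 6 := htot 1
    have : FiniteDimensional K K⟮i⟯⟮s 1⟯ := Module.finite_of_finrank_pos (by rw [hfin]; decide)
    obtain ⟨θ, hθ⟩ := Field.exists_primitive_element K K⟮i⟯⟮s 1⟯
    have h_integral : IsIntegral K θ := IsIntegral.of_finite K θ
    refine ⟨minpoly K θ, minpoly.irreducible h_integral, ?_⟩
    rw [← IntermediateField.adjoin.finrank h_integral, hθ, IntermediateField.finrank_top', hfin]
  · intro f hf
    obtain ⟨α, a, z, hz, hα, hαz⟩ := hroot f hf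
    apply mod_six_of_dvd _ a
    have hmem : α ∈ K⟮i⟯⟮s a⟯ := by
      rw [hαz]
      apply sum_mem
      intro j _
      apply mul_mem (pow_mem (mem_adjoin_simple_self _ _) j)
      have : z j ∈ K⟮i⟯ := by
        obtain ⟨u, v, huv⟩ := hKC _ (hz j)
        rw [huv]
        exact add_mem (IntermediateField.algebraMap_mem _ u)
          (mul_mem (mem_adjoin_simple_self K i) (IntermediateField.algebraMap_mem _ v))
      exact IntermediateField.algebraMap_mem K⟮i⟯⟮s a⟯ (⟨_, this⟩ : K⟮i⟯)
    have hroot' : aeval (⟨α, hmem⟩ : K⟮i⟯⟮s a⟯) f = 0 := by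
      apply (algebraMap K⟮i⟯⟮s a⟯ H).injective
      rw [map_zero, ← hα]
      have : IsScalarTower K K⟮i⟯⟮s a⟯ H := IsScalarTower.of_algebraMap_eq (fun x => rfl)
      exact (aeval_algebraMap_apply H (⟨α, hmem⟩ : K⟮i⟯⟮s a⟯) f).symm
    have hmin := minpoly.eq_of_irreducible hf hroot'
    have hd := minpoly.degree_dvd (K := K) (x := (⟨α, hmem⟩ : K⟮i⟯⟮s a⟯)) (by
      rw [← isAlgebraic_iff_isIntegral]
      exact ⟨f, hf.ne_zero, hroot'⟩)
    rw [htot, ← hmin, natDegree_mul_C (by simpa using hf.ne_zero)] at hd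
    exact hd

end Abstract

open Polynomial IntermediateField in
theorem KK_root (f : Polynomial KK) (hf : Irreducible f) :
    ∃ (α : HH) (a : ℕ) (y : ℕ → HH), (∀ j, y j ∈ KC) ∧
      aeval α f = 0 ∧ α = ∑ j ∈ Finset.range (3 ^ a), sH a ^ j * y j := by
  obtain ⟨b, hb, hb3, hcoef⟩ := common_denom (Finset.range (f.natDegree + 1))
    (fun i => (f.coeff i : HH)) (fun i => ((mem_KK _).1 (f.coeff i).2).1)
  obtain ⟨g, hg⟩ : ∃ g : Polynomial (LaurentSeries ℂ),
      g.map (EE b hb) = f.map (algebraMap KK HH) := by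
    have : f.map (algebraMap KK HH) ∈ Polynomial.lifts (EE b hb) := by
      rw [Polynomial.lifts_iff_coeff_lifts]
      intro n
      rw [coeff_map]
      by_cases hn : n ≤ f.natDegree
      · exact hcoef n (Finset.mem_range.2 (by omega))
      · rw [coeff_eq_zero_of_natDegree_lt (by omega), map_zero]
        exact ⟨0, map_zero _⟩
    exact (Polynomial.mem_lifts _).1 this
  have hgd : g.natDegree = f.natDegree := by
    have := congrArg natDegree hg
    rwa [natDegree_map_eq_of_injective (EE b hb).injective,
      natDegree_map_eq_of_injective (algebraMap KK HH).injective] at this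
  obtain ⟨N, hN, y, hy⟩ := exists_root_EE b hb g (by rw [hgd]; exact hf.natDegree_pos.ne')
  set α := EE (b * N) (mul_ne_zero hb hN) y with hα
  have hroot : aeval α f = 0 := by
    rw [aeval_def, ← eval_map, ← hg, eval_map]
    exact hy
  obtain ⟨a, c, hc3, hac⟩ := Nat.exists_eq_pow_mul_and_not_dvd hN 3 (by decide)
  have hc0 : c ≠ 0 := by rintro rfl; simp at hc3
  obtain ⟨z, hz, hαz⟩ := decomp a (b * c) (mul_ne_zero hb hc0) (by
    rw [Nat.Prime.dvd_mul Nat.prime_three]; tauto) α (by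
    have := (mem_range_EE _ _ α).1 ⟨y, hα.symm⟩
    rw [hac] at this
    convert this using 6
    push_cast
    ring)
  exact ⟨α, a, z, hz, hroot, hαz⟩

theorem exists_field : ∃ (K : Type) (_ : Field K),
    (∃ p : Polynomial K, Irreducible p ∧ p.natDegree = 2) ∧
    (∃ p : Polynomial K, Irreducible p ∧ p.natDegree = 3) ∧
    (∃ p : Polynomial K, Irreducible p ∧ p.natDegree = 6) ∧
    (∀ p : Polynomial K, Irreducible p → p.natDegree % 6 ≤ 3) :=
  ⟨KK, inferInstance, abs_field KC iH sH ⟨_, tH_mem⟩ KK_no_sqrt iH_sq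
    (fun x => ((mem_KK _).1 x.2).1) iH_mem sH_pow t_not_cube KC_le KK_root⟩

section RingD

open Polynomial UniqueFactorizationMonoid

variable {K : Type} [Field K] (g : K[X])

/-- functions on the projective line regular away from `g = 0` -/
noncomputable def DD : Subring (RatFunc K) where
  carrier := {x | ∃ (f : K[X]) (k : ℕ), f.natDegree ≤ g.natDegree * k ∧
    x * algebraMap K[X] (RatFunc K) (g ^ k) = algebraMap K[X] (RatFunc K) f}
  mul_mem' := by
    rintro x y ⟨f, k, h, e⟩ ⟨f', k', h', e'⟩
    refine ⟨f * f', k + k', ?_, ?_⟩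
    · rw [mul_add]
      exact natDegree_mul_le.trans (add_le_add h h')
    · rw [map_mul, ← e, ← e', pow_add, map_mul]
      ring
  one_mem' := ⟨1, 0, by simp, by simp⟩
  add_mem' := by
    rintro x y ⟨f, k, h, e⟩ ⟨f', k', h', e'⟩
    refine ⟨f * g ^ k' + f' * g ^ k, k + k', ?_, ?_⟩
    · apply natDegree_add_le_of_degree_le
      · refine natDegree_mul_le.trans ?_
        rw [mul_add]
        refine add_le_add h (natDegree_pow_le.trans ?_)
        rw [mul_comm]
      · refine natDegree_mul_le.trans ?_
        rw [add_comm k k', mul_add]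
        refine add_le_add h' (natDegree_pow_le.trans ?_)
        rw [mul_comm]
    · rw [map_add, map_mul, map_mul, ← e, ← e', pow_add, map_mul]
      ring
  zero_mem' := ⟨0, 0, by simp, by simp⟩
  neg_mem' := by
    rintro x ⟨f, k, h, e⟩
    refine ⟨-f, k, by simpa using h, ?_⟩
    rw [map_neg, ← e]
    ring

variable [hgi : Fact (Irreducible g)] [hg6 : Fact (g.natDegree = 6)]

theorem g_ne : g ≠ 0 := hgi.out.ne_zero

theorem ag_ne (k : ℕ) : algebraMap K[X] (RatFunc K) (g ^ k) ≠ 0 := by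
  intro h
  rw [map_eq_zero_iff _ (RatFunc.algebraMap_injective K)] at h
  exact pow_ne_zero _ (g_ne g) h

/-- the element `f / g ^ k` -/
noncomputable def mkD (f : K[X]) (k : ℕ) (h : f.natDegree ≤ 6 * k) : DD g :=
  ⟨algebraMap K[X] (RatFunc K) f / algebraMap K[X] (RatFunc K) (g ^ k), f, k, by rwa [hg6.out],
    div_mul_cancel₀ _ (ag_ne g k)⟩

theorem mk_val (f : K[X]) (k : ℕ) (h : f.natDegree ≤ 6 * k) :
    ((mkD g f k h : DD g) : RatFunc K) =
      algebraMap K[X] (RatFunc K) f / algebraMap K[X] (RatFunc K) (g ^ k) := rfl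

theorem exists_mk (z : DD g) : ∃ (f : K[X]) (k : ℕ) (h : f.natDegree ≤ 6 * k), z = mkD g f k h := by
  obtain ⟨x, f, k, h, e⟩ := z
  refine ⟨f, k, by rwa [hg6.out] at h, ?_⟩
  apply Subtype.ext
  exact (eq_div_iff (ag_ne g k)).2 e

theorem mk_eq_iff (f f' : K[X]) (k k' : ℕ) (h : f.natDegree ≤ 6 * k) (h' : f'.natDegree ≤ 6 * k') :
    mkD g f k h = mkD g f' k' h' ↔ f * g ^ k' = f' * g ^ k := by
  rw [Subtype.ext_iff, mk_val, mk_val, div_eq_div_iff (ag_ne g k) (ag_ne g k'), ← map_mul, ← map_mul]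
  exact (RatFunc.algebraMap_injective K).eq_iff

theorem mk_mul (f f' : K[X]) (k k' : ℕ) (h : f.natDegree ≤ 6 * k) (h' : f'.natDegree ≤ 6 * k')
    (h'' : (f * f').natDegree ≤ 6 * (k + k')) :
    mkD g f k h * mkD g f' k' h' = mkD g (f * f') (k + k') h'' := by
  apply Subtype.ext
  rw [Subring.coe_mul, mk_val, mk_val, mk_val, div_mul_div_comm, pow_add, map_mul, map_mul]

theorem mk_zero (k : ℕ) (h : (0 : K[X]).natDegree ≤ 6 * k) : mkD g 0 k h = 0 := by
  apply Subtype.ext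
  rw [mk_val, map_zero, zero_div]
  rfl

theorem mk_one (h : (1 : K[X]).natDegree ≤ 6 * 0) : mkD g 1 0 h = 1 := by
  apply Subtype.ext
  rw [mk_val, map_one, pow_zero, map_one, div_one]
  rfl

theorem mk_ne_zero (f : K[X]) (k : ℕ) (h : f.natDegree ≤ 6 * k) (h0 : mkD g f k h ≠ 0) : f ≠ 0 := by
  rintro rfl
  exact h0 (mk_zero g k h)

theorem mk_ne_zero' (f : K[X]) (k : ℕ) (h : f.natDegree ≤ 6 * k) (h0 : f ≠ 0) : mkD g f k h ≠ 0 := by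
  intro hc
  have hc' := (mk_eq_iff g _ _ _ _ _ _).1 (hc.trans (mk_zero g 0 (by simp)).symm)
  exact h0 (by simpa using hc')

open scoped Classical in
/-- weight of a polynomial prime -/
noncomputable def wt (p : K[X]) : ℕ :=
  if Associated p g then 0 else if p.natDegree % 6 = 0 then 6 else p.natDegree % 6

open scoped Classical in
/-- total weight of a polynomial -/
noncomputable def WW (f : K[X]) : ℕ := ((normalizedFactors f).map (wt g)).sum

theorem wt_assoc (p q : K[X]) (h : Associated p q) : wt g p = wt g q := by
  have h1 : Associated p g ↔ Associated q g := ⟨h.symm.trans, h.trans⟩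
  have h2 : p.natDegree = q.natDegree := natDegree_eq_of_degree_eq (degree_eq_degree_of_associated h)
  rw [wt, wt, h2]
  by_cases h3 : Associated q g
  · rw [if_pos h3, if_pos (h1.2 h3)]
  · rw [if_neg h3, if_neg (fun h4 => h3 (h1.1 h4))]

theorem WW_mul (f f' : K[X]) (h : f ≠ 0) (h' : f' ≠ 0) : WW g (f * f') = WW g f + WW g f' := by
  classical
  simp only [WW]
  rw [normalizedFactors_mul h h', Multiset.map_add, Multiset.sum_add]

theorem WW_irr (p : K[X]) (h : Irreducible p) : WW g p = wt g p := by
  classical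
  simp only [WW]
  rw [normalizedFactors_irreducible h, Multiset.map_singleton, Multiset.sum_singleton]
  exact wt_assoc g _ _ (normalize_associated p)

theorem WW_unit (p : K[X]) (h : IsUnit p) : WW g p = 0 := by
  classical
  simp only [WW]
  rw [normalizedFactors_of_isUnit h]
  rfl

theorem WW_g (k : ℕ) : WW g (g ^ k) = 0 := by
  induction k with
  | zero => rw [pow_zero]; exact WW_unit g _ isUnit_one
  | succ k ih =>
    rw [pow_succ, WW_mul g _ _ (pow_ne_zero _ (g_ne g)) (g_ne g), ih, WW_irr g _ hgi.out, wt,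
      if_pos (Associated.refl _)]

theorem wt_mod (p : K[X]) : wt g p % 6 = p.natDegree % 6 := by
  rw [wt]
  split_ifs with h1 h2
  · have h2 : p.natDegree = g.natDegree :=
      natDegree_eq_of_degree_eq (degree_eq_degree_of_associated h1)
    rw [h2, hg6.out]
  · omega
  · omega

theorem WW_mod (f : K[X]) (h : f ≠ 0) : WW g f % 6 = f.natDegree % 6 := by
  induction f using UniqueFactorizationMonoid.induction_on_prime with
  | h₁ => exact absurd rfl h
  | h₂ x hx => rw [WW_unit g x hx, natDegree_eq_zero_of_isUnit hx]
  | h₃ a p ha hp ih =>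
    have := ih ha
    have h2 := wt_mod g p
    rw [WW_mul g _ _ hp.ne_zero ha, WW_irr g _ hp.irreducible, natDegree_mul hp.ne_zero ha]
    omega

theorem WW_zero (f : K[X]) (h : f ≠ 0) (hW : WW g f = 0) : ∃ m, Associated f (g ^ m) := by
  induction f using UniqueFactorizationMonoid.induction_on_prime with
  | h₁ => exact absurd rfl h
  | h₂ x hx => exact ⟨0, by rw [pow_zero]; exact associated_one_iff_isUnit.2 hx⟩
  | h₃ a p ha hp ih =>
    rw [WW_mul g _ _ hp.ne_zero ha, WW_irr g _ hp.irreducible] at hW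
    obtain ⟨m, hm⟩ := ih ha (by omega)
    have hp0 : wt g p = 0 := by omega
    have : Associated p g := by
      by_contra h
      rw [wt, if_neg h] at hp0
      split_ifs at hp0
      omega
    refine ⟨m + 1, ?_⟩
    rw [pow_succ, mul_comm]
    exact hm.mul_mul this

/-- minus the degree -/
noncomputable def vv (z : DD g) : ℕ :=
  6 * (exists_mk g z).choose_spec.choose - (exists_mk g z).choose.natDegree

/-- total weight of an element -/
noncomputable def ww (z : DD g) : ℕ := vv g z + WW g (exists_mk g z).choose

theorem vv_mk (f : K[X]) (k : ℕ) (h : f.natDegree ≤ 6 * k) (hf : f ≠ 0) :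
    vv g (mkD g f k h) + f.natDegree = 6 * k := by
  have key : ∀ (f' : K[X]) (k' : ℕ) (h' : f'.natDegree ≤ 6 * k'),
      mkD g f k h = mkD g f' k' h' → (6 * k' - f'.natDegree) + f.natDegree = 6 * k := by
    intro f' k' h' e
    have hf' : f' ≠ 0 := mk_ne_zero g f' k' h' (by rw [← e]; exact mk_ne_zero' g f k h hf)
    rw [mk_eq_iff] at e
    have := congrArg natDegree e
    rw [natDegree_mul hf (pow_ne_zero _ (g_ne g)), natDegree_mul hf' (pow_ne_zero _ (g_ne g)),
      natDegree_pow, natDegree_pow, hg6.out] at this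
    omega
  exact key _ _ (exists_mk g (mkD g f k h)).choose_spec.choose_spec.choose
    (exists_mk g (mkD g f k h)).choose_spec.choose_spec.choose_spec

theorem ww_mk (f : K[X]) (k : ℕ) (h : f.natDegree ≤ 6 * k) (hf : f ≠ 0) :
    ww g (mkD g f k h) = vv g (mkD g f k h) + WW g f := by
  rw [ww]
  congr 1
  set f' := (exists_mk g (mkD g f k h)).choose
  obtain ⟨k', h', e⟩ : ∃ k', ∃ h' : f'.natDegree ≤ 6 * k', mkD g f k h = mkD g f' k' h' :=
    (exists_mk g (mkD g f k h)).choose_spec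
  have hf' : f' ≠ 0 := mk_ne_zero g f' k' h' (by rw [← e]; exact mk_ne_zero' g f k h hf)
  rw [mk_eq_iff] at e
  have := congrArg (WW g) e
  rw [WW_mul g _ _ hf (pow_ne_zero _ (g_ne g)), WW_mul g _ _ hf' (pow_ne_zero _ (g_ne g)),
    WW_g, WW_g] at this
  omega

theorem vw_mul (z z' : DD g) (h : z ≠ 0) (h' : z' ≠ 0) :
    vv g (z * z') = vv g z + vv g z' ∧ ww g (z * z') = ww g z + ww g z' := by
  obtain ⟨f, k, hf, rfl⟩ := exists_mk g z
  obtain ⟨f', k', hf', rfl⟩ := exists_mk g z'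
  have hf0 := mk_ne_zero g _ _ _ h
  have hf0' := mk_ne_zero g _ _ _ h'
  have hd := natDegree_mul hf0 hf0'
  have h1 := vv_mk g f k hf hf0
  have h2 := vv_mk g f' k' hf' hf0'
  have hle : (f * f').natDegree ≤ 6 * (k + k') := by omega
  have h3 := vv_mk g (f * f') (k + k') hle (mul_ne_zero hf0 hf0')
  have h4 := WW_mul g f f' hf0 hf0'
  rw [mk_mul g f f' k k' hf hf' hle, ww_mk g _ _ _ hf0, ww_mk g _ _ _ hf0',
    ww_mk g _ _ _ (mul_ne_zero hf0 hf0')]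
  omega

theorem ww_mod (z : DD g) (h : z ≠ 0) : 6 ∣ ww g z := by
  obtain ⟨f, k, hf, rfl⟩ := exists_mk g z
  have hf0 := mk_ne_zero g _ _ _ h
  have h1 := vv_mk g f k hf hf0
  have h2 := WW_mod g f hf0
  rw [ww_mk g _ _ _ hf0]
  omega

theorem ww_one : ww g 1 = 0 ∧ vv g 1 = 0 := by
  have := vw_mul g 1 1 one_ne_zero one_ne_zero
  rw [mul_one] at this
  omega

theorem isUnit_iff_ww (z : DD g) (h : z ≠ 0) : IsUnit z ↔ ww g z = 0 := by
  constructor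
  · intro hu
    obtain ⟨z', hz'⟩ := hu.exists_right_inv
    have h0 : z' ≠ 0 := by
      rintro rfl
      simp at hz'
    have h1 := vw_mul g z z' h h0
    rw [hz', (ww_one g).1] at h1
    omega
  · intro hw
    obtain ⟨f, k, hf, rfl⟩ := exists_mk g z
    have hf0 := mk_ne_zero g _ _ _ h
    have h1 := vv_mk g f k hf hf0
    rw [ww_mk g _ _ _ hf0] at hw
    obtain ⟨m, u, hm⟩ := WW_zero g f hf0 (by omega)
    have hu0 : ((u : K[X])).natDegree = 0 := natDegree_eq_zero_of_isUnit u.isUnit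
    have hd := congrArg natDegree hm
    rw [natDegree_mul hf0 u.ne_zero, natDegree_pow, hg6.out, hu0] at hd
    have hmk : m = k := by omega
    subst hmk
    apply IsUnit.of_mul_eq_one (mkD g u 0 (by omega))
    rw [mk_mul g f u m 0 hf (by omega) (by rw [natDegree_mul hf0 u.ne_zero]; omega),
      ← mk_one g (by simp), mk_eq_iff, hm]
    simp

end RingD

section Comb

open scoped Classical in
theorem comb_sum {α : Type*} (w : α → ℕ) (M : Multiset α)
    (h : ∀ x ∈ M, w x = 0 ∨ w x = 1 ∨ w x = 2 ∨ w x = 3) :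
    (M.map w).sum = Multiset.card (M.filter (fun x => w x = 1)) +
      2 * Multiset.card (M.filter (fun x => w x = 2)) +
      3 * Multiset.card (M.filter (fun x => w x = 3)) := by
  induction M using Multiset.induction with
  | empty => simp
  | cons a M ih =>
    have ih' := ih (fun x hx => h x (Multiset.mem_cons_of_mem hx))
    rw [Multiset.map_cons, Multiset.sum_cons, ih']
    rcases h a (Multiset.mem_cons_self a M) with h | h | h | h <;>
      simp [Multiset.filter_cons, h] <;> omega

theorem exists_sub_card {α : Type*} (M : Multiset α) (n : ℕ) (h : n ≤ Multiset.card M) :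
    ∃ S ≤ M, Multiset.card S = n := by
  induction M using Multiset.induction generalizing n with
  | empty => exact ⟨0, le_rfl, by simpa using (h.antisymm (Nat.zero_le _)).symm⟩
  | cons a M ih =>
    rcases n with _ | n
    · exact ⟨0, Multiset.zero_le _, rfl⟩
    · rw [Multiset.card_cons] at h
      obtain ⟨S, hS, hc⟩ := ih n (by omega)
      exact ⟨a ::ₘ S, Multiset.cons_le_cons a hS, by rw [Multiset.card_cons, hc]⟩

theorem comb_sum_const {α : Type*} (w : α → ℕ) (S M : Multiset α) (c : ℕ) (h : S ≤ M)
    (hM : ∀ x ∈ M, w x = c) : (S.map w).sum = c * Multiset.card S := by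
  have : S.map w = S.map (fun _ => c) :=
    Multiset.map_congr rfl (fun x hx => hM x (Multiset.mem_of_le h hx))
  rw [this, Multiset.map_const', Multiset.sum_replicate, smul_eq_mul, mul_comm]

open scoped Classical in
theorem comb {α : Type*} (w : α → ℕ) (M : Multiset α)
    (h : ∀ x ∈ M, w x = 0 ∨ w x = 1 ∨ w x = 2 ∨ w x = 3 ∨ w x = 6) (v : ℕ)
    (h6 : 6 ≤ v + (M.map w).sum) (hd : 6 ∣ v + (M.map w).sum) :
    ∃ S ≤ M, ∃ e ≤ v, e + (S.map w).sum = 6 := by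
  by_cases hx : ∃ x ∈ M, w x = 6
  · obtain ⟨x, hx, hw⟩ := hx
    exact ⟨{x}, Multiset.singleton_le.2 hx, 0, by omega, by simp [hw]⟩
  push Not at hx
  have hs := comb_sum w M (fun x hxM => by
    have h1 := h x hxM
    have h2 := hx x hxM
    tauto)
  rw [hs] at h6 hd
  set M1 := M.filter (fun x => w x = 1) with hM1
  set M2 := M.filter (fun x => w x = 2) with hM2
  set M3 := M.filter (fun x => w x = 3) with hM3
  have hle : M1 + M2 + M3 ≤ M := by
    rw [Multiset.le_iff_count]
    intro a
    simp only [hM1, hM2, hM3, Multiset.count_add, Multiset.count_filter]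
    split_ifs <;> omega
  obtain ⟨a1, a2, a3, e, h1, h2, h3, he, hsum⟩ : ∃ a1 a2 a3 e, a1 ≤ Multiset.card M1 ∧
      a2 ≤ Multiset.card M2 ∧ a3 ≤ Multiset.card M3 ∧ e ≤ v ∧
      e + (1 * a1 + 2 * a2 + 3 * a3) = 6 := by
    generalize Multiset.card M1 = n1 at *
    generalize Multiset.card M2 = n2 at *
    generalize Multiset.card M3 = n3 at *
    have fill : ∀ a2 a3, a2 ≤ n2 → a3 ≤ n3 → 2 * a2 + 3 * a3 ≤ 6 → 6 ≤ n1 + v + 2 * a2 + 3 * a3 →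
      ∃ a1 a2 a3 e, a1 ≤ n1 ∧ a2 ≤ n2 ∧ a3 ≤ n3 ∧ e ≤ v ∧
      e + (1 * a1 + 2 * a2 + 3 * a3) = 6 := by
      intro a2 a3 h2 h3 h4 h5
      by_cases h : 6 - 2 * a2 - 3 * a3 ≤ n1
      · exact ⟨6 - 2 * a2 - 3 * a3, a2, a3, 0, by omega, by omega, by omega, by omega, by omega⟩
      · exact ⟨n1, a2, a3, 6 - 2 * a2 - 3 * a3 - n1, by omega, by omega, by omega, by omega,
          by omega⟩
    by_cases h3 : 2 ≤ n3
    · exact fill 0 2 (by omega) (by omega) (by omega) (by omega)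
    by_cases h2 : 3 ≤ n2
    · exact fill 3 0 (by omega) (by omega) (by omega) (by omega)
    by_cases h4 : 2 * n2 + 3 * n3 ≤ 6
    · exact fill n2 n3 (by omega) (by omega) (by omega) (by omega)
    · exact fill n2 0 (by omega) (by omega) (by omega) (by omega)
  obtain ⟨S1, hS1, hc1⟩ := exists_sub_card _ _ h1
  obtain ⟨S2, hS2, hc2⟩ := exists_sub_card _ _ h2
  obtain ⟨S3, hS3, hc3⟩ := exists_sub_card _ _ h3
  refine ⟨S1 + S2 + S3, (add_le_add (add_le_add hS1 hS2) hS3).trans hle, e, he, ?_⟩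
  rw [Multiset.map_add, Multiset.map_add, Multiset.sum_add, Multiset.sum_add,
    comb_sum_const w S1 M1 1 hS1 (fun x hx => (Multiset.mem_filter.1 hx).2),
    comb_sum_const w S2 M2 2 hS2 (fun x hx => (Multiset.mem_filter.1 hx).2),
    comb_sum_const w S3 M3 3 hS3 (fun x hx => (Multiset.mem_filter.1 hx).2), hc1, hc2, hc3, hsum]

end Comb

section HFD

open Polynomial UniqueFactorizationMonoid

variable {K : Type} [Field K] (g : K[X]) [hgi : Fact (Irreducible g)]
  [hg6 : Fact (g.natDegree = 6)]

theorem wt_cases (hdeg : ∀ p : K[X], Irreducible p → p.natDegree % 6 ≤ 3) (p : K[X])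
    (hp : Irreducible p) :
    wt g p = 0 ∨ wt g p = 1 ∨ wt g p = 2 ∨ wt g p = 3 ∨ wt g p = 6 := by
  have := hdeg p hp
  rw [wt]
  split_ifs <;> omega

theorem WW_prod (S : Multiset K[X]) (h : ∀ p ∈ S, Irreducible p) :
    WW g S.prod = (S.map (wt g)).sum := by
  induction S using Multiset.induction with
  | empty => simpa using WW_unit g 1 isUnit_one
  | cons a S ih =>
    have h1 := fun x hx => h x (Multiset.mem_cons_of_mem hx)
    rw [Multiset.prod_cons, Multiset.map_cons, Multiset.sum_cons, WW_mul, ih h1, WW_irr]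
    · exact h a (Multiset.mem_cons_self a S)
    · exact (h a (Multiset.mem_cons_self a S)).ne_zero
    · exact Multiset.prod_ne_zero (fun h0 => (h1 0 h0).ne_zero rfl)

theorem split6 (hdeg : ∀ p : K[X], Irreducible p → p.natDegree % 6 ≤ 3) (z : DD g) (hz : z ≠ 0)
    (h6 : 6 ≤ ww g z) : ∃ a b, z = a * b ∧ ww g a = 6 := by
  classical
  have hm := ww_mod g z hz
  obtain ⟨f, k, hf, rfl⟩ := exists_mk g z
  have hf0 := mk_ne_zero g _ _ _ hz
  have hv := vv_mk g f k hf hf0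
  rw [ww_mk g _ _ _ hf0, WW] at h6 hm
  obtain ⟨S, hS, e, he, hsum⟩ := comb (wt g) (normalizedFactors f)
    (fun p hp => wt_cases g hdeg p (irreducible_of_normalized_factor p hp)) _ h6 hm
  have hirr : ∀ p ∈ S, Irreducible p := fun p hp =>
    irreducible_of_normalized_factor p (Multiset.mem_of_le hS hp)
  obtain ⟨f', hff⟩ : S.prod ∣ f :=
    (Multiset.prod_dvd_prod_of_le hS).trans (prod_normalizedFactors hf0).dvd
  have hSp : S.prod ≠ 0 := Multiset.prod_ne_zero (fun h0 => (hirr 0 h0).ne_zero rfl)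
  have hf'0 : f' ≠ 0 := by
    rintro rfl
    exact hf0 (by rw [hff, mul_zero])
  have hW := WW_prod g S hirr
  have hWm := WW_mod g S.prod hSp
  generalize S.prod = s at *
  obtain ⟨l, hl⟩ : ∃ l, s.natDegree + e = 6 * l := ⟨(s.natDegree + e) / 6, by omega⟩
  have hd := congrArg natDegree hff
  rw [natDegree_mul hSp hf'0] at hd
  have hs : s.natDegree ≤ 6 * l := by omega
  refine ⟨mkD g s l hs, mkD g f' (k - l) (by omega), ?_, ?_⟩
  · rw [mk_mul g _ _ _ _ _ _ (by rw [← hff]; omega), mk_eq_iff, ← hff]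
    congr 2
    omega
  · have := vv_mk g s l hs hSp
    rw [ww_mk g _ _ _ hSp]
    omega

theorem ww_pos (z : DD g) (h : z ≠ 0) (hu : ¬ IsUnit z) : 6 ≤ ww g z := by
  have h1 := ww_mod g z h
  rw [isUnit_iff_ww g z h] at hu
  omega

theorem irr_of_ww (z : DD g) (h : z ≠ 0) (hw : ww g z = 6) : Irreducible z := by
  refine ⟨fun hu => ?_, ?_⟩
  · rw [isUnit_iff_ww g z h] at hu
    omega
  · rintro a b rfl
    have ha : a ≠ 0 := left_ne_zero_of_mul h
    have hb : b ≠ 0 := right_ne_zero_of_mul h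
    have h1 := (vw_mul g a b ha hb).2
    have h2 := ww_mod g a ha
    have h3 := ww_mod g b hb
    rw [isUnit_iff_ww g a ha, isUnit_iff_ww g b hb]
    omega

theorem ww_of_irr (hdeg : ∀ p : K[X], Irreducible p → p.natDegree % 6 ≤ 3) (z : DD g)
    (h : Irreducible z) : ww g z = 6 := by
  obtain ⟨a, b, rfl, ha⟩ := split6 g hdeg z h.ne_zero (ww_pos g z h.ne_zero h.not_isUnit)
  have ha0 : a ≠ 0 := left_ne_zero_of_mul h.ne_zero
  have hb0 : b ≠ 0 := right_ne_zero_of_mul h.ne_zero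
  have h1 := (vw_mul g a b ha0 hb0).2
  rcases h.isUnit_or_isUnit rfl with h2 | h2
  · rw [isUnit_iff_ww g a ha0] at h2
    omega
  · rw [isUnit_iff_ww g b hb0] at h2
    omega

theorem DD_atomic (hdeg : ∀ p : K[X], Irreducible p → p.natDegree % 6 ≤ 3) :
    IsAtomicDomain (DD g) := by
  have key : ∀ n, ∀ z : DD g, z ≠ 0 → ¬ IsUnit z → ww g z ≤ n →
      ∃ l : Multiset (DD g), (∀ p ∈ l, Irreducible p) ∧ l.prod = z := by
    intro n
    induction n with
    | zero =>
      intro z hz hu hn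
      have := ww_pos g z hz hu
      omega
    | succ n ih =>
      intro z hz hu hn
      obtain ⟨a, b, rfl, ha⟩ := split6 g hdeg z hz (ww_pos g z hz hu)
      have ha0 : a ≠ 0 := left_ne_zero_of_mul hz
      have hb0 : b ≠ 0 := right_ne_zero_of_mul hz
      have h1 := (vw_mul g a b ha0 hb0).2
      by_cases hbu : IsUnit b
      · refine ⟨{a * b}, ?_, by simp⟩
        intro p hp
        rw [Multiset.mem_singleton.1 hp]
        rw [isUnit_iff_ww g b hb0] at hbu
        exact irr_of_ww g _ hz (by omega)
      · obtain ⟨l, hl, rfl⟩ := ih b hb0 hbu (by omega)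
        refine ⟨a ::ₘ l, ?_, by simp⟩
        intro p hp
        rcases Multiset.mem_cons.1 hp with rfl | hp
        · exact irr_of_ww g _ ha0 ha
        · exact hl p hp
  exact fun z hz hu => key _ z hz hu le_rfl

theorem ww_prod (hdeg : ∀ p : K[X], Irreducible p → p.natDegree % 6 ≤ 3) (s : Multiset (DD g))
    (hs : ∀ p ∈ s, Irreducible p) : ww g s.prod = 6 * Multiset.card s := by
  induction s using Multiset.induction with
  | empty => simpa using (ww_one g).1
  | cons a S ih =>
    have h1 := fun x hx => hs x (Multiset.mem_cons_of_mem hx)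
    have ha := hs a (Multiset.mem_cons_self a S)
    rw [Multiset.prod_cons, Multiset.card_cons, (vw_mul g _ _ ha.ne_zero
      (Multiset.prod_ne_zero (fun h0 => (h1 0 h0).ne_zero rfl))).2, ih h1, ww_of_irr g hdeg a ha]
    ring

theorem DD_hfd (hdeg : ∀ p : K[X], Irreducible p → p.natDegree % 6 ≤ 3) : IsHFD (DD g) := by
  refine ⟨inferInstance, DD_atomic g hdeg, ?_⟩
  intro s t hs ht h
  have h1 := ww_prod g hdeg s hs
  have h2 := ww_prod g hdeg t ht
  rw [h] at h1
  omega

theorem exists_wt_one (f : K[X]) (h : f ≠ 0) (hW : WW g f = 1) :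
    ∃ p, Irreducible p ∧ p ∣ f ∧ wt g p = 1 := by
  induction f using UniqueFactorizationMonoid.induction_on_prime with
  | h₁ => exact absurd rfl h
  | h₂ x hx =>
    rw [WW_unit g x hx] at hW
    omega
  | h₃ a p ha hp ih =>
    rw [WW_mul g _ _ hp.ne_zero ha, WW_irr g _ hp.irreducible] at hW
    by_cases h1 : wt g p = 1
    · exact ⟨p, hp.irreducible, dvd_mul_right _ _, h1⟩
    · obtain ⟨q, hq, hd, hw⟩ := ih ha (by omega)
      exact ⟨q, hq, hd.mul_left _, hw⟩

theorem vw_assoc (a b : DD g) (h : Associated a b) (ha : a ≠ 0) : vv g a = vv g b := by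
  obtain ⟨u, rfl⟩ := h
  have h1 := vw_mul g a u ha u.ne_zero
  have h2 := vw_mul g u ((u⁻¹ : (DD g)ˣ) : DD g) u.ne_zero (Units.ne_zero _)
  rw [Units.mul_inv, (ww_one g).2] at h2
  omega

theorem DD_not_idpd (hdeg : ∀ p : K[X], Irreducible p → p.natDegree % 6 ≤ 3)
    (Q R : K[X]) (hQ : Irreducible Q) (hR : Irreducible R) (hQ2 : Q.natDegree = 2)
    (hR3 : R.natDegree = 3) : ¬ IsIDPD (DD g) := by
  have hQ0 := hQ.ne_zero
  have hR0 := hR.ne_zero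
  have nass : ∀ p : K[X], p.natDegree ≠ 6 → ¬ Associated p g := by
    intro p hp h
    have := natDegree_eq_of_degree_eq (degree_eq_degree_of_associated h)
    rw [hg6.out] at this
    exact hp this
  have wQ : wt g Q = 2 := by
    rw [wt, if_neg (nass Q (by omega)), hQ2]; rfl
  have wR : wt g R = 3 := by
    rw [wt, if_neg (nass R (by omega)), hR3]; rfl
  have d1 : (1 : K[X]).natDegree = 0 := natDegree_one
  have dp : (Q * R).natDegree = 5 := by rw [natDegree_mul hQ0 hR0, hQ2, hR3]
  have hQ20 : Q ^ 2 * R ≠ 0 := mul_ne_zero (pow_ne_zero _ hQ0) hR0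
  have dpz : (Q ^ 2 * R).natDegree = 7 := by
    rw [natDegree_mul (pow_ne_zero _ hQ0) hR0, natDegree_pow, hQ2, hR3]
  have hz0 : Q ^ 3 * R ^ 2 ≠ 0 := mul_ne_zero (pow_ne_zero _ hQ0) (pow_ne_zero _ hR0)
  have dz : (Q ^ 3 * R ^ 2).natDegree = 12 := by
    rw [natDegree_mul (pow_ne_zero _ hQ0) (pow_ne_zero _ hR0), natDegree_pow, natDegree_pow,
      hQ2, hR3]
  intro hI
  set q := mkD g 1 1 (by omega) with hq
  set p := mkD g (Q * R) 1 (by omega) with hp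
  set z := mkD g (Q ^ 3 * R ^ 2) 3 (by omega) with hz
  have hq0 : q ≠ 0 := mk_ne_zero' g _ _ _ one_ne_zero
  have hp0 : p ≠ 0 := mk_ne_zero' g _ _ _ (mul_ne_zero hQ0 hR0)
  have hzz : z ≠ 0 := mk_ne_zero' g _ _ _ hz0
  have vq : vv g q = 6 := by
    have := vv_mk g 1 1 (by omega) one_ne_zero
    rw [← hq] at this
    omega
  have vp : vv g p = 1 := by
    have := vv_mk g (Q * R) 1 (by omega) (mul_ne_zero hQ0 hR0)
    rw [← hp] at this
    omega
  have vz : vv g z = 6 := by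
    have := vv_mk g _ 3 (by omega) hz0
    rw [← hz] at this
    omega
  have wq : ww g q = 6 := by
    rw [hq, ww_mk g _ _ _ one_ne_zero, ← hq, vq, WW_unit g _ isUnit_one]
  have wp : ww g p = 6 := by
    rw [hp, ww_mk g _ _ _ (mul_ne_zero hQ0 hR0), ← hp, vp, WW_mul g _ _ hQ0 hR0, WW_irr g _ hQ,
      WW_irr g _ hR, wQ, wR]
  have epz : z = p * mkD g (Q ^ 2 * R) 2 (by omega) := by
    rw [hp, mk_mul g _ _ _ _ _ _ (by rw [natDegree_mul (mul_ne_zero hQ0 hR0) hQ20]; omega), hz,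
      mk_eq_iff]
    ring
  have eqz : z = q * mkD g (Q ^ 3 * R ^ 2) 2 (by omega) := by
    rw [hq, mk_mul g _ _ _ _ _ _ (by rw [one_mul]; omega), hz, mk_eq_iff]
    ring
  obtain ⟨p', q', hp', hq', hass, hdvd⟩ := hI.2.2 z p q hzz
    (fun hu => by
      rw [isUnit_iff_ww g z hzz, ww] at hu
      omega)
    (irr_of_ww g p hp0 wp) (irr_of_ww g q hq0 wq)
    ⟨_, epz⟩ ⟨_, eqz⟩
    (fun h => by have := vw_assoc g _ _ h hp0; omega)
  have hpp := mul_ne_zero hp0 hp'.ne_zero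
  have e1 := vw_assoc g _ _ hass hpp
  rw [(vw_mul g _ _ hp0 hp'.ne_zero).1, (vw_mul g _ _ hq0 hq'.ne_zero).1] at e1
  have e2 : vv g q' = 0 := by
    obtain ⟨c, hc⟩ := hdvd
    have hc0 : c ≠ 0 := by
      rintro rfl
      exact hzz (by rw [hc, mul_zero])
    have := (vw_mul g _ _ (mul_ne_zero hq0 hq'.ne_zero) hc0).1
    rw [(vw_mul g _ _ hq0 hq'.ne_zero).1, ← hc] at this
    omega
  have wp' := ww_of_irr g hdeg p' hp'
  have hpz : p' ∣ mkD g (Q ^ 2 * R) 2 (by omega) := by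
    have := hass.dvd.trans hdvd
    rw [epz] at this
    exact (mul_dvd_mul_iff_left hp0).1 this
  obtain ⟨f', k', hf', rfl⟩ := exists_mk g p'
  have hf'0 := mk_ne_zero g _ _ _ hp'.ne_zero
  rw [ww_mk g _ _ _ hf'0] at wp'
  obtain ⟨P, hP, hPf, hPw⟩ := exists_wt_one g f' hf'0 (by omega)
  obtain ⟨c, hc⟩ := hpz
  obtain ⟨h, l, hl, rfl⟩ := exists_mk g c
  rw [mk_mul g _ _ _ _ _ _ (natDegree_mul_le.trans (by omega)), mk_eq_iff] at hc
  have hPd : P ∣ Q ^ 2 * R * g ^ (k' + l) := by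
    rw [hc]
    exact ((hPf.mul_right _).mul_right _)
  have hPp := hP.prime
  rcases hPp.dvd_or_dvd hPd with h1 | h1
  · rcases hPp.dvd_or_dvd h1 with h2 | h2
    · have := wt_assoc g _ _ (hP.associated_of_dvd hQ (hPp.dvd_of_dvd_pow h2))
      omega
    · have := wt_assoc g _ _ (hP.associated_of_dvd hR h2)
      omega
  · have := hP.associated_of_dvd hgi.out (hPp.dvd_of_dvd_pow h1)
    rw [wt, if_pos this] at hPw
    omega

end HFD

section Dedekind

open Polynomial UniqueFactorizationMonoid

variable {K : Type} [Field K] (g : K[X]) [hgi : Fact (Irreducible g)]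
  [hg6 : Fact (g.natDegree = 6)]

theorem mk_add (f f' : K[X]) (k : ℕ) (h : f.natDegree ≤ 6 * k) (h' : f'.natDegree ≤ 6 * k)
    (h'' : (f + f').natDegree ≤ 6 * k) :
    mkD g f k h + mkD g f' k h' = mkD g (f + f') k h'' := by
  apply Subtype.ext
  rw [Subring.coe_add, mk_val, mk_val, mk_val, map_add, add_div]

/-- the element `1 / g` -/
noncomputable def yy : DD g := mkD g 1 1 (by simp)

theorem yy_pow (k : ℕ) : yy g ^ k = mkD g 1 k (by simp) := by
  induction k with
  | zero => rw [pow_zero, mk_one]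
  | succ k ih =>
    rw [pow_succ, ih, yy, mk_mul g _ _ _ _ _ _ (by simp), mk_eq_iff, one_mul]

theorem mk_yy (f : K[X]) (k l : ℕ) (h : f.natDegree ≤ 6 * k) :
    yy g ^ l * mkD g f k h = mkD g f (l + k) (by omega) := by
  rw [yy_pow, mk_mul g _ _ _ _ _ _ (by rw [one_mul]; omega), mk_eq_iff, one_mul]

/-- constants -/
noncomputable def CC : K →+* DD g :=
  (RatFunc.C : K →+* RatFunc K).codRestrict (DD g) (fun c => ⟨C c, 0, by simp, by
    rw [pow_zero, map_one, mul_one, RatFunc.algebraMap_C]⟩)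

theorem CC_eq (c : K) : CC g c = mkD g (C c) 0 (by simp) := by
  apply Subtype.ext
  rw [mk_val, pow_zero, map_one, div_one, RatFunc.algebraMap_C]
  rfl

/-- `D` as an algebra over polynomials in `1 / g` -/
noncomputable def ev : K[X] →+* DD g := eval₂RingHom (CC g) (yy g)

theorem DD_finite : (ev g).Finite := by
  letI : Algebra K[X] (DD g) := (ev g).toAlgebra
  change Module.Finite K[X] (DD g)
  have hsm : ∀ (p : K[X]) (z : DD g), p • z = ev g p * z := fun p z => rfl
  have hC : ∀ c, ev g (C c) = CC g c := fun c => eval₂_C _ _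
  have hX : ∀ n, ev g (X ^ n) = yy g ^ n := fun n => by
    rw [map_pow]
    congr 1
    exact eval₂_X _ _
  let T : Set (DD g) := insert 1 (Set.range (fun j : Fin 7 => mkD g (X ^ (j : ℕ)) 1
    (by rw [natDegree_X_pow]; omega)))
  have hT : T.Finite := (Set.finite_range _).insert _
  refine ⟨⟨hT.toFinset, ?_⟩⟩
  rw [Set.Finite.coe_toFinset, eq_top_iff]
  have h1 : ∀ f : K[X], f.natDegree ≤ 6 → ∀ h, mkD g f 1 h ∈ Submodule.span K[X] T := by
    intro f hf
    refine induction_with_natDegree_le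
      (fun f => ∀ h, mkD g f 1 h ∈ Submodule.span K[X] T) 6 ?_ ?_ ?_ f hf
    · intro h
      rw [mk_zero]
      exact zero_mem _
    · intro n r hr hn h
      have h2 : mkD g (C r * X ^ n) 1 h = (C r : K[X]) • mkD g (X ^ n) 1
          (by rw [natDegree_X_pow]; omega) := by
        rw [hsm, hC, CC_eq, mk_mul g _ _ _ _ _ _ (by omega), mk_eq_iff]
      rw [h2]
      exact Submodule.smul_mem _ _ (Submodule.subset_span
        (Set.mem_insert_of_mem _ ⟨⟨n, by omega⟩, rfl⟩))
    · intro f f' hff hf' h3 h4 h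
      rw [← mk_add g f f' 1 (by omega) (by omega)]
      exact add_mem (h3 _) (h4 _)
  have h2 : ∀ k, ∀ f : K[X], ∀ h, mkD g f k h ∈ Submodule.span K[X] T := by
    intro k
    induction k with
    | zero =>
      intro f h
      have hf : f = C (f.coeff 0) := eq_C_of_natDegree_eq_zero (by omega)
      have h2 : mkD g f 0 h = (C (f.coeff 0) : K[X]) • (1 : DD g) := by
        rw [hsm, hC, CC_eq, mul_one, mk_eq_iff, ← hf]
      rw [h2]
      exact Submodule.smul_mem _ _ (Submodule.subset_span (Set.mem_insert _ _))
    | succ k ih =>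
      intro f h
      have hr : (f % g).natDegree < 6 := by
        have := natDegree_mod_lt f (q := g) (by rw [hg6.out]; omega)
        rwa [hg6.out] at this
      have hfe := EuclideanDomain.div_add_mod f g
      have hq : (f / g).natDegree ≤ 6 * k := by
        by_cases hq0 : f / g = 0
        · rw [hq0, natDegree_zero]
          omega
        · have h3 : g * (f / g) = f - f % g := eq_sub_of_add_eq hfe
          have h4 := congrArg natDegree h3
          rw [natDegree_mul (g_ne g) hq0, hg6.out] at h4
          have h5 := natDegree_sub_le f (f % g)
          rw [← h4] at h5
          rcases le_max_iff.1 h5 with h6 | h6 <;> omega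
      have hgq : (g * (f / g)).natDegree ≤ 6 * (k + 1) := by
        refine natDegree_mul_le.trans ?_
        rw [hg6.out]
        omega
      have e1 : mkD g f (k + 1) h = mkD g (f / g) k hq +
          (X ^ k : K[X]) • mkD g (f % g) 1 (by omega) := by
        have e2 : mkD g (f / g) k hq = mkD g (g * (f / g)) (k + 1) hgq := by
          rw [mk_eq_iff]
          ring
        rw [hsm, hX, mk_yy, e2, mk_add g _ _ _ _ _ (by rw [hfe]; omega), mk_eq_iff, hfe]
      rw [e1]
      exact add_mem (ih _ _) (Submodule.smul_mem _ _ (h1 _ (by omega) _))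
  intro z _
  obtain ⟨f, k, h, rfl⟩ := exists_mk g z
  exact h2 k f h

theorem DD_noeth : IsNoetherianRing (DD g) := by
  letI : Algebra K[X] (DD g) := (ev g).toAlgebra
  haveI : Module.Finite K[X] (DD g) := DD_finite g
  exact IsNoetherianRing.of_finite K[X] (DD g)

theorem DD_dim : Ring.DimensionLEOne (DD g) := by
  letI : Algebra K[X] (DD g) := (ev g).toAlgebra
  haveI : Module.Finite K[X] (DD g) := DD_finite g
  refine ⟨fun {P} h0 hP => ?_⟩
  apply Ideal.isMaximal_of_isIntegral_of_isMaximal_comap (R := K[X])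
  obtain ⟨x, hx, hx0⟩ := Submodule.exists_mem_ne_zero_of_ne_bot h0
  have := Ideal.comap_ne_bot_of_integral_mem (R := K[X]) hx0 hx (Algebra.IsIntegral.isIntegral x)
  exact (Ideal.IsPrime.comap (algebraMap K[X] (DD g))).isMaximal this

instance DD_frac : IsFractionRing (DD g) (RatFunc K) := by
  apply IsFractionRing.of_field
  intro z
  have hk : z.num.natDegree ≤ 6 * (z.num.natDegree + z.denom.natDegree) := by omega
  have hk' : z.denom.natDegree ≤ 6 * (z.num.natDegree + z.denom.natDegree) := by omega
  refine ⟨mkD g _ _ hk, mkD g _ _ hk', ?_⟩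
  change z = (mkD g _ _ hk : RatFunc K) / (mkD g _ _ hk' : RatFunc K)
  rw [mk_val, mk_val, div_div_div_cancel_right₀ (ag_ne g _), RatFunc.num_div_denom]

theorem val_le {Γ : Type} [LinearOrderedCommGroupWithZero Γ] (v : Valuation (RatFunc K) Γ)
    (hv : ∀ d : DD g, v d ≤ 1) (x : RatFunc K) (hx : IsIntegral (DD g) x) : v x ≤ 1 := by
  apply (Valuation.integer.integers v).mem_of_integral
  obtain ⟨p, hp, he⟩ := hx
  have hle : DD g ≤ v.integer := fun d hd => hv ⟨d, hd⟩
  refine ⟨p.map (Subring.inclusion hle), hp.map _, ?_⟩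
  rw [eval₂_map]
  exact he

theorem DD_int (x : RatFunc K) (hx : IsIntegral (DD g) x) : x ∈ DD g := by
  classical
  have hd0 := x.denom_ne_zero
  have hcop := x.isCoprime_num_denom
  have hxe := x.num_div_denom
  generalize x.num = a at *
  generalize x.denom = b at *
  have hb : ∃ m, Associated b (g ^ m) := by
    have : ∀ p, Irreducible p → p ∣ b → Associated p g := by
      intro p hp hpb
      by_contra hn
      let v : IsDedekindDomain.HeightOneSpectrum K[X] :=
        ⟨Ideal.span {p}, (Ideal.span_singleton_prime hp.ne_zero).2 hp.prime,
          by simpa using hp.ne_zero⟩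
      have h1 := val_le g (v.valuation (RatFunc K)) (fun d => by
        obtain ⟨f, k, h, rfl⟩ := exists_mk g d
        rw [mk_val, map_div₀]
        have h3 : v.valuation (RatFunc K) (algebraMap K[X] (RatFunc K) (g ^ k)) = 1 := by
          rw [IsDedekindDomain.HeightOneSpectrum.valuation_eq_one_iff_notMem]
          intro hm
          have := hp.prime.dvd_of_dvd_pow (Ideal.mem_span_singleton.1 hm)
          exact hn (hp.associated_of_dvd hgi.out this)
        rw [h3, div_one]
        exact v.valuation_le_one f) x hx
      rw [← hxe] at h1
      have hbm : b ∈ v.asIdeal := Ideal.mem_span_singleton.2 hpb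
      refine (v.valuation_div_le_one_iff (RatFunc K) a hd0 (fun _ ha => ?_)).1 h1 hbm
      exact hp.not_isUnit (hcop.isUnit_of_dvd' (Ideal.mem_span_singleton.1 ha) hpb)
    apply WW_zero g b hd0
    rw [WW]
    apply Multiset.sum_eq_zero
    intro n hn
    obtain ⟨p, hp, rfl⟩ := Multiset.mem_map.1 hn
    rw [wt, if_pos (this p (irreducible_of_normalized_factor p hp)
      (dvd_of_mem_normalizedFactors hp))]
  by_cases ha0 : a = 0
  · rw [← hxe, ha0, map_zero, zero_div]
    exact zero_mem _
  have hinf : a.natDegree ≤ b.natDegree := by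
    have h2 : ∀ f : K[X], f ≠ 0 → RatFunc.inftyValuation K (algebraMap K[X] (RatFunc K) f) =
      WithZero.exp (f.natDegree : ℤ) := fun f hf => RatFunc.inftyValuation.polynomial K hf
    have h1 := val_le g (RatFunc.inftyValuation K) (fun d => by
      obtain ⟨f, k, h, rfl⟩ := exists_mk g d
      by_cases hf : f = 0
      · rw [mk_val, hf, map_zero, zero_div, map_zero]
        exact zero_le_one
      rw [mk_val, map_div₀, h2 _ hf, h2 _ (pow_ne_zero _ (g_ne g)), natDegree_pow, hg6.out,
        ← WithZero.exp_sub, ← WithZero.exp_zero, WithZero.exp_le_exp]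
      push_cast
      omega) x hx
    rw [← hxe, map_div₀, h2 _ ha0, h2 _ hd0, ← WithZero.exp_sub, ← WithZero.exp_zero,
      WithZero.exp_le_exp] at h1
    omega
  obtain ⟨m, u, hu⟩ := hb
  have hu0 : ((u : K[X])).natDegree = 0 := natDegree_eq_zero_of_isUnit u.isUnit
  have hbd := congrArg natDegree hu
  rw [natDegree_mul hd0 u.ne_zero, natDegree_pow] at hbd
  refine ⟨a * u, m, ?_, ?_⟩
  · rw [natDegree_mul ha0 u.ne_zero, mul_comm, ← hbd]
    omega
  · rw [← hu, ← hxe, map_mul, map_mul, ← mul_assoc, div_mul_cancel₀]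
    rwa [ne_eq, map_eq_zero_iff _ (RatFunc.algebraMap_injective K)]

instance DD_ded : IsDedekindDomain (DD g) :=
  (isDedekindDomain_iff (DD g) (RatFunc K)).2
    ⟨inferInstance, DD_noeth g, DD_dim g, fun {x} hx => ⟨⟨x, DD_int g x hx⟩, rfl⟩⟩

end Dedekind

section ClassGp

open Polynomial UniqueFactorizationMonoid

variable {K : Type} [Field K] (g : K[X]) [hgi : Fact (Irreducible g)]
  [hg6 : Fact (g.natDegree = 6)]

theorem mem_PI_iff (n : ℕ) (f : K[X]) (k : ℕ) (h : f.natDegree ≤ 6 * k) :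
    (mkD g f k h = 0 ∨ n ≤ vv g (mkD g f k h)) ↔ (f = 0 ∨ n + f.natDegree ≤ 6 * k) := by
  by_cases hf : f = 0
  · subst hf
    simp [mk_zero]
  · have h1 := mk_ne_zero' g f k h hf
    have h2 := vv_mk g f k h hf
    simp only [h1, hf, false_or]
    omega

/-- functions vanishing to order at least `n` at infinity -/
noncomputable def PI (n : ℕ) : Ideal (DD g) where
  carrier := {z | z = 0 ∨ n ≤ vv g z}
  zero_mem' := Or.inl rfl
  add_mem' := by
    intro a b ha hb
    obtain ⟨f, k, h, rfl⟩ := exists_mk g a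
    obtain ⟨f', k', h', rfl⟩ := exists_mk g b
    have d1 : (f * g ^ k').natDegree ≤ f.natDegree + 6 * k' := by
      refine natDegree_mul_le.trans ?_
      rw [natDegree_pow, hg6.out]
      omega
    have d2 : (f' * g ^ k).natDegree ≤ f'.natDegree + 6 * k := by
      refine natDegree_mul_le.trans ?_
      rw [natDegree_pow, hg6.out]
      omega
    have e1 : mkD g f k h = mkD g (f * g ^ k') (k + k') (by omega) := by
      rw [mk_eq_iff]
      ring
    have e2 : mkD g f' k' h' = mkD g (f' * g ^ k) (k + k') (by omega) := by
      rw [mk_eq_iff]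
      ring
    have hle := natDegree_add_le (f * g ^ k') (f' * g ^ k)
    rw [Set.mem_setOf_eq, e1, mem_PI_iff] at ha
    rw [Set.mem_setOf_eq, e2, mem_PI_iff] at hb
    have d3 : (f * g ^ k' + f' * g ^ k).natDegree ≤ 6 * (k + k') := by
      rcases le_max_iff.1 hle with h3 | h3 <;> omega
    rw [Set.mem_setOf_eq, e1, e2, mk_add g _ _ _ _ _ d3, mem_PI_iff]
    clear e1 e2
    generalize f * g ^ k' = F at *
    generalize f' * g ^ k = F' at *
    rcases ha with ha | ha
    · rw [ha, zero_add]
      exact hb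
    · rcases hb with hb | hb
      · rw [hb, add_zero]
        exact Or.inr ha
      · right
        rcases le_max_iff.1 hle with h3 | h3 <;> omega
  smul_mem' := by
    intro c z hz
    rw [smul_eq_mul]
    by_cases hc : c = 0
    · left
      rw [hc, zero_mul]
    rcases hz with hz | hz
    · left
      rw [hz, mul_zero]
    · by_cases hz0 : z = 0
      · left
        rw [hz0, mul_zero]
      right
      rw [(vw_mul g c z hc hz0).1]
      omega

theorem mem_PI (n : ℕ) (z : DD g) : z ∈ PI g n ↔ z = 0 ∨ n ≤ vv g z := Iff.rfl

theorem PI_mul (a b : ℕ) : PI g a * PI g b ≤ PI g (a + b) := by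
  rw [Ideal.mul_le]
  intro r hr s hs
  rw [mem_PI] at *
  by_cases h : r * s = 0
  · exact Or.inl h
  have h1 := left_ne_zero_of_mul h
  have h2 := right_ne_zero_of_mul h
  right
  rw [(vw_mul g _ _ h1 h2).1]
  have h3 := hr.resolve_left h1
  have h4 := hs.resolve_left h2
  omega

theorem PI_pow (n : ℕ) : PI g 1 ^ n ≤ PI g n := by
  induction n with
  | zero =>
    intro z _
    exact Or.inr (Nat.zero_le _)
  | succ n ih =>
    rw [pow_succ]
    exact (Ideal.mul_mono_left ih).trans (PI_mul g n 1)

theorem vw_yy : vv g (yy g) = 6 ∧ ww g (yy g) = 6 := by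
  have h1 := vv_mk g 1 1 (by simp) one_ne_zero
  have h2 := ww_mk g 1 1 (by simp) one_ne_zero
  rw [WW_unit g _ isUnit_one] at h2
  have h3 : (1 : K[X]).natDegree = 0 := natDegree_one
  rw [yy]
  omega

theorem yy_ne : yy g ≠ 0 := mk_ne_zero' g _ _ _ one_ne_zero

instance PI_prime : (PI g 1).IsPrime := by
  refine ⟨?_, ?_⟩
  · rw [Ideal.ne_top_iff_one, mem_PI, (ww_one g).2]
    simp
  · intro a b h
    rw [mem_PI] at *
    by_cases ha : a = 0
    · exact Or.inl (Or.inl ha)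
    by_cases hb : b = 0
    · exact Or.inr (Or.inl hb)
    have := h.resolve_left (mul_ne_zero ha hb)
    rw [(vw_mul g _ _ ha hb).1] at this
    rw [mem_PI]
    omega

theorem PI_ne : PI g 1 ≠ ⊥ := by
  intro h
  have : yy g ∈ PI g 1 := Or.inr (by rw [(vw_yy g).1]; omega)
  rw [h, Ideal.mem_bot] at this
  exact yy_ne g this

theorem PI_Prime : Prime (PI g 1) := Ideal.prime_of_isPrime (PI_ne g) (PI_prime g)

theorem mk_pow (f : K[X]) (k : ℕ) (h : f.natDegree ≤ 6 * k) (n : ℕ)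
    (h' : (f ^ n).natDegree ≤ 6 * (k * n)) : mkD g f k h ^ n = mkD g (f ^ n) (k * n) h' := by
  apply Subtype.ext
  rw [SubmonoidClass.coe_pow, mk_val, mk_val, div_pow, map_pow, pow_mul, map_pow]
  rw [map_pow, map_pow]

theorem yy_dvd (z : DD g) (hz : z ∈ PI g 1) : yy g ∣ z ^ 6 := by
  obtain ⟨f, k, h, rfl⟩ := exists_mk g z
  rw [mem_PI, mem_PI_iff] at hz
  rcases hz with hz | hz
  · subst hz
    rw [mk_zero]
    simp
  · have h1 : (f ^ 6).natDegree ≤ 6 * f.natDegree := natDegree_pow_le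
    refine ⟨mkD g (f ^ 6) (6 * k - 1) (by omega), ?_⟩
    have h2 := mk_yy g (f ^ 6) (6 * k - 1) 1 (by omega)
    rw [pow_one] at h2
    rw [h2, mk_pow g f k h 6 (by omega), mk_eq_iff]
    congr 2
    omega

theorem span_yy : Ideal.span {yy g} = PI g 1 ^ 6 := by
  have h0 : Ideal.span {yy g} ≠ 0 := by
    rw [Ideal.zero_eq_bot, ne_eq, Ideal.span_singleton_eq_bot]
    exact yy_ne g
  obtain ⟨n, hn⟩ := exists_associated_prime_pow_of_unique_normalized_factor (p := PI g 1)
    (r := Ideal.span {yy g}) (by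
      intro Q hQ
      have hQp := prime_of_normalized_factor Q hQ
      have hQy := Ideal.dvd_span_singleton.1 (dvd_of_mem_normalizedFactors hQ)
      have hQP := Ideal.isPrime_of_prime hQp
      have hle : PI g 1 ≤ Q := by
        intro z hz
        exact hQP.mem_of_pow_mem 6 (Q.mem_of_dvd (yy_dvd g z hz) hQy)
      exact (((PI_prime g).isMaximal (PI_ne g)).eq_of_le hQP.ne_top hle).symm) h0
  rw [associated_iff_eq] at hn
  rw [← hn]
  congr 1
  apply le_antisymm
  · have h1 : yy g ∈ PI g 1 ^ n := by
      rw [hn]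
      exact Ideal.mem_span_singleton_self _
    have h2 := PI_pow g n h1
    rw [mem_PI, (vw_yy g).1] at h2
    exact h2.resolve_left (yy_ne g)
  · have d5 : (X ^ 5 : K[X]).natDegree = 5 := natDegree_X_pow 5
    have d30 : (X ^ 30 : K[X]).natDegree = 30 := natDegree_X_pow 30
    set p := mkD g (X ^ 5) 1 (by omega) with hp
    set u := mkD g (X ^ 30) 5 (by omega) with hu
    have hpu : p ^ 6 = yy g * u := by
      have h1 := mk_yy g (X ^ 30) 5 1 (by omega)
      rw [pow_one] at h1
      rw [hu, h1, hp, mk_pow g _ _ _ 6 (by rw [← pow_mul, natDegree_X_pow]; omega), mk_eq_iff]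
      ring
    have hpP : p ∈ PI g 1 := by
      rw [mem_PI, hp, mem_PI_iff]
      omega
    have huP : u ∉ PI g 1 := by
      rw [mem_PI, hu, mem_PI_iff]
      have : (X ^ 30 : K[X]) ≠ 0 := pow_ne_zero _ X_ne_zero
      rintro (h | h)
      · exact this h
      · omega
    have h6 : PI g 1 ^ 6 ∣ PI g 1 ^ n * Ideal.span {u} := by
      rw [hn, Ideal.span_singleton_mul_span_singleton, ← hpu, Ideal.dvd_span_singleton]
      exact Ideal.pow_mem_pow hpP 6
    have h7 := (PI_Prime g).pow_dvd_of_dvd_mul_right 6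
      (by rw [Ideal.dvd_span_singleton]; exact huP) h6
    exact (pow_dvd_pow_iff (PI_Prime g).ne_zero (PI_Prime g).not_isUnit).1 h7

theorem ww_pow (z : DD g) (hz : z ≠ 0) (n : ℕ) : ww g (z ^ n) = n * ww g z := by
  induction n with
  | zero => rw [pow_zero, (ww_one g).1, zero_mul]
  | succ n ih =>
    rw [pow_succ, (vw_mul g _ _ (pow_ne_zero _ hz) hz).2, ih]
    ring

theorem ww_assoc (a b : DD g) (h : Associated a b) (ha : a ≠ 0) : ww g a = ww g b := by
  obtain ⟨u, rfl⟩ := h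
  rw [(vw_mul g a u ha u.ne_zero).2, (isUnit_iff_ww g u u.ne_zero).1 u.isUnit, add_zero]

theorem PI_pow_principal (m : ℕ) (h : (PI g 1 ^ m).IsPrincipal) : 6 ∣ m := by
  obtain ⟨z, hz⟩ := h.principal
  have hz' : PI g 1 ^ m = Ideal.span {z} := hz
  have hz0 : z ≠ 0 := by
    rintro rfl
    rw [Ideal.span_singleton_eq_bot.2 rfl] at hz'
    exact pow_ne_zero m (PI_Prime g).ne_zero hz'
  have h1 : Ideal.span {z ^ 6} = Ideal.span {yy g ^ m} := by
    rw [← Ideal.span_singleton_pow, ← Ideal.span_singleton_pow, ← hz', span_yy, ← pow_mul,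
      ← pow_mul, mul_comm]
  rw [Ideal.span_singleton_eq_span_singleton] at h1
  have h2 := ww_assoc g _ _ h1 (pow_ne_zero _ hz0)
  rw [ww_pow g _ hz0, ww_pow g _ (yy_ne g), (vw_yy g).2] at h2
  have h3 := ww_mod g z hz0
  omega

/-- numerators of an ideal -/
noncomputable def numer (I : Ideal (DD g)) : Ideal K[X] where
  carrier := {f | ∃ k0, ∀ k, k0 ≤ k → ∀ h, mkD g f k h ∈ I}
  zero_mem' := ⟨0, fun k _ h => by rw [mk_zero]; exact zero_mem _⟩
  add_mem' := by
    rintro f f' ⟨k0, h0⟩ ⟨k1, h1⟩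
    refine ⟨k0 + k1 + f.natDegree + f'.natDegree, fun k hk h => ?_⟩
    rw [← mk_add g f f' k (by omega) (by omega)]
    exact add_mem (h0 _ (by omega) _) (h1 _ (by omega) _)
  smul_mem' := by
    rintro c f ⟨k0, h0⟩
    refine ⟨k0 + c.natDegree + f.natDegree, fun k hk h => ?_⟩
    have e : mkD g (c • f) k h = mkD g c c.natDegree (by omega) *
        mkD g f (k - c.natDegree) (by omega) := by
      rw [mk_mul g _ _ _ _ _ _ (natDegree_mul_le.trans (by omega)), mk_eq_iff, smul_eq_mul]
      congr 2
      omega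
    rw [e]
    exact I.mul_mem_left _ (h0 _ (by omega) _)

theorem ideal_class (I : Ideal (DD g)) (hI : I ≠ ⊥) :
    ∃ i : ℕ, ∃ b : DD g, b ≠ 0 ∧ I * PI g 1 ^ i = Ideal.span {b} := by
  obtain ⟨f0, hf0⟩ := (IsPrincipalIdealRing.principal (numer g I)).principal
  have hmem : ∀ f, f ∈ numer g I ↔ f0 ∣ f := by
    intro f
    rw [hf0]
    exact Ideal.mem_span_singleton
  have hnum : ∀ f k h, mkD g f k h ∈ I → f ∈ numer g I := by
    intro f k h hI
    refine ⟨k, fun k' hk h' => ?_⟩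
    have e : mkD g f k' h' = yy g ^ (k' - k) * mkD g f k h := by
      rw [mk_yy, mk_eq_iff]
      congr 2
      omega
    rw [e]
    exact I.mul_mem_left _ hI
  have hf00 : f0 ≠ 0 := by
    rintro rfl
    obtain ⟨x, hx, hx0⟩ := Submodule.exists_mem_ne_zero_of_ne_bot hI
    obtain ⟨f, k, h, rfl⟩ := exists_mk g x
    exact mk_ne_zero g _ _ _ hx0 (zero_dvd_iff.1 ((hmem f).1 (hnum f k h hx)))
  obtain ⟨k1, hk1⟩ := (hmem f0).2 dvd_rfl
  set k0 := k1 + f0.natDegree with hk0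
  have hd0 : f0.natDegree ≤ 6 * k0 := by omega
  have hb : mkD g f0 k0 hd0 ∈ I := hk1 k0 (by omega) hd0
  have hb0 : mkD g f0 k0 hd0 ≠ 0 := mk_ne_zero' g _ _ _ hf00
  obtain ⟨J, hJ⟩ := Ideal.dvd_span_singleton.2 hb
  have hdvd : Ideal.span {mkD g f0 k0 hd0} ∣ I * Ideal.span {yy g ^ k0} := by
    rw [Ideal.dvd_iff_le, mul_comm, Ideal.span_singleton_mul_le_iff]
    intro z hz
    rw [Ideal.mem_span_singleton]
    obtain ⟨f, k, h, rfl⟩ := exists_mk g z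
    by_cases hf : f = 0
    · subst hf
      rw [mk_zero, mul_zero]
      exact dvd_zero _
    obtain ⟨c, rfl⟩ := (hmem f).1 (hnum f k h hz)
    have hd := natDegree_mul hf00 (right_ne_zero_of_mul hf)
    refine ⟨mkD g c k (by omega), ?_⟩
    rw [mk_yy, mk_mul g _ _ _ _ _ _ (by omega)]
  rw [hJ, ← Ideal.span_singleton_pow, span_yy, ← pow_mul] at hdvd
  have hJd : J ∣ PI g 1 ^ (6 * k0) := (mul_dvd_mul_iff_left hI).1 hdvd
  obtain ⟨i, _, hi⟩ := (dvd_prime_pow (PI_Prime g) _).1 hJd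
  rw [associated_iff_eq] at hi
  exact ⟨i, _, hb0, by rw [hJ, hi]⟩

theorem DD_class : Nonempty (ClassGroup (DD g) ≃* Multiplicative (ZMod 6)) := by
  have hP0 : PI g 1 ∈ nonZeroDivisors (Ideal (DD g)) :=
    mem_nonZeroDivisors_of_ne_zero (PI_Prime g).ne_zero
  set c := ClassGroup.mk0 (⟨PI g 1, hP0⟩ : nonZeroDivisors (Ideal (DD g))) with hc
  have hcp : ∀ m : ℕ, c ^ m = 1 ↔ (PI g 1 ^ m).IsPrincipal := by
    intro m
    rw [hc, ← map_pow]
    exact ClassGroup.mk0_eq_one_iff (pow_mem hP0 m)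
  have hord : orderOf c = 6 := by
    rw [orderOf_eq_iff (by omega)]
    refine ⟨(hcp 6).2 ?_, fun m hm hm0 h => ?_⟩
    · rw [← span_yy]
      exact ⟨⟨yy g, rfl⟩⟩
    · have := PI_pow_principal g m ((hcp m).1 h)
      omega
  have hgen : ∀ x, x ∈ Subgroup.zpowers c := by
    intro x
    obtain ⟨⟨I, hI⟩, rfl⟩ := ClassGroup.mk0_surjective x
    obtain ⟨i, b, hb, h⟩ := ideal_class g I (nonZeroDivisors.ne_zero hI)
    have h1 : ClassGroup.mk0 ⟨I, hI⟩ * c ^ i = 1 := by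
      rw [hc, ← map_pow, ← MonoidHom.map_mul]
      refine (ClassGroup.mk0_eq_one_iff (mul_mem hI (pow_mem hP0 i))).2 ?_
      rw [h]
      exact ⟨⟨b, rfl⟩⟩
    rw [eq_inv_of_mul_eq_one_left h1]
    exact inv_mem (pow_mem (Subgroup.mem_zpowers c) i)
  have hcard := orderOf_eq_card_of_forall_mem_zpowers hgen
  haveI : IsCyclic (ClassGroup (DD g)) := ⟨⟨c, hgen⟩⟩
  refine ⟨mulEquivOfCyclicCardEq ?_⟩
  rw [← hcard, hord]
  simp

end ClassGp

/-- Theorem 3.21: there is a Dedekind domain with class group `ℤ/6ℤ` that is an HFD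
but not an IDPD. -/
theorem exists_dedekind_hfd_not_idpd :
    ∃ (D : Type) (_ : CommRing D) (_ : IsDomain D) (_ : IsDedekindDomain D),
      Nonempty (ClassGroup D ≃* Multiplicative (ZMod 6)) ∧ IsHFD D ∧ ¬ IsIDPD D := by
  obtain ⟨K, _, ⟨Q, hQ, hQ2⟩, ⟨R, hR, hR3⟩, ⟨g, hg, hg6⟩, hdeg⟩ := exists_field
  haveI : Fact (Irreducible g) := ⟨hg⟩
  haveI : Fact (g.natDegree = 6) := ⟨hg6⟩
  exact ⟨DD g, inferInstance, inferInstance, inferInstance, DD_class g, DD_hfd g hdeg,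
    DD_not_idpd g hdeg Q R hQ hR hQ2 hR3⟩
end

section
/- Let D be a Dedekind domain. Then the following are equivalent: (i) the polynomial ring D[X] is an IDPD; (ii) D[X] is an HFD; (iii) the ideal class group ClassGroup D has at most 2 elements. -/
theorem idpd_to_hfd {R : Type*} [CommRing R] (h : IsIDPD R) : IsHFD R := by
  obtain ⟨hd, hat, hI⟩ := h
  refine ⟨hd, hat, ?_⟩
  have key : ∀ n : ℕ, ∀ s t : Multiset R, (∀ p ∈ s, Irreducible p) → (∀ q ∈ t, Irreducible q) →
      Associated s.prod t.prod → Multiset.card s = n → Multiset.card t = n := by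
    intro n
    induction n with
    | zero =>
      intro s t hs ht hst hn
      rw [Multiset.card_eq_zero] at hn
      subst hn
      rw [Multiset.prod_zero] at hst
      by_contra hc
      obtain ⟨q, hq⟩ := Multiset.card_pos_iff_exists_mem.1 (Nat.pos_of_ne_zero hc)
      exact (ht q hq).not_isUnit (isUnit_of_dvd_unit (Multiset.dvd_prod hq)
        (hst.isUnit isUnit_one))
    | succ n ih =>
      intro s t hs ht hst hn
      obtain ⟨p, s, rfl⟩ : ∃ p s', s = p ::ₘ s' := by
        obtain ⟨p, hp⟩ := Multiset.card_pos_iff_exists_mem.1 (show 0 < Multiset.card s by omega)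
        exact ⟨p, Multiset.exists_cons_of_mem hp⟩
      have hp := hs p (by simp)
      have hs' : ∀ p ∈ s, Irreducible p := fun a ha => hs a (by simp [ha])
      have hsn : Multiset.card s = n := by simpa using hn
      by_cases ht0 : t = 0
      · subst ht0
        exfalso
        apply hp.not_isUnit
        refine isUnit_of_dvd_unit (Multiset.dvd_prod (Multiset.mem_cons_self p s)) (hst.symm.isUnit (by simp))
      obtain ⟨q, hq⟩ := Multiset.exists_mem_of_ne_zero ht0
      obtain ⟨t, rfl⟩ := Multiset.exists_cons_of_mem hq
      have hq := ht q (by simp)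
      have ht' : ∀ p ∈ t, Irreducible p := fun a ha => ht a (by simp [ha])
      rw [Multiset.prod_cons, Multiset.prod_cons] at hst
      rw [Multiset.card_cons]
      congr 1
      by_cases hpq : Associated p q
      · exact ih s t hs' ht' (hst.of_mul_left hpq hp.ne_zero) hsn
      have hs0 : s.prod ≠ 0 := Multiset.prod_ne_zero fun h0 => (hs' 0 h0).ne_zero rfl
      obtain ⟨p', q', hp', hq', hass, w, hw⟩ := hI (p * s.prod) p q (mul_ne_zero hp.ne_zero hs0)
        (fun hu => hp.not_isUnit (isUnit_of_mul_isUnit_left hu)) hp hq (dvd_mul_right _ _)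
        ((dvd_mul_right q t.prod).trans hst.dvd') hpq
      have hw0 : w ≠ 0 := by
        rintro rfl
        exact mul_ne_zero hp.ne_zero hs0 (by simpa using hw)
      obtain ⟨l, hl, hlw⟩ : ∃ l : Multiset R, (∀ p ∈ l, Irreducible p) ∧ Associated l.prod w := by
        by_cases hu : IsUnit w
        · exact ⟨0, by simp, by simpa using (associated_one_iff_isUnit.2 hu).symm⟩
        · obtain ⟨l, hl, h⟩ := hat w hw0 hu
          exact ⟨l, hl, h ▸ Associated.refl _⟩
      have h1 : Associated s.prod (p' ::ₘ l).prod := by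
        rw [Multiset.prod_cons]
        refine Associated.of_mul_left (a := p) (c := p) ?_ (Associated.refl p) hp.ne_zero
        rw [hw, ← mul_assoc]
        exact hass.symm.mul_mul hlw.symm
      have h2 : Associated (q' ::ₘ l).prod t.prod := by
        rw [Multiset.prod_cons]
        refine Associated.of_mul_left (a := q) (c := q) ?_ (Associated.refl q) hq.ne_zero
        refine Associated.trans ?_ hst
        rw [hw, ← mul_assoc]
        exact (Associated.refl _).mul_mul hlw
      have c1 := ih s (p' ::ₘ l) hs' (by simpa using ⟨hp', hl⟩) h1 hsn
      exact ih (q' ::ₘ l) t (by simpa using ⟨hq', hl⟩) ht' h2 (by simpa using c1)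
  intro s t hs ht hst
  exact (key _ s t hs ht (hst ▸ Associated.refl _) rfl).symm

/-- abstract transfer principle -/
theorem idpd_of_transfer {R S : Type*} [CommRing R] [IsDomain R] [WfDvdMonoid R]
    (φ : R → Multiset S) (T : S → Prop) [DecidablePred T]
    (hmul : ∀ a b, a ≠ 0 → b ≠ 0 → φ (a * b) = φ a + φ b)
    (hdvd : ∀ a b, a ≠ 0 → b ≠ 0 → φ a ≤ φ b → a ∣ b)
    (heven : ∀ a, a ≠ 0 → Even ((φ a).countP T))
    (hex : ∀ z m, z ≠ 0 → m ≤ φ z → Even (m.countP T) → ∃ a, a ≠ 0 ∧ φ a = m) :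
    IsIDPD R := by
  classical
  refine ⟨inferInstance, ?_, ?_⟩
  · intro z hz hu
    obtain ⟨l, hl, h, -⟩ := (WfDvdMonoid.not_isUnit_iff_exists_factors_eq z hz).1 hu
    exact ⟨l, hl, h⟩
  have h1 : φ 1 = 0 := by
    have := hmul 1 1 one_ne_zero one_ne_zero
    rw [mul_one] at this
    simpa using this
  have hunit : ∀ a, a ≠ 0 → (IsUnit a ↔ φ a = 0) := by
    intro a ha
    constructor
    · intro h
      obtain ⟨b, hb⟩ := h.exists_right_inv
      have hb0 : b ≠ 0 := by
        rintro rfl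
        simp at hb
      have := hmul a b ha hb0
      rw [hb, h1] at this
      exact (add_eq_zero.1 this.symm).1
    · intro h
      exact isUnit_of_dvd_one (hdvd a 1 ha one_ne_zero (by simp [h]))
  have hassoc : ∀ a b, a ≠ 0 → b ≠ 0 → φ a = φ b → Associated a b := fun a b ha hb h =>
    associated_of_dvd_dvd (hdvd a b ha hb h.le) (hdvd b a hb ha h.ge)
  have hle : ∀ a b, b ≠ 0 → a ∣ b → φ a ≤ φ b := by
    rintro a _ hb ⟨c, rfl⟩
    rw [hmul a c (left_ne_zero_of_mul hb) (right_ne_zero_of_mul hb)]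
    exact Multiset.le_add_right _ _
  have hmin : ∀ p, Irreducible p → ∀ m, m ≤ φ p → Even (m.countP T) → m ≠ 0 → m = φ p := by
    intro p hp m hm he hm0
    obtain ⟨a, ha0, rfl⟩ := hex p m hp.ne_zero hm he
    obtain ⟨b, hb⟩ := hdvd a p ha0 hp.ne_zero hm
    have hb0 : b ≠ 0 := by
      rintro rfl
      exact hp.ne_zero (by simpa using hb)
    have hf := hmul a b ha0 hb0
    rw [← hb] at hf
    rcases hp.isUnit_or_isUnit hb with h | h
    · exact absurd ((hunit a ha0).1 h) hm0
    · rw [(hunit b hb0).1 h] at hf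
      simp [hf]
  have hA : ∀ p, Irreducible p → ∀ s ∈ φ p, ¬ T s → φ p = {s} := by
    intro p hp s hs hT
    exact (hmin p hp {s} (by simpa using hs) (by simp [← Multiset.cons_zero, hT]) (by simp)).symm
  have hB : ∀ p, Irreducible p → ∀ s ∈ φ p, T s → ∃ t, T t ∧ φ p = {s, t} := by
    intro p hp s hs hT
    obtain ⟨r, hr⟩ := Multiset.exists_cons_of_mem hs
    have he := heven p hp.ne_zero
    rw [hr, Multiset.countP_cons_of_pos _ hT] at he
    have : 0 < r.countP T := by
      rcases Nat.eq_zero_or_pos (r.countP T) with h | h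
      · rw [h] at he
        simp at he
      · exact h
    obtain ⟨t, ht, hTt⟩ := Multiset.countP_pos.1 this
    refine ⟨t, hTt, (hmin p hp {s, t} ?_ ?_ ?_).symm⟩
    · rw [hr]
      exact Multiset.cons_le_cons _ (by simpa using ht)
    · rw [Multiset.insert_eq_cons, Multiset.countP_cons_of_pos _ hT, ← Multiset.cons_zero,
        Multiset.countP_cons_of_pos _ hTt, Multiset.countP_zero]
      decide
    · simp
  have hirr : ∀ a, a ≠ 0 → ∀ s t, T s → T t → φ a = {s, t} → Irreducible a := by
    intro a ha s t hs ht hst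
    refine ⟨fun h => ?_, ?_⟩
    · have := (hunit a ha).1 h
      rw [hst] at this
      simp at this
    · rintro x y rfl
      have hx := left_ne_zero_of_mul ha
      have hy := right_ne_zero_of_mul ha
      rw [hmul x y hx hy] at hst
      have hall : ∀ u ∈ φ x + φ y, T u := by
        rw [hst]
        simp [hs, ht]
      have e1 := heven x hx
      have e2 := heven y hy
      rw [Multiset.countP_eq_card.2 (fun u hu => hall u (by simp [hu]))] at e1 e2
      have hc := congrArg Multiset.card hst
      simp only [Multiset.card_add, Multiset.insert_eq_cons, Multiset.card_cons,
        Multiset.card_singleton] at hc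
      rw [hunit x hx, hunit y hy, ← Multiset.card_eq_zero, ← Multiset.card_eq_zero]
      obtain ⟨i, hi⟩ := e1
      obtain ⟨j, hj⟩ := e2
      omega
  intro z p q hz _ hp hq hpz hqz hpq
  have hpz' := hle p z hz hpz
  have hqz' := hle q z hz hqz
  by_cases hdis : Disjoint (φ p) (φ q)
  · refine ⟨q, p, hq, hp, by rw [mul_comm], ?_⟩
    refine hdvd _ _ (mul_ne_zero hq.ne_zero hp.ne_zero) hz ?_
    rw [hmul _ _ hq.ne_zero hp.ne_zero, Multiset.add_eq_union_iff_disjoint.2 hdis.symm]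
    exact Multiset.union_le hqz' hpz'
  obtain ⟨s, hsp, hsq⟩ : ∃ s, s ∈ φ p ∧ s ∈ φ q := by
    by_contra hcon
    push Not at hcon
    exact hdis (Multiset.disjoint_left.2 fun {a} ha hb => hcon a ha hb)
  by_cases hT : T s
  swap
  · exact absurd (hassoc p q hp.ne_zero hq.ne_zero
      ((hA p hp s hsp hT).trans (hA q hq s hsq hT).symm)) hpq
  obtain ⟨t, ht, hpt⟩ := hB p hp s hsp hT
  obtain ⟨u, hu, hqu⟩ := hB q hq s hsq hT
  have htu : t ≠ u := by
    rintro rfl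
    exact hpq (hassoc p q hp.ne_zero hq.ne_zero (hpt.trans hqu.symm))
  obtain ⟨r, hr⟩ := Multiset.exists_cons_of_mem (Multiset.mem_of_le hpz' hsp)
  rw [hr, hpt, Multiset.insert_eq_cons, Multiset.cons_le_cons_iff, Multiset.singleton_le] at hpz'
  rw [hr, hqu, Multiset.insert_eq_cons, Multiset.cons_le_cons_iff, Multiset.singleton_le] at hqz'
  obtain ⟨r, rfl⟩ := Multiset.exists_cons_of_mem hpz'
  rw [Multiset.mem_cons] at hqz'
  obtain ⟨r, rfl⟩ := Multiset.exists_cons_of_mem (hqz'.resolve_left htu.symm)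
  have he := heven z hz
  rw [hr, Multiset.countP_cons_of_pos _ hT, Multiset.countP_cons_of_pos _ ht,
    Multiset.countP_cons_of_pos _ hu] at he
  have : 0 < r.countP T := by
    rcases Nat.eq_zero_or_pos (r.countP T) with h | h
    · rw [h] at he
      exact absurd he (by decide)
    · exact h
  obtain ⟨v, hv, hTv⟩ := Multiset.countP_pos.1 this
  obtain ⟨r, rfl⟩ := Multiset.exists_cons_of_mem hv
  have hr1 : φ z = {u, v} + (s ::ₘ t ::ₘ r) := by
    rw [hr]
    simp only [← Multiset.singleton_add, Multiset.insert_eq_cons]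
    abel
  have hr2 : φ z = {t, v} + (s ::ₘ u ::ₘ r) := by
    rw [hr]
    simp only [← Multiset.singleton_add, Multiset.insert_eq_cons]
    abel
  have hr3 : φ z = {s, u} + {t, v} + r := by
    rw [hr]
    simp only [← Multiset.singleton_add, Multiset.insert_eq_cons]
    abel
  have heT : ∀ a b, T a → T b → Even (Multiset.countP T {a, b}) := by
    intro a b ha hb
    rw [Multiset.insert_eq_cons, Multiset.countP_cons_of_pos _ ha, ← Multiset.cons_zero,
      Multiset.countP_cons_of_pos _ hb, Multiset.countP_zero]
    decide
  obtain ⟨p', hp'0, hp'⟩ := hex z {u, v} hz (hr1 ▸ Multiset.le_add_right _ _) (heT _ _ hu hTv)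
  obtain ⟨q', hq'0, hq'⟩ := hex z {t, v} hz (hr2 ▸ Multiset.le_add_right _ _) (heT _ _ ht hTv)
  refine ⟨p', q', hirr p' hp'0 u v hu hTv hp', hirr q' hq'0 t v ht hTv hq', ?_, ?_⟩
  · refine hassoc _ _ (mul_ne_zero hp.ne_zero hp'0) (mul_ne_zero hq.ne_zero hq'0) ?_
    rw [hmul _ _ hp.ne_zero hp'0, hmul _ _ hq.ne_zero hq'0, hpt, hqu, hp', hq']
    simp only [← Multiset.singleton_add, Multiset.insert_eq_cons]
    abel
  · refine hdvd _ _ (mul_ne_zero hq.ne_zero hq'0) hz ?_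
    rw [hmul _ _ hq.ne_zero hq'0, hqu, hq', hr3]
    exact Multiset.le_add_right _ _
set_option linter.overlappingInstances false
set_option linter.unusedSectionVars false

section content
open Polynomial

theorem contentIdeal_C_mul' {R : Type*} [CommRing R] (a : R) (p : R[X]) :
    (C a * p).contentIdeal = Ideal.span {a} * p.contentIdeal := by
  apply le_antisymm
  · refine (contentIdeal_mul_le_mul_contentIdeal _ _).trans ?_
    rw [contentIdeal_C]
  · rw [contentIdeal_def p, Ideal.span_mul_span', Ideal.span_le]
    rintro _ ⟨x, hx, y, hy, rfl⟩
    rw [Set.mem_singleton_iff] at hx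
    subst hx
    obtain ⟨n, -, rfl⟩ := mem_coeffs_iff.1 hy
    have := coeff_mem_contentIdeal (C x * p) n
    rwa [coeff_C_mul] at this

theorem C_dvd_of_contentIdeal_le {R : Type*} [CommRing R] {a : R} {p : R[X]}
    (h : p.contentIdeal ≤ Ideal.span {a}) : C a ∣ p := by
  rw [C_dvd_iff_dvd_coeff]
  exact fun i => Ideal.mem_span_singleton.1 (h (coeff_mem_contentIdeal p i))

theorem contentIdeal_mul_of_pid {R : Type*} [CommRing R] [IsDomain R] [IsPrincipalIdealRing R]
    (p q : R[X]) : (p * q).contentIdeal = p.contentIdeal * q.contentIdeal := by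
  by_cases hp : p = 0
  · simp [hp]
  by_cases hq : q = 0
  · simp [hq]
  have key : ∀ p : R[X], p ≠ 0 → ∃ a p', p = C a * p' ∧ p'.contentIdeal = ⊤ := by
    intro p hp
    obtain ⟨a, ha⟩ := (IsPrincipalIdealRing.principal p.contentIdeal).principal
    change p.contentIdeal = Ideal.span {a} at ha
    obtain ⟨p', hp'⟩ := C_dvd_of_contentIdeal_le ha.le
    have ha0 : a ≠ 0 := by
      rintro rfl
      exact hp (by simpa using hp')
    refine ⟨a, p', hp', ?_⟩
    have h1 := contentIdeal_C_mul' a p'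
    rw [← hp', ha] at h1
    have h2 : Ideal.span {a} * p'.contentIdeal = Ideal.span {a} * ⊤ := by rw [← h1, Ideal.mul_top]
    exact (Ideal.span_singleton_mul_right_inj ha0).1 h2
  obtain ⟨a, p, rfl, hp1⟩ := key p hp
  obtain ⟨b, q, rfl, hq1⟩ := key q hq
  have : C a * p * (C b * q) = C a * (C b * (p * q)) := by ring
  rw [this, contentIdeal_C_mul', contentIdeal_C_mul', contentIdeal_C_mul', contentIdeal_C_mul',
    contentIdeal_mul_eq_top_of_contentIdeal_eq_top hp1 hq1, hp1, hq1]
  simp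

variable {D : Type*} [CommRing D] [IsDomain D] [IsDedekindDomain D]

theorem contentIdeal_mul_ded (p q : D[X]) :
    (p * q).contentIdeal = p.contentIdeal * q.contentIdeal := by
  refine Ideal.eq_of_localization_maximal fun P hP => ?_
  have : IsDomain (Localization.AtPrime P) := inferInstance
  have : IsDedekindDomain (Localization.AtPrime P) :=
    IsLocalization.isDedekindDomain D P.primeCompl_le_nonZeroDivisors _
  have : IsPrincipalIdealRing (Localization.AtPrime P) :=
    IsPrincipalIdealRing.of_finite_maximals (by
      refine Set.Finite.subset (Set.finite_singleton (IsLocalRing.maximalIdeal _)) ?_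
      intro I hI
      exact IsLocalRing.eq_maximalIdeal hI)
  rw [Ideal.map_mul, ← contentIdeal_map_eq_map_contentIdeal, ← contentIdeal_map_eq_map_contentIdeal,
    ← contentIdeal_map_eq_map_contentIdeal, Polynomial.map_mul, contentIdeal_mul_of_pid]

/-- class of the content -/
noncomputable def ccls (f : D[X]) (hf : f ≠ 0) : ClassGroup D :=
  ClassGroup.mk0 ⟨f.contentIdeal, mem_nonZeroDivisors_of_ne_zero
    (fun h => hf ((contentIdeal_eq_bot_iff f).1 h))⟩

theorem ccls_mul (f g : D[X]) (hf : f ≠ 0) (hg : g ≠ 0) :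
    ccls (f * g) (mul_ne_zero hf hg) = ccls f hf * ccls g hg := by
  unfold ccls
  rw [← map_mul]
  congr 1
  ext1
  exact contentIdeal_mul_ded f g

theorem ccls_C (a : D) (ha : C a ≠ 0) : ccls (C a) ha = 1 := by
  unfold ccls
  rw [ClassGroup.mk0_eq_one_iff, contentIdeal_C]
  exact ⟨a, rfl⟩

theorem ccls_eq_of_C_mul {f g : D[X]} (hf : f ≠ 0) (hg : g ≠ 0) {a b : D} (ha : a ≠ 0)
    (hb : b ≠ 0) (h : C a * f = C b * g) : ccls f hf = ccls g hg := by
  have h1 := ccls_mul (C a) f (C_ne_zero.2 ha) hf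
  have h2 := ccls_mul (C b) g (C_ne_zero.2 hb) hg
  rw [ccls_C, one_mul] at h1 h2
  rw [← h1, ← h2]
  congr 1

/-- clearing denominators -/
theorem exists_clear (P : (FractionRing D)[X]) :
    ∃ (d : D) (f : D[X]), d ≠ 0 ∧ f.map (algebraMap D (FractionRing D)) =
      C (algebraMap D (FractionRing D) d) * P := by
  obtain ⟨b, hb, h⟩ := IsLocalization.integerNormalization_spec (nonZeroDivisors D) P
  refine ⟨b, _, nonZeroDivisors.ne_zero hb, h.trans ?_⟩
  rw [← IsScalarTower.algebraMap_smul (FractionRing D) b P, smul_eq_C_mul]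

theorem map_inj' {f g : D[X]} (h : f.map (algebraMap D (FractionRing D)) =
    g.map (algebraMap D (FractionRing D))) : f = g :=
  map_injective _ (IsFractionRing.injective D (FractionRing D)) h

theorem map_ne_zero' {f : D[X]} (hf : f ≠ 0) : f.map (algebraMap D (FractionRing D)) ≠ 0 := by
  intro h
  exact hf (map_inj' (by simpa using h))

theorem ccls_eq_of_assoc {f g : D[X]} (hf : f ≠ 0) (hg : g ≠ 0)
    (h : Associated (f.map (algebraMap D (FractionRing D)))
      (g.map (algebraMap D (FractionRing D)))) : ccls f hf = ccls g hg := by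
  obtain ⟨u, hu⟩ := h
  obtain ⟨c, hc, hcu⟩ := Polynomial.isUnit_iff.1 u.isUnit
  obtain ⟨x, y, hy, rfl⟩ := IsFractionRing.div_surjective (A := D) c
  have hy0 := nonZeroDivisors.ne_zero hy
  have hy1 : algebraMap D (FractionRing D) y ≠ 0 := by
    simpa using hy0
  have hx0 : x ≠ 0 := by
    rintro rfl
    simp at hc
  refine ccls_eq_of_C_mul hf hg hx0 hy0 (map_inj' ?_)
  rw [Polynomial.map_mul, Polynomial.map_mul, map_C, map_C, ← hu, ← hcu]
  rw [mul_left_comm, ← C_mul, mul_div_cancel₀ _ hy1, mul_comm]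

theorem dvd_of_map_dvd {f g : D[X]} (hf : f ≠ 0) (hg : g ≠ 0)
    (h1 : f.contentIdeal ∣ g.contentIdeal)
    (h2 : f.map (algebraMap D (FractionRing D)) ∣ g.map (algebraMap D (FractionRing D))) :
    f ∣ g := by
  obtain ⟨J, hJ⟩ := h1
  obtain ⟨H, hH⟩ := h2
  obtain ⟨d, h0, hd, hh⟩ := exists_clear H
  have e : C d * g = f * h0 := by
    apply map_inj'
    rw [Polynomial.map_mul, Polynomial.map_mul, map_C, hh, hH]
    ring
  have e2 := congrArg contentIdeal e
  rw [contentIdeal_C_mul', contentIdeal_mul_ded, hJ, mul_left_comm] at e2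
  have e3 := mul_left_cancel₀ (fun h => hf ((contentIdeal_eq_bot_iff f).1 h)) e2
  obtain ⟨h1, rfl⟩ := C_dvd_of_contentIdeal_le (a := d) (p := h0) (e3 ▸ Ideal.mul_le_left)
  refine ⟨h1, mul_left_cancel₀ (C_ne_zero.2 hd) ?_⟩
  rw [e]
  ring

/-- realising a pair -/
theorem exists_real {I : Ideal D} (hI : I ∈ nonZeroDivisors (Ideal D)) {g : D[X]} (hg : g ≠ 0)
    (h : ccls g hg = ClassGroup.mk0 ⟨I, hI⟩) :
    ∃ f : D[X], f ≠ 0 ∧ f.contentIdeal = I ∧ ∃ x y : D, x ≠ 0 ∧ y ≠ 0 ∧ C x * g = C y * f := by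
  obtain ⟨x, y, hx, hy, hxy⟩ := ClassGroup.mk0_eq_mk0_iff.1 h
  simp only at hxy
  rw [← contentIdeal_C_mul'] at hxy
  obtain ⟨f, hf⟩ := C_dvd_of_contentIdeal_le (a := y) (p := C x * g) (hxy ▸ Ideal.mul_le_left)
  rw [hf, contentIdeal_C_mul'] at hxy
  refine ⟨f, ?_, (Ideal.span_singleton_mul_right_inj hy).1 hxy, x, y, hx, hy, hf⟩
  rintro rfl
  simp [hx, hg] at hf

theorem assoc_of_C_mul {f g : D[X]} {x y : D} (hx : x ≠ 0) (hy : y ≠ 0)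
    (h : C x * g = C y * f) : Associated (f.map (algebraMap D (FractionRing D)))
      (g.map (algebraMap D (FractionRing D))) := by
  have hu : ∀ x : D, x ≠ 0 → IsUnit (C (algebraMap D (FractionRing D) x)) := fun x hx =>
    Polynomial.isUnit_C.2 (IsUnit.mk0 _ (by simpa using hx))
  have := congrArg (Polynomial.map (algebraMap D (FractionRing D))) h
  rw [Polynomial.map_mul, Polynomial.map_mul, map_C, map_C] at this
  exact ((associated_isUnit_mul_left_iff (hu y hy)).1 ((associated_isUnit_mul_right_iff (hu x hx)).1 (this ▸ Associated.refl _)))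

end content
section forward
open Polynomial

variable {D : Type*} [CommRing D] [IsDomain D] [IsDedekindDomain D]

theorem exists_linear (x : ClassGroup D) :
    ∃ (f : D[X]) (hf : f ≠ 0), f.natDegree = 1 ∧ ccls f hf = x := by
  obtain ⟨⟨I, hI⟩, rfl⟩ := ClassGroup.mk0_surjective x
  have hI0 : I ≠ ⊥ := nonZeroDivisors.ne_zero hI
  obtain ⟨a, haI, ha⟩ := Submodule.exists_mem_ne_zero_of_ne_bot hI0
  obtain ⟨b, hb⟩ := IsDedekindDomain.exists_eq_span_pair haI ha
  have hdeg : (C a * X + C b).natDegree = 1 := natDegree_linear ha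
  have hf : C a * X + C b ≠ 0 := by
    intro h
    rw [h] at hdeg
    simp at hdeg
  refine ⟨C a * X + C b, hf, hdeg, ?_⟩
  unfold ccls
  congr 1
  ext1
  change (C a * X + C b).contentIdeal = I
  rw [hb]
  apply le_antisymm
  · rw [contentIdeal_def, Ideal.span_le]
    intro r hr
    obtain ⟨n, -, rfl⟩ := mem_coeffs_iff.1 hr
    have h1 : a ∈ Ideal.span {a, b} := Ideal.subset_span (by simp)
    have h2 : b ∈ Ideal.span {a, b} := Ideal.subset_span (by simp)
    rw [SetLike.mem_coe, coeff_add, coeff_C_mul, coeff_C]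
    refine add_mem (Ideal.mul_mem_right _ _ h1) ?_
    split_ifs
    · exact h2
    · exact zero_mem _
  · rw [Ideal.span_le]
    rintro r (rfl | hr)
    · have := coeff_mem_contentIdeal (C r * X + C b) 1
      simpa using this
    · rw [Set.mem_singleton_iff] at hr
      subst hr
      have := coeff_mem_contentIdeal (C a * X + C r) 0
      simpa using this

theorem ccls_of_top {g : D[X]} (hg : g ≠ 0) (h : g.contentIdeal = ⊤) : ccls g hg = 1 := by
  unfold ccls
  rw [ClassGroup.mk0_eq_one_iff, h]
  exact top_isPrincipal

theorem natDegree_map' (f : D[X]) :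
    (f.map (algebraMap D (FractionRing D))).natDegree = f.natDegree :=
  natDegree_map_eq_of_injective (IsFractionRing.injective D (FractionRing D)) f

theorem unit_of_small {l : Multiset D[X]}
    (hl : ∀ f ∈ l, f.natDegree = 1 ∧ ∃ hf : f ≠ 0, ccls f hf ≠ 1)
    {g : D[X]} (hg : g.contentIdeal = ⊤) (hd : g.natDegree ≤ 1)
    (hdvd : g.map (algebraMap D (FractionRing D)) ∣ l.prod.map (algebraMap D (FractionRing D))) :
    IsUnit g := by
  have irr : ∀ f : D[X], f.natDegree = 1 → Irreducible (f.map (algebraMap D (FractionRing D))) := by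
    intro f hf
    apply irreducible_of_degree_eq_one
    rw [degree_eq_natDegree (map_ne_zero' (by
      rintro rfl
      simp at hf)), natDegree_map', hf]
    rfl
  have hg0 : g ≠ 0 := by
    rintro rfl
    rw [contentIdeal_zero] at hg
    exact bot_ne_top hg
  rcases Nat.le_one_iff_eq_zero_or_eq_one.1 hd with h | h
  · obtain ⟨a, rfl⟩ := natDegree_eq_zero.1 h
    rw [contentIdeal_C, Ideal.span_singleton_eq_top] at hg
    exact isUnit_C.2 hg
  · exfalso
    rw [← coe_mapRingHom, map_multiset_prod] at hdvd
    obtain ⟨f, hfl, hf⟩ := (irr g h).prime.exists_mem_multiset_map_dvd hdvd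
    obtain ⟨hf1, hf0, hfc⟩ := hl f hfl
    have := (irr g h).associated_of_dvd (irr f hf1) hf
    exact hfc ((ccls_eq_of_assoc hg0 hf0 this).symm.trans (ccls_of_top hg0 hg))

theorem exists_prim (l : Multiset D[X])
    (hl : ∀ f ∈ l, f.natDegree = 1 ∧ ∃ hf : f ≠ 0, ccls f hf ≠ 1)
    (h2 : 2 ≤ Multiset.card l) (h3 : Multiset.card l ≤ 3) (h0 : l.prod ≠ 0)
    (h : ccls l.prod h0 = 1) :
    ∃ F : D[X], Irreducible F ∧ F.contentIdeal = ⊤ ∧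
      Associated (F.map (algebraMap D (FractionRing D)))
        (l.prod.map (algebraMap D (FractionRing D))) := by
  have htop : (⊤ : Ideal D) ∈ nonZeroDivisors (Ideal D) :=
    mem_nonZeroDivisors_of_ne_zero top_ne_bot
  obtain ⟨F, hF0, hF, x, y, hx, hy, hxy⟩ := exists_real htop h0
    (h.trans ((ClassGroup.mk0_eq_one_iff htop).2 top_isPrincipal).symm)
  have has := assoc_of_C_mul hx hy hxy
  have hdeg : F.natDegree = Multiset.card l := by
    rw [← natDegree_map', natDegree_eq_of_degree_eq (degree_eq_degree_of_associated has),
      natDegree_map', natDegree_multiset_prod _ (fun h => h0 (Multiset.prod_eq_zero h))]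
    rw [Multiset.map_congr rfl (fun f hf => (hl f hf).1)]
    simp
  refine ⟨F, ⟨fun hu => ?_, ?_⟩, hF, has⟩
  · have := natDegree_eq_zero_of_isUnit hu
    omega
  · rintro g k rfl
    have hg := contentIdeal_eq_top_of_contentIdeal_mul_eq_top hF
    have hk : k.contentIdeal = ⊤ := by
      rw [mul_comm] at hF
      exact contentIdeal_eq_top_of_contentIdeal_mul_eq_top hF
    have hm := natDegree_mul (left_ne_zero_of_mul hF0) (right_ne_zero_of_mul hF0)
    rw [Polynomial.map_mul] at has
    by_cases hg1 : g.natDegree ≤ 1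
    · exact Or.inl (unit_of_small hl hg hg1 ((dvd_mul_right _ _).trans has.dvd))
    · exact Or.inr (unit_of_small hl hk (by omega) ((dvd_mul_left _ _).trans has.dvd))

open Cardinal in
theorem card_le_of_hfd (h : IsHFD D[X]) : #(ClassGroup D) ≤ 2 := by
  obtain ⟨-, -, h⟩ := h
  by_contra hc
  have hc3 : 3 ≤ #(ClassGroup D) := by
    have := Order.succ_le_of_lt (not_le.1 hc)
    refine le_trans ?_ this
    have e : (3 : Cardinal) = ((3 : ℕ) : Cardinal) := by norm_num
    have e2 : (2 : Cardinal) = ((2 : ℕ) : Cardinal) := by norm_num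
    rw [e, e2, Cardinal.succ_natCast]
    norm_num
  obtain ⟨x, hx, -⟩ := Cardinal.exists_ne_ne_of_three_le hc3 1 1
  obtain ⟨y, hy, hxy⟩ := Cardinal.exists_ne_ne_of_three_le hc3 1 x⁻¹
  have hxy' : x * y ≠ 1 := fun h => hxy (eq_inv_of_mul_eq_one_right h)
  obtain ⟨a, ha0, ha, hac⟩ := exists_linear x
  obtain ⟨b, hb0, hb, hbc⟩ := exists_linear y
  obtain ⟨c, hc0, hc, hcc⟩ := exists_linear (x * y)⁻¹
  obtain ⟨a', ha0', ha', hac'⟩ := exists_linear x⁻¹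
  obtain ⟨b', hb0', hb', hbc'⟩ := exists_linear y⁻¹
  obtain ⟨c', hc0', hc', hcc'⟩ := exists_linear (x * y)
  have A : a.natDegree = 1 ∧ ∃ hf : a ≠ 0, ccls a hf ≠ 1 := ⟨ha, ha0, hac ▸ hx⟩
  have B : b.natDegree = 1 ∧ ∃ hf : b ≠ 0, ccls b hf ≠ 1 := ⟨hb, hb0, hbc ▸ hy⟩
  have HC1 : c.natDegree = 1 ∧ ∃ hf : c ≠ 0, ccls c hf ≠ 1 := ⟨hc, hc0, hcc ▸ inv_ne_one.2 hxy'⟩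
  have A' : a'.natDegree = 1 ∧ ∃ hf : a' ≠ 0, ccls a' hf ≠ 1 := ⟨ha', ha0', hac' ▸ inv_ne_one.2 hx⟩
  have B' : b'.natDegree = 1 ∧ ∃ hf : b' ≠ 0, ccls b' hf ≠ 1 := ⟨hb', hb0', hbc' ▸ inv_ne_one.2 hy⟩
  have HC2 : c'.natDegree = 1 ∧ ∃ hf : c' ≠ 0, ccls c' hf ≠ 1 := ⟨hc', hc0', hcc' ▸ hxy'⟩
  have three : ∀ f g k : D[X], (f.natDegree = 1 ∧ ∃ hf : f ≠ 0, ccls f hf ≠ 1) →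
      (g.natDegree = 1 ∧ ∃ hf : g ≠ 0, ccls g hf ≠ 1) →
      (k.natDegree = 1 ∧ ∃ hf : k ≠ 0, ccls k hf ≠ 1) →
      (∀ hf hg hk, ccls f hf * (ccls g hg * ccls k hk) = 1) →
      ∃ F : D[X], Irreducible F ∧ F.contentIdeal = ⊤ ∧
      Associated (F.map (algebraMap D (FractionRing D)))
        ((f * (g * k)).map (algebraMap D (FractionRing D))) := by
    intro f g k hf hg hk hp
    have := exists_prim {f, g, k} (by simpa using ⟨hf, hg, hk⟩) (by simp) (by simp)
      (by simpa using ⟨hf.2.1, hg.2.1, hk.2.1⟩) (by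
        obtain ⟨-, hf, -⟩ := hf
        obtain ⟨-, hg, -⟩ := hg
        obtain ⟨-, hk, -⟩ := hk
        refine Eq.trans ?_ (hp hf hg hk)
        rw [← ccls_mul, ← ccls_mul]
        congr 1
        simp)
    simpa using this
  have two : ∀ f g : D[X], (f.natDegree = 1 ∧ ∃ hf : f ≠ 0, ccls f hf ≠ 1) →
      (g.natDegree = 1 ∧ ∃ hf : g ≠ 0, ccls g hf ≠ 1) →
      (∀ hf hg, ccls f hf * ccls g hg = 1) →
      ∃ F : D[X], Irreducible F ∧ F.contentIdeal = ⊤ ∧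
      Associated (F.map (algebraMap D (FractionRing D)))
        ((f * g).map (algebraMap D (FractionRing D))) := by
    intro f g hf hg hp
    have := exists_prim {f, g} (by simpa using ⟨hf, hg⟩) (by simp) (by simp)
      (by simpa using ⟨hf.2.1, hg.2.1⟩) (by
        obtain ⟨-, hf, -⟩ := hf
        obtain ⟨-, hg, -⟩ := hg
        refine Eq.trans ?_ (hp hf hg)
        rw [← ccls_mul]
        congr 1
        simp)
    simpa using this
  obtain ⟨F1, iF1, tF1, aF1⟩ := three a b c A B HC1 (fun _ _ _ => by
    rw [hac, hbc, hcc, ← mul_assoc, mul_inv_cancel])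
  obtain ⟨F2, iF2, tF2, aF2⟩ := three a' b' c' A' B' HC2 (fun _ _ _ => by
    rw [hac', hbc', hcc', ← mul_assoc, ← mul_inv, inv_mul_cancel])
  obtain ⟨G1, iG1, tG1, aG1⟩ := two a a' A A' (fun _ _ => by rw [hac, hac', mul_inv_cancel])
  obtain ⟨G2, iG2, tG2, aG2⟩ := two b b' B B' (fun _ _ => by rw [hbc, hbc', mul_inv_cancel])
  obtain ⟨G3, iG3, tG3, aG3⟩ := two c c' HC1 HC2 (fun _ _ => by rw [hcc, hcc', inv_mul_cancel])
  have tF := contentIdeal_mul_eq_top_of_contentIdeal_eq_top tF1 tF2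
  have tG := contentIdeal_mul_eq_top_of_contentIdeal_eq_top tG1
    (contentIdeal_mul_eq_top_of_contentIdeal_eq_top tG2 tG3)
  have nF := mul_ne_zero iF1.ne_zero iF2.ne_zero
  have nG := mul_ne_zero iG1.ne_zero (mul_ne_zero iG2.ne_zero iG3.ne_zero)
  have e : a * (b * c) * (a' * (b' * c')) = (a * a') * ((b * b') * (c * c')) := by ring
  have as : Associated ((F1 * F2).map (algebraMap D (FractionRing D)))
      ((G1 * (G2 * G3)).map (algebraMap D (FractionRing D))) := by
    have l := aF1.mul_mul aF2
    have r := aG1.mul_mul (aG2.mul_mul aG3)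
    simp only [← Polynomial.map_mul] at l r
    rw [e] at l
    exact l.trans r.symm
  have as' : Associated (F1 * F2) (G1 * (G2 * G3)) := associated_of_dvd_dvd
    (dvd_of_map_dvd nF nG (by rw [tF, tG]) as.dvd)
    (dvd_of_map_dvd nG nF (by rw [tF, tG]) as.symm.dvd)
  obtain ⟨u, hu⟩ := as'
  have := h {F1, F2 * u} {G1, G2, G3}
    (by simpa using ⟨iF1, (irreducible_mul_units u).2 iF2⟩)
    (by simpa using ⟨iG1, iG2, iG3⟩) (by simpa [mul_assoc] using hu)
  simp at this

end forward
section backward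
open Polynomial

variable {D : Type*} [CommRing D] [IsDomain D] [IsDedekindDomain D]

open Classical in
/-- class of an ideal (junk value at zero) -/
noncomputable def icls (I : Ideal D) : ClassGroup D :=
  if h : I ∈ nonZeroDivisors (Ideal D) then ClassGroup.mk0 ⟨I, h⟩ else 1

theorem icls_of {I : Ideal D} (h : I ∈ nonZeroDivisors (Ideal D)) :
    icls I = ClassGroup.mk0 ⟨I, h⟩ := dif_pos h

theorem icls_one : icls (1 : Ideal D) = 1 := by
  rw [icls_of (one_mem _)]
  exact map_one _

theorem icls_mul {I J : Ideal D} (hI : I ≠ 0) (hJ : J ≠ 0) : icls (I * J) = icls I * icls J := by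
  have hI' := mem_nonZeroDivisors_of_ne_zero hI
  have hJ' := mem_nonZeroDivisors_of_ne_zero hJ
  rw [icls_of hI', icls_of hJ', icls_of (mul_mem hI' hJ'), ← map_mul]
  rfl

open Classical in
/-- class of a polynomial over the fraction field (junk value at zero) -/
noncomputable def pcls (P : (FractionRing D)[X]) : ClassGroup D :=
  if h : ∃ (f : D[X]) (_ : f ≠ 0), Associated (f.map (algebraMap D (FractionRing D))) P then
    ccls h.choose h.choose_spec.choose else 1

theorem pcls_of {P : (FractionRing D)[X]} {f : D[X]} (hf : f ≠ 0)
    (h : Associated (f.map (algebraMap D (FractionRing D))) P) : pcls P = ccls f hf := by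
  have h' : ∃ (f : D[X]) (_ : f ≠ 0), Associated (f.map (algebraMap D (FractionRing D))) P :=
    ⟨f, hf, h⟩
  unfold pcls
  rw [dif_pos h']
  exact ccls_eq_of_assoc _ _ (h'.choose_spec.choose_spec.trans h.symm)

theorem exists_rep {P : (FractionRing D)[X]} (hP : P ≠ 0) :
    ∃ (f : D[X]) (_ : f ≠ 0), Associated (f.map (algebraMap D (FractionRing D))) P := by
  obtain ⟨d, f, hd, hf⟩ := exists_clear P
  have hd' : algebraMap D (FractionRing D) d ≠ 0 := by simpa using hd
  refine ⟨f, ?_, ?_⟩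
  · rintro rfl
    simp [hd, hP] at hf
  · rw [hf]
    exact (associated_isUnit_mul_left_iff (isUnit_C.2 (IsUnit.mk0 _ hd'))).2 (Associated.refl _)

theorem pcls_one : pcls (1 : (FractionRing D)[X]) = 1 := by
  rw [pcls_of (f := 1) one_ne_zero (by simp), ccls_of_top one_ne_zero contentIdeal_one]

theorem pcls_mul {P Q : (FractionRing D)[X]} (hP : P ≠ 0) (hQ : Q ≠ 0) :
    pcls (P * Q) = pcls P * pcls Q := by
  obtain ⟨f, hf, hfP⟩ := exists_rep hP
  obtain ⟨g, hg, hgQ⟩ := exists_rep hQ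
  rw [pcls_of hf hfP, pcls_of hg hgQ, pcls_of (mul_ne_zero hf hg) (f := f * g), ccls_mul]
  rw [Polynomial.map_mul]
  exact hfP.mul_mul hgQ

theorem icls_prod (m : Multiset (Ideal D)) (h : (0 : Ideal D) ∉ m) :
    icls m.prod = (m.map icls).prod := by
  induction m using Multiset.induction with
  | empty => simpa using icls_one
  | cons a m ih =>
    simp only [Multiset.mem_cons, not_or] at h
    rw [Multiset.prod_cons, Multiset.map_cons, Multiset.prod_cons, ← ih h.2,
      icls_mul (Ne.symm h.1) (Multiset.prod_ne_zero h.2)]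

theorem pcls_prod (m : Multiset (FractionRing D)[X]) (h : (0 : (FractionRing D)[X]) ∉ m) :
    pcls m.prod = (m.map pcls).prod := by
  induction m using Multiset.induction with
  | empty => simpa using pcls_one
  | cons a m ih =>
    simp only [Multiset.mem_cons, not_or] at h
    rw [Multiset.prod_cons, Multiset.map_cons, Multiset.prod_cons, ← ih h.2,
      pcls_mul (Ne.symm h.1) (Multiset.prod_ne_zero h.2)]

theorem cls_eq_iff {I : Ideal D} (hI : I ≠ 0) {P : (FractionRing D)[X]} (hP : P ≠ 0) :
    icls I = pcls P ↔ ∃ f : D[X], f ≠ 0 ∧ f.contentIdeal = I ∧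
      Associated (f.map (algebraMap D (FractionRing D))) P := by
  have hI' := mem_nonZeroDivisors_of_ne_zero hI
  constructor
  · intro h
    obtain ⟨g, hg, hgP⟩ := exists_rep hP
    rw [icls_of hI', pcls_of hg hgP] at h
    obtain ⟨f, hf, hc, x, y, hx, hy, hxy⟩ := exists_real hI' hg h.symm
    exact ⟨f, hf, hc, (assoc_of_C_mul hx hy hxy).trans hgP⟩
  · rintro ⟨f, hf, rfl, h⟩
    rw [pcls_of hf h, icls_of hI']
    rfl

open Cardinal in
theorem mul_eq_one_of_card {G : Type*} [CommGroup G] (h : #G ≤ 2) {x y : G} (hx : x ≠ 1)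
    (hy : y ≠ 1) : x * y = 1 := by
  by_contra hxy
  have hinj : Function.Injective ![1, x, x * y] := by
    intro i j hij
    fin_cases i <;> fin_cases j <;> simp_all [eq_comm]
  have h3 := Cardinal.lift_mk_le_lift_mk_of_injective hinj
  simp at h3
  have := h3.trans h
  norm_num at this

open Cardinal in
theorem even_iff {G S : Type*} [CommGroup G] (h : #G ≤ 2) (χ : S → G)
    [DecidablePred fun s => χ s ≠ 1] (m : Multiset S) :
    Even (m.countP fun s => χ s ≠ 1) ↔ (m.map χ).prod = 1 := by
  induction m using Multiset.induction with
  | empty => simp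
  | cons a m ih =>
    rw [Multiset.map_cons, Multiset.prod_cons]
    by_cases ha : χ a = 1
    · rw [Multiset.countP_cons_of_neg (p := fun s => χ s ≠ 1) _ (by simpa using ha), ih, ha, one_mul]
    · rw [Multiset.countP_cons_of_pos (p := fun s => χ s ≠ 1) _ ha, Nat.even_add_one, ih]
      constructor
      · exact fun hm => mul_eq_one_of_card h ha hm
      · intro h1 h2
        rw [h2, mul_one] at h1
        exact ha h1

theorem sum_decomp {A B : Type*} (m : Multiset (A ⊕ B)) :
    ∃ (m1 : Multiset A) (m2 : Multiset B), m = m1.map Sum.inl + m2.map Sum.inr := by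
  induction m using Multiset.induction with
  | empty => exact ⟨0, 0, by simp⟩
  | cons a m ih =>
    obtain ⟨m1, m2, rfl⟩ := ih
    rcases a with a | b
    · exact ⟨a ::ₘ m1, m2, by simp⟩
    · exact ⟨m1, b ::ₘ m2, by simp⟩

theorem sum_le {A B : Type*} {m1 n1 : Multiset A} {m2 n2 : Multiset B}
    (h : m1.map Sum.inl + m2.map Sum.inr ≤ n1.map (Sum.inl : A → A ⊕ B) + n2.map Sum.inr) :
    m1 ≤ n1 ∧ m2 ≤ n2 := by
  classical
  rw [Multiset.le_iff_count] at h
  constructor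
  · rw [Multiset.le_iff_count]
    intro a
    have := h (Sum.inl a)
    rw [Multiset.count_add, Multiset.count_add, Multiset.count_map_eq_count' _ _ Sum.inl_injective,
      Multiset.count_map_eq_count' _ _ Sum.inl_injective,
      Multiset.count_eq_zero_of_notMem (s := m2.map Sum.inr) (by simp),
      Multiset.count_eq_zero_of_notMem (s := n2.map Sum.inr) (by simp)] at this
    simpa using this
  · rw [Multiset.le_iff_count]
    intro a
    have := h (Sum.inr a)
    rw [Multiset.count_add, Multiset.count_add, Multiset.count_map_eq_count' _ _ Sum.inr_injective,
      Multiset.count_map_eq_count' _ _ Sum.inr_injective,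
      Multiset.count_eq_zero_of_notMem (s := m1.map Sum.inl) (by simp),
      Multiset.count_eq_zero_of_notMem (s := n1.map Sum.inl) (by simp)] at this
    simpa using this

open Cardinal UniqueFactorizationMonoid in
theorem idpd_of_card (h : #(ClassGroup D) ≤ 2) : IsIDPD D[X] := by
  classical
  let ψ : D[X] →+* (FractionRing D)[X] := mapRingHom (algebraMap D (FractionRing D))
  let φ : D[X] → Multiset (Ideal D ⊕ (FractionRing D)[X]) := fun f =>
    (normalizedFactors f.contentIdeal).map Sum.inl +
      (normalizedFactors (f.map (algebraMap D (FractionRing D)))).map Sum.inr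
  let χ : Ideal D ⊕ (FractionRing D)[X] → ClassGroup D := Sum.elim icls pcls
  have hc0 : ∀ f : D[X], f ≠ 0 → f.contentIdeal ≠ 0 := fun f hf h =>
    hf ((contentIdeal_eq_bot_iff f).1 h)
  have hχ : ∀ (m1 : Multiset (Ideal D)) (m2 : Multiset (FractionRing D)[X]), 0 ∉ m1 → 0 ∉ m2 →
      (Even ((m1.map Sum.inl + m2.map Sum.inr).countP fun s => χ s ≠ 1) ↔
        icls m1.prod = pcls m2.prod) := by
    intro m1 m2 h1 h2
    rw [even_iff h, icls_prod m1 h1, pcls_prod m2 h2, Multiset.map_add, Multiset.map_map,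
      Multiset.map_map, Multiset.prod_add]
    change (m1.map icls).prod * (m2.map pcls).prod = 1 ↔ _
    generalize (m1.map icls).prod = x
    generalize (m2.map pcls).prod = y
    constructor
    · intro hxy
      by_cases hx : x = 1
      · subst hx
        simpa using hxy.symm
      · have := mul_eq_one_of_card h hx hx
        exact mul_left_cancel (this.trans hxy.symm)
    · rintro rfl
      by_cases hx : x = 1
      · simp [hx]
      · exact mul_eq_one_of_card h hx hx
  refine idpd_of_transfer φ (fun s => χ s ≠ 1) ?_ ?_ ?_ ?_
  · intro a b ha hb
    simp only [φ]
    rw [contentIdeal_mul_ded, Polynomial.map_mul, normalizedFactors_mul (hc0 a ha) (hc0 b hb),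
      normalizedFactors_mul (map_ne_zero' ha) (map_ne_zero' hb), Multiset.map_add, Multiset.map_add]
    abel
  · intro a b ha hb hab
    obtain ⟨h1, h2⟩ := sum_le hab
    exact dvd_of_map_dvd ha hb
      ((dvd_iff_normalizedFactors_le_normalizedFactors (hc0 a ha) (hc0 b hb)).2 h1)
      ((dvd_iff_normalizedFactors_le_normalizedFactors (map_ne_zero' ha) (map_ne_zero' hb)).2 h2)
  · intro a ha
    simp only [φ]
    rw [hχ _ _ (zero_notMem_normalizedFactors _) (zero_notMem_normalizedFactors _),
      cls_eq_iff (Multiset.prod_ne_zero (zero_notMem_normalizedFactors _))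
        (Multiset.prod_ne_zero (zero_notMem_normalizedFactors _))]
    exact ⟨a, ha, (associated_iff_eq.1 (prod_normalizedFactors (hc0 a ha))).symm,
      (prod_normalizedFactors (map_ne_zero' ha)).symm⟩
  · intro z m hz hm he
    obtain ⟨m1, m2, rfl⟩ := sum_decomp m
    obtain ⟨h1, h2⟩ := sum_le hm
    have z1 : 0 ∉ m1 := fun h => zero_notMem_normalizedFactors _ (Multiset.mem_of_le h1 h)
    have z2 : 0 ∉ m2 := fun h => zero_notMem_normalizedFactors _ (Multiset.mem_of_le h2 h)
    rw [hχ _ _ z1 z2, cls_eq_iff (Multiset.prod_ne_zero z1) (Multiset.prod_ne_zero z2)] at he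
    obtain ⟨f, hf, hc, ha⟩ := he
    refine ⟨f, hf, ?_⟩
    simp only [φ]
    congr 2
    · rw [hc]
      exact normalizedFactors_prod_eq_self_of_subset (Multiset.subset_of_le h1)
    · rw [(associated_iff_normalizedFactors_eq_normalizedFactors (map_ne_zero' hf)
        (Multiset.prod_ne_zero z2)).1 ha, normalizedFactors_prod_eq _
        (fun p hp => irreducible_of_normalized_factor p (Multiset.mem_of_le h2 hp))]
      conv_rhs => rw [← Multiset.map_id m2]
      exact Multiset.map_congr rfl fun p hp =>
        normalize_normalized_factor p (Multiset.mem_of_le h2 hp)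

end backward

open Cardinal in
/-- Corollary 3.9: for a Dedekind domain `D`, the polynomial ring `D[X]` is an IDPD
iff it is an HFD iff the class group of `D` has at most two elements. -/
theorem polynomial_isIDPD_iff (D : Type*) [CommRing D] [IsDomain D] [IsDedekindDomain D] :
    (IsIDPD (Polynomial D) ↔ IsHFD (Polynomial D)) ∧
    (IsHFD (Polynomial D) ↔ #(ClassGroup D) ≤ 2) :=
  ⟨⟨idpd_to_hfd, fun h => idpd_of_card (card_le_of_hfd h)⟩,
    ⟨card_le_of_hfd, fun h => idpd_to_hfd (idpd_of_card h)⟩⟩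
end

section
/- Let D be a Dedekind domain. If the ideal class group ClassGroup D has at most 2 elements, then D is an IDPD. Conversely, if ClassGroup D is a torsion group (every element has finite order), every class in ClassGroup D contains a nonzero prime ideal of D, and D is an IDPD, then ClassGroup D has at most 2 elements. -/
open scoped nonZeroDivisors

set_option linter.overlappingInstances false
set_option linter.unusedSectionVars false

namespace IDPDaux

variable {D : Type*} [CommRing D] [IsDomain D] [IsDedekindDomain D]

/-- The ideal `I` is principal. -/
def Pr (I : Ideal D) : Prop := ∃ x : D, I = Ideal.span {x}

lemma span_mul (a b : D) : (Ideal.span {a} : Ideal D) * Ideal.span {b} = Ideal.span {a * b} :=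
  Ideal.span_singleton_mul_span_singleton a b

lemma span_one_iff (a : D) : (Ideal.span {a} : Ideal D) = 1 ↔ IsUnit a := by
  rw [Ideal.one_eq_top, Ideal.span_singleton_eq_top]

lemma span_zero_iff (a : D) : (Ideal.span {a} : Ideal D) = 0 ↔ a = 0 := by
  rw [Ideal.zero_eq_bot, Ideal.span_singleton_eq_bot]

lemma span_eq_iff (a b : D) : (Ideal.span {a} : Ideal D) = Ideal.span {b} ↔ Associated a b :=
  Ideal.span_singleton_eq_span_singleton

lemma span_dvd (a b : D) : (Ideal.span {a} : Ideal D) ∣ Ideal.span {b} ↔ a ∣ b := by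
  rw [Ideal.dvd_span_singleton, Ideal.mem_span_singleton]

lemma unit_eq {I : Ideal D} (h : IsUnit I) : I = 1 := by
  rw [Ideal.one_eq_top]; exact Ideal.isUnit_iff.1 h

lemma pr_one : Pr (1 : Ideal D) := ⟨1, ((span_one_iff 1).2 isUnit_one).symm⟩

lemma pr_mul {I J : Ideal D} (hI : Pr I) (hJ : Pr J) : Pr (I * J) := by
  obtain ⟨x, rfl⟩ := hI
  obtain ⟨y, rfl⟩ := hJ
  exact ⟨x * y, span_mul x y⟩

lemma pr_of_mul {I J : Ideal D} (h0 : I ≠ 0) (hI : Pr I) (hJ : Pr (I * J)) : Pr J := by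
  obtain ⟨x, rfl⟩ := hI
  obtain ⟨y, hy⟩ := hJ
  have : x ∣ y := by rw [← span_dvd, ← hy]; exact dvd_mul_right _ _
  obtain ⟨w, rfl⟩ := this
  rw [← span_mul] at hy
  exact ⟨w, mul_left_cancel₀ h0 hy⟩

lemma prime_eq {P Q : Ideal D} (hP : Prime P) (hQ : Prime Q) (h : P ∣ Q) : P = Q :=
  associated_iff_eq.1 (hP.associated_of_dvd hQ h)

lemma dvd_prime {P b : Ideal D} (hP : Prime P) (h : b ∣ P) : b = 1 ∨ b = P := by
  rcases hP.irreducible.dvd_iff.1 h with h | h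
  · exact Or.inl (unit_eq h)
  · exact Or.inr (associated_iff_eq.1 h).symm

lemma dvd_prime_mul {P b c : Ideal D} (hP : Prime P) (h : b ∣ P * c) :
    b ∣ c ∨ ∃ b', b = P * b' ∧ b' ∣ c := by
  by_cases hb : P ∣ b
  · obtain ⟨b', rfl⟩ := hb
    exact Or.inr ⟨b', rfl, (mul_dvd_mul_iff_left hP.ne_zero).1 h⟩
  · obtain ⟨d, hd⟩ := h
    have : P ∣ b * d := hd ▸ dvd_mul_right _ _
    obtain ⟨d', rfl⟩ := (hP.dvd_or_dvd this).resolve_left hb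
    left
    refine ⟨d', mul_left_cancel₀ hP.ne_zero ?_⟩
    rw [hd]; ring

lemma dvd_two {P Q b : Ideal D} (hP : Prime P) (hQ : Prime Q) (h : b ∣ P * Q) :
    b = 1 ∨ b = P ∨ b = Q ∨ b = P * Q := by
  rcases dvd_prime_mul hP h with h | ⟨b', rfl, h'⟩
  · rcases dvd_prime hQ h with h | h <;> simp [h]
  · rcases dvd_prime hQ h' with h | h <;> simp [h]

lemma irr_of {x : D} {I : Ideal D} (hx : Ideal.span {x} = I) (h1 : I ≠ 1)
    (h : ∀ A B : Ideal D, Pr A → Pr B → A * B = I → A = 1 ∨ B = 1) : Irreducible x := by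
  subst hx
  refine ⟨fun hu => h1 ((span_one_iff x).2 hu), ?_⟩
  rintro a b rfl
  rw [← span_one_iff, ← span_one_iff]
  exact h _ _ ⟨a, rfl⟩ ⟨b, rfl⟩ (span_mul a b)

lemma irr_two {x : D} {P Q : Ideal D} (hP : Prime P) (hQ : Prime Q) (nP : ¬ Pr P) (nQ : ¬ Pr Q)
    (hx : Ideal.span {x} = P * Q) : Irreducible x := by
  refine irr_of hx (fun h => hP.not_isUnit (IsUnit.of_mul_eq_one Q h)) ?_
  intro A B hA hB hAB
  rcases dvd_two hP hQ (Dvd.intro _ hAB) with h | h | h | h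
  · exact Or.inl h
  · exact absurd (h ▸ hA) nP
  · exact absurd (h ▸ hA) nQ
  · right
    have h0 : P * Q ≠ 0 := mul_ne_zero hP.ne_zero hQ.ne_zero
    rw [h] at hAB
    exact mul_left_cancel₀ h0 (by rw [hAB, mul_one])

lemma irr_three {x : D} {P Q R : Ideal D} (hP : Prime P) (hQ : Prime Q) (hR : Prime R)
    (nP : ¬ Pr P) (nQ : ¬ Pr Q) (nR : ¬ Pr R)
    (hx : Ideal.span {x} = P * (Q * R)) : Irreducible x := by
  have key : ∀ A B : Ideal D, Pr A → Pr B → A * B = P * (Q * R) → P ∣ A → B = 1 := by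
    rintro _ B hA hB hAB ⟨A', rfl⟩
    have h2 : A' * B = Q * R := mul_left_cancel₀ hP.ne_zero (by rw [← hAB]; ring)
    rcases dvd_two hQ hR (Dvd.intro_left _ h2) with h | h | h | h
    · exact h
    · exact absurd (h ▸ hB) nQ
    · exact absurd (h ▸ hB) nR
    · exfalso
      rw [h] at h2
      have h0 : Q * R ≠ 0 := mul_ne_zero hQ.ne_zero hR.ne_zero
      have : A' = 1 := mul_right_cancel₀ h0 (by rw [h2, one_mul])
      rw [this, mul_one] at hA
      exact nP hA
  refine irr_of hx (fun h => hP.not_isUnit (IsUnit.of_mul_eq_one _ h)) ?_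
  intro A B hA hB hAB
  rcases hP.dvd_or_dvd (hAB ▸ dvd_mul_right P (Q * R) : P ∣ A * B) with h | h
  · exact Or.inr (key A B hA hB hAB h)
  · exact Or.inl (key B A hB hA (by rw [mul_comm, hAB]) h)

lemma irr_pow {x : D} {P : Ideal D} {n : ℕ} (hP : Prime P) (hn : n ≠ 0)
    (hord : ∀ i, Pr (P ^ i) → n ∣ i) (hx : Ideal.span {x} = P ^ n) : Irreducible x := by
  refine irr_of hx (fun h => hP.not_isUnit (isUnit_of_dvd_one (h ▸ dvd_pow_self P hn))) ?_
  intro A B hA hB hAB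
  obtain ⟨i, hi, h⟩ := (dvd_prime_pow hP n).1 (Dvd.intro _ hAB)
  have h : A = P ^ i := associated_iff_eq.1 h
  subst h
  rcases Nat.eq_zero_or_pos i with h0 | h0
  · left; simp [h0]
  · right
    have : i = n := le_antisymm hi (Nat.le_of_dvd h0 (hord i hA))
    subst this
    exact mul_left_cancel₀ (pow_ne_zero i hP.ne_zero) (by rw [hAB, mul_one])

lemma exists_prime_factor (I : Ideal D) : I ≠ 0 → ¬ Pr I → ∃ P, Prime P ∧ ¬ Pr P ∧ P ∣ I := by
  refine UniqueFactorizationMonoid.induction_on_prime I ?_ ?_ ?_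
  · intro h; exact absurd rfl h
  · intro x hx _ h
    exact absurd (unit_eq hx ▸ pr_one) h
  · intro a p ha hp ih _ h
    by_cases hpp : Pr p
    · obtain ⟨P, h1, h2, h3⟩ := ih ha (fun h' => h (pr_mul hpp h'))
      exact ⟨P, h1, h2, h3.mul_left p⟩
    · exact ⟨p, hp, hpp, dvd_mul_right _ _⟩

lemma primes_of_irr (H : ∀ I J : Ideal D, I ≠ 0 → J ≠ 0 → ¬ Pr I → ¬ Pr J → Pr (I * J))
    {p : D} (hp : Irreducible p) {G A : Ideal D} (h : Ideal.span {p} = G * A)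
    (nG : ¬ Pr G) (nA : ¬ Pr A) : Prime A := by
  have h0 : G * A ≠ 0 := by
    rw [← h]; exact fun h' => hp.ne_zero ((span_zero_iff p).1 h')
  obtain ⟨R, hR, nR, A', rfl⟩ := exists_prime_factor A (right_ne_zero_of_mul h0) nA
  obtain ⟨S, hS, nS, G', rfl⟩ := exists_prime_factor G (left_ne_zero_of_mul h0) nG
  obtain ⟨x, hx⟩ := H S R hS.ne_zero hR.ne_zero nS nR
  have hxp : x ∣ p := by
    rw [← span_dvd, ← hx, h]
    exact mul_dvd_mul (dvd_mul_right _ _) (dvd_mul_right _ _)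
  rcases hp.dvd_iff.1 hxp with hu | hu
  · rw [← span_one_iff, ← hx] at hu
    exact absurd (IsUnit.of_mul_eq_one _ hu) hS.not_isUnit
  · rw [← span_eq_iff, h, ← hx] at hu
    have h1 : G' * A' = 1 :=
      mul_left_cancel₀ (mul_ne_zero hS.ne_zero hR.ne_zero) (by
        rw [mul_one]; refine Eq.trans ?_ hu; ring)
    have : A' = 1 := unit_eq (isUnit_of_dvd_one (Dvd.intro_left _ h1))
    rw [this, mul_one]; exact hR

lemma atomic : IsAtomicDomain D := by
  intro z hz hu
  obtain ⟨f, h1, h2, -⟩ := (WfDvdMonoid.not_isUnit_iff_exists_factors_eq z hz).1 hu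
  exact ⟨f, h1, h2⟩

lemma forward (H : ∀ I J : Ideal D, I ≠ 0 → J ≠ 0 → ¬ Pr I → ¬ Pr J → Pr (I * J)) :
    IsIDPD D := by
  refine ⟨inferInstance, atomic, ?_⟩
  intro z p q hz _ hp hq hpz hqz hpq
  set G : Ideal D := Ideal.span {p} ⊔ Ideal.span {q} with hG
  by_cases nG : Pr G
  · obtain ⟨g, hg⟩ := nG
    have hgp : g ∣ p := by
      rw [← span_dvd, ← hg, Ideal.dvd_iff_le]; exact le_sup_left
    have hgq : g ∣ q := by
      rw [← span_dvd, ← hg, Ideal.dvd_iff_le]; exact le_sup_right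
    have hgu : IsUnit g := by
      rcases hp.dvd_iff.1 hgp with h | h
      · exact h
      · exact absurd (hp.associated_of_dvd hq (h.dvd.trans hgq)) hpq
    have hc : IsCoprime p q := by
      rw [← Ideal.isCoprime_span_singleton_iff, Ideal.isCoprime_iff_sup_eq, ← hG, hg,
        Ideal.span_singleton_eq_top]
      exact hgu
    refine ⟨q, p, hq, hp, ?_, ?_⟩
    · rw [mul_comm]
    · rw [mul_comm]; exact hc.mul_dvd hpz hqz
  · obtain ⟨A, hA⟩ : G ∣ Ideal.span {p} := by rw [Ideal.dvd_iff_le]; exact le_sup_left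
    obtain ⟨B, hB⟩ : G ∣ Ideal.span {q} := by rw [Ideal.dvd_iff_le]; exact le_sup_right
    have hGA0 : G * A ≠ 0 := by
      rw [← hA]; exact fun h' => hp.ne_zero ((span_zero_iff p).1 h')
    have hG0 := left_ne_zero_of_mul hGA0
    have hGB0 : G * B ≠ 0 := by
      rw [← hB]; exact fun h' => hq.ne_zero ((span_zero_iff q).1 h')
    have nA : ¬ Pr A := fun h =>
      nG (pr_of_mul (right_ne_zero_of_mul hGA0) h (by rw [mul_comm]; exact ⟨p, hA.symm⟩))
    have nB : ¬ Pr B := fun h =>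
      nG (pr_of_mul (right_ne_zero_of_mul hGB0) h (by rw [mul_comm]; exact ⟨q, hB.symm⟩))
    have pA := primes_of_irr H hp hA nG nA
    have pB := primes_of_irr H hq hB nG nB
    have hAB : ¬ B ∣ A := by
      intro h
      have := prime_eq pB pA h
      apply hpq
      rw [← span_eq_iff, hA, hB, this]
    obtain ⟨M, hM⟩ := (span_dvd p z).2 hpz
    have hBM : B ∣ M := by
      have h1 := (span_dvd q z).2 hqz
      rw [hM, hA, hB, mul_assoc, mul_dvd_mul_iff_left hG0] at h1
      exact (pB.dvd_or_dvd h1).resolve_left hAB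
    obtain ⟨C, rfl⟩ := hBM
    have hz0 : Ideal.span {z} ≠ (0 : Ideal D) := fun h' => hz ((span_zero_iff z).1 h')
    have hC0 : C ≠ 0 := by
      rintro rfl
      apply hz0
      rw [hM]; simp
    have nC : ¬ Pr C := by
      intro h
      apply nB
      refine pr_of_mul hC0 h ?_
      rw [mul_comm]
      refine pr_of_mul (fun h' => hp.ne_zero ((span_zero_iff p).1 h')) ⟨p, rfl⟩ ⟨z, hM.symm⟩
    obtain ⟨R, pR, nR, C', rfl⟩ := exists_prime_factor C hC0 nC
    obtain ⟨p', hp'⟩ := H B R pB.ne_zero pR.ne_zero nB nR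
    obtain ⟨q', hq'⟩ := H A R pA.ne_zero pR.ne_zero nA nR
    refine ⟨p', q', irr_two pB pR nB nR hp'.symm, irr_two pA pR nA nR hq'.symm, ?_, ?_⟩
    · rw [← span_eq_iff, ← span_mul, ← span_mul, ← hp', ← hq', hA, hB]; ring
    · rw [← span_dvd, ← span_mul, ← hq', hM, hA, hB]
      exact ⟨C', by ring⟩

lemma assoc_of_idpd (h : IsIDPD D) {p q r s t : D} (hp : Irreducible p) (hq : Irreducible q)
    (hr : Irreducible r) (hs : ¬ IsUnit s) (ht : ¬ IsUnit t)
    (he : Associated (p * r) (q * (s * t))) : Associated p q := by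
  by_contra hpq
  obtain ⟨p', q', hp', hq', h1, h2⟩ := h.2.2 (p * r) p q (mul_ne_zero hp.ne_zero hr.ne_zero)
    (fun hu => hp.not_isUnit (isUnit_of_mul_isUnit_left hu)) hp hq (dvd_mul_right _ _)
    ((dvd_mul_right _ _).trans he.symm.dvd) hpq
  have h3 : p' ∣ r := (mul_dvd_mul_iff_left hp.ne_zero).1 (h1.dvd.trans h2)
  have h4 : Associated p' r := hp'.associated_of_dvd hr h3
  have h5 : Associated (q * q') (q * (s * t)) := h1.symm.trans ((h4.mul_left p).trans he)
  have h6 : Associated q' (s * t) := h5.of_mul_left (Associated.refl q) hq.ne_zero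
  rcases (h6.irreducible hq').isUnit_or_isUnit rfl with h | h
  · exact hs h
  · exact ht h

lemma pr_iff (I : (Ideal D)⁰) : Pr (I : Ideal D) ↔ ClassGroup.mk0 I = 1 := by
  rw [show I = ⟨(I : Ideal D), I.2⟩ from rfl, ClassGroup.mk0_eq_one_iff]
  exact ⟨fun ⟨x, hx⟩ => ⟨x, hx⟩, fun ⟨x, hx⟩ => ⟨x, hx⟩⟩

open Cardinal in
lemma card_fact {G : Type*} [Group G] (h : #G ≤ 2) (x y : G) (hx : x ≠ 1) (hy : y ≠ 1) :
    x * y = 1 := by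
  by_contra hxy
  have hxi : x⁻¹ ≠ 1 := inv_ne_one.2 hx
  have hne : x⁻¹ ≠ y := fun h => hxy (by rw [← h]; simp)
  have hinj : Function.Injective (![1, x⁻¹, y] : Fin 3 → G) := by
    intro i j hij
    fin_cases i <;> fin_cases j <;> simp_all [eq_comm]
  have := Cardinal.lift_mk_le_lift_mk_of_injective hinj
  simp only [Cardinal.mk_fin, Cardinal.lift_natCast, Cardinal.lift_uzero] at this
  have h3 := this.trans h
  norm_cast at h3

open Cardinal in
lemma backward (ht : ∀ g : ClassGroup D, IsOfFinOrder g)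
    (hc : ∀ g : ClassGroup D, ∃ P : (Ideal D)⁰, (P : Ideal D).IsPrime ∧ ClassGroup.mk0 P = g)
    (h : IsIDPD D) : #(ClassGroup D) ≤ 2 := by
  have hpr : ∀ P : (Ideal D)⁰, (P : Ideal D).IsPrime → Prime (P : Ideal D) := fun P hP =>
    Ideal.prime_of_isPrime (nonZeroDivisors.ne_zero P.2) hP
  have h2 : ∀ g : ClassGroup D, g * g = 1 := by
    intro g
    by_contra hg
    have hg1 : g ≠ 1 := by rintro rfl; simp at hg
    obtain ⟨P, hP, hPg⟩ := hc g
    obtain ⟨Q, hQ, hQg⟩ := hc g⁻¹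
    have pP := hpr P hP
    have pQ := hpr Q hQ
    have nP : ¬ Pr (P : Ideal D) := by rw [pr_iff, hPg]; exact hg1
    have nQ : ¬ Pr (Q : Ideal D) := by rw [pr_iff, hQg]; exact inv_ne_one.2 hg1
    obtain ⟨n, hn⟩ : ∃ n, n = orderOf g := ⟨_, rfl⟩
    have hn0 : 0 < n := hn ▸ (ht g).orderOf_pos
    have hn1 : n ≠ 1 := fun h' => hg1 (orderOf_eq_one_iff.1 (hn ▸ h'))
    have hn2 : n ≠ 2 := fun h' => hg (by rw [← pow_two, ← h', hn, pow_orderOf_eq_one])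
    obtain ⟨m, rfl⟩ : ∃ m, n = m + 3 := ⟨n - 3, by omega⟩
    have oP : ∀ i, Pr ((P : Ideal D) ^ i) ↔ m + 3 ∣ i := by
      intro i
      rw [← SubmonoidClass.coe_pow, pr_iff, map_pow, hPg, hn, orderOf_dvd_iff_pow_eq_one]
    have oQ : ∀ i, Pr ((Q : Ideal D) ^ i) ↔ m + 3 ∣ i := by
      intro i
      rw [← SubmonoidClass.coe_pow, pr_iff, map_pow, hQg, hn, ← orderOf_inv,
        orderOf_dvd_iff_pow_eq_one]
    obtain ⟨p, hp⟩ := (oP (m + 3)).2 dvd_rfl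
    obtain ⟨r, hr⟩ := (oQ (m + 3)).2 dvd_rfl
    obtain ⟨q, hq⟩ : Pr ((P : Ideal D) * (Q : Ideal D)) := by
      rw [← Submonoid.coe_mul, pr_iff, map_mul, hPg, hQg]; simp
    have ip := irr_pow pP (by omega) (fun i => (oP i).1) hp.symm
    have ir := irr_pow pQ (by omega) (fun i => (oQ i).1) hr.symm
    have iq := irr_two pP pQ nP nQ hq.symm
    have key := assoc_of_idpd (s := q) (t := q ^ (m + 1)) h ip iq ir iq.not_isUnit
      (fun hu => iq.not_isUnit ((isUnit_pow_iff (by omega)).1 hu)) (by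
        rw [← pow_succ', ← pow_succ', ← span_eq_iff, ← span_mul, ← hp, ← hr,
          ← Ideal.span_singleton_pow, ← hq]
        ring)
    rw [← span_eq_iff, ← hp, ← hq, pow_succ'] at key
    have e := mul_left_cancel₀ pP.ne_zero key
    rw [pow_succ'] at e
    rcases (e ▸ pQ).irreducible.isUnit_or_isUnit rfl with hu | hu
    · exact pP.not_isUnit hu
    · exact pP.not_isUnit ((isUnit_pow_iff (by omega)).1 hu)
  by_contra hcard
  have h3 : (3 : Cardinal) ≤ #(ClassGroup D) := by
    have := Order.succ_le_of_lt (not_le.1 hcard)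
    have e : Order.succ (2 : Cardinal) = 3 := by
      have := Cardinal.succ_natCast 2
      norm_num at this
      exact this
    rwa [e] at this
  obtain ⟨a, ha, -⟩ := Cardinal.exists_ne_ne_of_three_le h3 1 1
  obtain ⟨b, hb, hab⟩ := Cardinal.exists_ne_ne_of_three_le h3 1 a
  obtain ⟨P, hP, hPg⟩ := hc a
  obtain ⟨Q, hQ, hQg⟩ := hc b
  obtain ⟨R, hR, hRg⟩ := hc (a * b)
  have pP := hpr P hP
  have pQ := hpr Q hQ
  have pR := hpr R hR
  have nP : ¬ Pr (P : Ideal D) := by rw [pr_iff, hPg]; exact ha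
  have nQ : ¬ Pr (Q : Ideal D) := by rw [pr_iff, hQg]; exact hb
  have nR : ¬ Pr (R : Ideal D) := by
    rw [pr_iff, hRg]
    intro hh
    exact hab (mul_left_cancel (hh.trans (h2 a).symm))
  have sq : ∀ S : (Ideal D)⁰, Pr ((S : Ideal D) * (S : Ideal D)) := by
    intro S
    rw [← Submonoid.coe_mul, pr_iff, map_mul, h2]
  obtain ⟨q, hq⟩ := sq P
  obtain ⟨s, hs⟩ := sq Q
  obtain ⟨t, ht'⟩ := sq R
  obtain ⟨p, hp⟩ : Pr ((P : Ideal D) * ((Q : Ideal D) * (R : Ideal D))) := by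
    rw [← Submonoid.coe_mul, ← Submonoid.coe_mul, pr_iff, map_mul, map_mul, hPg, hQg, hRg,
      ← mul_assoc, h2]
  have ip := irr_three pP pQ pR nP nQ nR hp.symm
  have key := assoc_of_idpd h ip (irr_two pP pP nP nP hq.symm) ip
    (irr_two pQ pQ nQ nQ hs.symm).not_isUnit (irr_two pR pR nR nR ht'.symm).not_isUnit (by
      rw [← span_eq_iff, ← span_mul, ← span_mul, ← span_mul, ← hp, ← hq, ← hs, ← ht']
      ring)
  rw [← span_eq_iff, ← hp, ← hq] at key
  have e := mul_left_cancel₀ pP.ne_zero key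
  rcases (e ▸ pP).irreducible.isUnit_or_isUnit rfl with hu | hu
  · exact pQ.not_isUnit hu
  · exact pR.not_isUnit hu

end IDPDaux


open Cardinal in
/-- Corollary 3.10: a Dedekind domain with at most two ideal classes is an IDPD;
conversely, if the class group is torsion, every class contains a nonzero prime
ideal, and `D` is an IDPD, then there are at most two ideal classes. -/
theorem dedekind_isIDPD_of_card_le_two (D : Type*) [CommRing D] [IsDomain D]
    [IsDedekindDomain D] :
    (#(ClassGroup D) ≤ 2 → IsIDPD D) ∧
    ((∀ g : ClassGroup D, IsOfFinOrder g) →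
      (∀ g : ClassGroup D, ∃ P : (Ideal D)⁰, (P : Ideal D).IsPrime ∧
        ClassGroup.mk0 P = g) →
      IsIDPD D → #(ClassGroup D) ≤ 2) := by

  refine ⟨fun hcard => IDPDaux.forward ?_, IDPDaux.backward⟩
  intro I J hI hJ nI nJ
  have hI' : I ∈ (Ideal D)⁰ := mem_nonZeroDivisors_of_ne_zero hI
  have hJ' : J ∈ (Ideal D)⁰ := mem_nonZeroDivisors_of_ne_zero hJ
  have h1 := IDPDaux.pr_iff (⟨I, hI'⟩ : (Ideal D)⁰)
  have h2 := IDPDaux.pr_iff (⟨J, hJ'⟩ : (Ideal D)⁰)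
  have h3 := IDPDaux.pr_iff (⟨I, hI'⟩ * ⟨J, hJ'⟩ : (Ideal D)⁰)
  refine h3.2 ?_
  rw [map_mul]
  exact IDPDaux.card_fact hcard _ _ (fun h => nI (h1.2 h)) (fun h => nJ (h2.2 h))
end
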